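/- Let (a_i)_{i≥0} be a sequence with a_0 ∈ S_p and a_i ∈ S'_p for all i ≥ 1 which is quasi-periodic with data (n_i), (λ_i), (k_i) satisfying the exact relation n_{i+1} = n_i + λ_i·k_i for all i, i.e. the continued fraction has the form [a_0, …, a_{n_0−1}, (a_{n_0}, …, a_{n_0+k_0−1}) repeated λ_0 times, (a_{n_1}, …, a_{n_1+k_1−1}) repeated λ_1 times, …]. Assume (a_i) is not ultimately periodic, the sequences (|a_i|_p)_{i≥0} and (k_i)_{i≥0} are bounded, and liminf_{i→∞} λ_i/λ_{i−1} > 4. Then the value α of [a_0, a_1, a_2, …] is either algebraic of degree exactly 2 over ℚ or transcendental over ℚ. -/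

import Mathlib

open Filter Polynomial

/-- `S_p`: rationals `b` with `b·p^k ∈ ℤ` for some `k ≥ 0` and `0 ≤ b < p`. -/
def Sp (p : ℕ) : Set ℚ :=
  {b : ℚ | (∃ k : ℕ, ∃ z : ℤ, (z : ℚ) = b * (p : ℚ) ^ k) ∧ 0 ≤ b ∧ b < (p : ℚ)}

/-- `S'_p`: elements of `S_p` with `|b|_p ≥ p`. -/
def Sp' (p : ℕ) : Set ℚ :=
  {b : ℚ | b ∈ Sp p ∧ (p : ℚ) ≤ padicNorm p b}

/-- Denominators of the convergents, with shifted index: `rubanQ a 0 = q_{-1} = 0`,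
`rubanQ a 1 = q_0 = 1`, and `rubanQ a (n+1) = q_n = a_n q_{n-1} + q_{n-2}`. -/
def rubanQ (a : ℕ → ℚ) : ℕ → ℚ
  | 0 => 0
  | 1 => 1
  | n + 2 => a (n + 1) * rubanQ a (n + 1) + rubanQ a n

/-- Numerators of the convergents, with shifted index: `rubanR a 0 = r_{-1} = 1`,
`rubanR a 1 = r_0 = a_0`, and `rubanR a (n+1) = r_n = a_n r_{n-1} + r_{n-2}`. -/
def rubanR (a : ℕ → ℚ) : ℕ → ℚ
  | 0 => 1
  | 1 => a 0
  | n + 2 => a (n + 1) * rubanR a (n + 1) + rubanR a n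

/-- `α` is the value of the infinite Ruban continued fraction `[a_0, a_1, …]`, i.e. the
limit in `ℚ_p` of the convergents `r_n / q_n`. -/
def IsRubanValue (p : ℕ) [Fact p.Prime] (a : ℕ → ℚ) (α : ℚ_[p]) : Prop :=
  Filter.Tendsto (fun n : ℕ => ((rubanR a (n + 1) / rubanQ a (n + 1) : ℚ) : ℚ_[p]))
    Filter.atTop (nhds α)

/-- A sequence is ultimately periodic if `a_{n+l} = a_n` for all `n ≥ k`,
for some `k ≥ 0`, `l ≥ 1`. -/
def UltimatelyPeriodic (a : ℕ → ℚ) : Prop :=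
  ∃ k l : ℕ, 1 ≤ l ∧ ∀ n, k ≤ n → a (n + l) = a n

/-! ## Diagonal operators on polynomials -/

/-- The product of the binomial coefficients of the entries of two multi-indices. -/
def mchoose {σ : Type*} [Fintype σ] (f e : σ →₀ ℕ) : ℕ := ∏ j, (f j).choose (e j)

/-- The diagonal operator `X^e · ∂^e / e!`, which multiplies the monomial `X^f` by the
binomial coefficient of `f` over `e`. -/
noncomputable def theta {σ R : Type*} [Fintype σ] [CommSemiring R] (e : σ →₀ ℕ) :
    MvPolynomial σ R →ₗ[R] MvPolynomial σ R :=
  (MvPolynomial.basisMonomials σ R).constr R fun f => MvPolynomial.monomial f (mchoose f e : R)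

section Theta

variable {σ R L : Type*} [Fintype σ] [CommRing R] [CommRing L] [Algebra R L]

theorem theta_monomial (e f : σ →₀ ℕ) (c : R) :
    theta e (MvPolynomial.monomial f c) = MvPolynomial.monomial f ((mchoose f e : R) * c) := by
  have h : MvPolynomial.monomial f c = c • MvPolynomial.basisMonomials σ R f := by
    simp [MvPolynomial.smul_monomial]
  rw [h, map_smul, theta, Module.Basis.constr_basis, MvPolynomial.smul_monomial, smul_eq_mul,
    mul_comm]

theorem coeff_theta (e f : σ →₀ ℕ) (P : MvPolynomial σ R) :
    MvPolynomial.coeff f (theta e P) = (mchoose f e : R) * MvPolynomial.coeff f P := by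
  classical
  induction P using MvPolynomial.induction_on' with
  | monomial u a =>
    rw [theta_monomial, MvPolynomial.coeff_monomial, MvPolynomial.coeff_monomial]
    split_ifs with h
    · rw [h]
    · simp
  | add p q hp hq => rw [map_add, MvPolynomial.coeff_add, hp, hq, MvPolynomial.coeff_add, mul_add]

theorem map_theta {A B : Type*} [CommRing A] [CommRing B] (φ : A →+* B) (e : σ →₀ ℕ)
    (P : MvPolynomial σ A) :
    MvPolynomial.map φ (theta e P) = theta e (MvPolynomial.map φ P) := by
  ext f
  simp [coeff_theta, MvPolynomial.coeff_map]

/-- The substitution `X_j ↦ ξ_j (1 + X_j)`, whose coefficients are the values at `ξ` of the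
polynomials `theta e P`. -/
noncomputable def dilate (ξ : σ → L) : MvPolynomial σ R →ₐ[R] MvPolynomial σ L :=
  MvPolynomial.aeval fun j => MvPolynomial.C (ξ j) * (1 + MvPolynomial.X j)

theorem coeff_prod_one_add_X_pow {A : Type*} [CommRing A] (f e : σ →₀ ℕ) :
    MvPolynomial.coeff e (∏ j, (1 + MvPolynomial.X j : MvPolynomial σ A) ^ f j) =
      (mchoose f e : A) := by
  classical
  have h1 : ∀ j, (1 + MvPolynomial.X j : MvPolynomial σ A) ^ f j =
      ∑ k ∈ Finset.range (f j + 1),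
        MvPolynomial.monomial (Finsupp.single j k) (((f j).choose k : ℕ) : A) := by
    intro j
    rw [add_comm, add_pow]
    refine Finset.sum_congr rfl fun k _ => ?_
    rw [one_pow, mul_one, MvPolynomial.X_pow_eq_monomial, ← map_natCast MvPolynomial.C,
      mul_comm, MvPolynomial.C_mul_monomial, mul_one]
  have h2 : ∀ x : σ → ℕ, ∏ j, MvPolynomial.monomial (Finsupp.single j (x j))
      (((f j).choose (x j) : ℕ) : A) =
      MvPolynomial.monomial (Finsupp.equivFunOnFinite.symm x)
        (∏ j, (((f j).choose (x j) : ℕ) : A)) := by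
    intro x
    have : Finsupp.equivFunOnFinite.symm x = ∑ j, Finsupp.single j (x j) := by
      ext j; simp [Finsupp.finsetSum_apply, Finsupp.single_apply]
    rw [this, MvPolynomial.monomial_sum_prod]
  simp_rw [h1, Finset.prod_univ_sum, h2, MvPolynomial.coeff_sum, MvPolynomial.coeff_monomial]
  rw [Finset.sum_eq_single (⇑e)]
  · rw [if_pos (by ext; simp), mchoose, Nat.cast_prod]
  · intro x _ hx
    rw [if_neg]
    rintro rfl
    exact hx (by ext; simp)
  · intro he
    rw [if_pos (by ext; simp)]
    simp only [Fintype.mem_piFinset, Finset.mem_range, not_forall, not_lt] at he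
    obtain ⟨j, hj⟩ := he
    exact Finset.prod_eq_zero (Finset.mem_univ j) (by rw [Nat.choose_eq_zero_of_lt (by omega)]; simp)

theorem coeff_dilate (ξ : σ → L) (e : σ →₀ ℕ) (P : MvPolynomial σ R) :
    MvPolynomial.coeff e (dilate ξ P) = MvPolynomial.aeval ξ (theta e P) := by
  induction P using MvPolynomial.induction_on' with
  | monomial u a =>
    rw [theta_monomial, dilate, MvPolynomial.aeval_monomial, MvPolynomial.aeval_monomial,
      Finsupp.prod_fintype _ _ (by simp), Finsupp.prod_fintype _ _ (by simp)]
    simp_rw [mul_pow, Finset.prod_mul_distrib, ← map_pow, ← map_prod]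
    rw [IsScalarTower.algebraMap_apply R L (MvPolynomial σ L), MvPolynomial.algebraMap_eq,
      MvPolynomial.coeff_C_mul, MvPolynomial.coeff_C_mul, coeff_prod_one_add_X_pow]
    simp only [map_mul, map_natCast]
    ring
  | add p q hp hq => simp only [map_add, MvPolynomial.coeff_add, hp, hq]

theorem choose_mul_choose_eq_sum (e i : ℕ) : ∃ c : ℕ → ℚ, ∀ f : ℕ,
    ((f.choose e * f.choose i : ℕ) : ℚ) = ∑ l ∈ Finset.range (e + i + 1), c l * f.choose l := by
  induction i with
  | zero =>
    refine ⟨fun l => if l = e then 1 else 0, fun f => ?_⟩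
    simp
  | succ i ih =>
    obtain ⟨c, hc⟩ := ih
    refine ⟨fun l => (if l = 0 then 0 else c (l - 1) * l / (i + 1)) +
      (if l < e + i + 1 then c l * (l - i) / (i + 1) else 0), fun f => ?_⟩
    have key : ∀ l : ℕ, ((f.choose (l + 1) : ℕ) : ℚ) * (l + 1) = f.choose l * (f - l) := by
      intro l
      rcases le_or_gt l f with h | h
      · have := Nat.choose_succ_right_eq f l
        rw [← Nat.cast_sub h]
        exact_mod_cast this
      · rw [Nat.choose_eq_zero_of_lt h, Nat.choose_eq_zero_of_lt (by omega)]
        simp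
    have hi : ((i : ℚ) + 1) ≠ 0 := by positivity
    have h1 : ((f.choose e * f.choose (i + 1) : ℕ) : ℚ) =
        (∑ l ∈ Finset.range (e + i + 1), c l * f.choose l) * (f - i) / (i + 1) := by
      rw [← hc f, eq_div_iff hi]
      push_cast
      rw [mul_assoc, key i]
      ring
    rw [h1, show e + (i + 1) + 1 = (e + i + 1) + 1 by ring]
    simp_rw [add_mul, Finset.sum_add_distrib]
    rw [Finset.sum_range_succ' (fun l => (if l = 0 then (0:ℚ) else c (l - 1) * l / (i + 1)) *
      (f.choose l : ℚ)), Finset.sum_range_succ (fun l => (if l < e + i + 1 then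
        c l * (l - i) / (i + 1) else (0:ℚ)) * (f.choose l : ℚ))]
    simp only [if_true, zero_mul, add_zero, lt_irrefl, if_false]
    rw [← Finset.sum_add_distrib, Finset.sum_mul, Finset.sum_div]
    refine Finset.sum_congr rfl fun l hl => ?_
    rw [if_neg (by omega), if_pos (Finset.mem_range.mp hl)]
    have := key l
    push_cast
    field_simp
    linear_combination (-c l) * this

/-- If all the values `theta l P (ξ)` with `l ≤ e + i` vanish, so does
`theta e (theta i P) (ξ)`. -/
theorem aeval_theta_theta_eq_zero [Algebra ℚ L] (ξ : σ → L) (P : MvPolynomial σ R)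
    (e i : σ →₀ ℕ)
    (h : ∀ l : σ →₀ ℕ, l ≤ e + i → MvPolynomial.aeval ξ (theta l P) = 0) :
    MvPolynomial.aeval ξ (theta e (theta i P)) = 0 := by
  classical
  have hval : ∀ l : σ →₀ ℕ, MvPolynomial.aeval ξ (theta l P) =
      ∑ f ∈ P.support, (mchoose f l : L) * (algebraMap R L (P.coeff f) * ∏ j, ξ j ^ f j) := by
    intro l
    conv_lhs => rw [P.as_sum]
    rw [map_sum, map_sum]
    refine Finset.sum_congr rfl fun f _ => ?_
    rw [theta_monomial, MvPolynomial.aeval_monomial, Finsupp.prod_fintype _ _ (by simp), map_mul,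
      map_natCast, mul_assoc]
  have hval2 : MvPolynomial.aeval ξ (theta e (theta i P)) =
      ∑ f ∈ P.support, ((mchoose f e * mchoose f i : ℕ) : L) *
        (algebraMap R L (P.coeff f) * ∏ j, ξ j ^ f j) := by
    conv_lhs => rw [P.as_sum]
    rw [map_sum, map_sum, map_sum]
    refine Finset.sum_congr rfl fun f _ => ?_
    rw [theta_monomial, theta_monomial, MvPolynomial.aeval_monomial,
      Finsupp.prod_fintype _ _ (by simp)]
    simp only [map_mul, map_natCast, Nat.cast_mul]
    ring
  choose c hc using fun j => choose_mul_choose_eq_sum (e j) (i j)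
  have hexp : ∀ f : σ →₀ ℕ, ((mchoose f e * mchoose f i : ℕ) : L) =
      ∑ x ∈ Fintype.piFinset fun j => Finset.range (e j + i j + 1),
        algebraMap ℚ L (∏ j, c j (x j)) * (mchoose f (Finsupp.equivFunOnFinite.symm x) : L) := by
    intro f
    have : ((mchoose f e * mchoose f i : ℕ) : ℚ) =
      ∑ x ∈ Fintype.piFinset fun j => Finset.range (e j + i j + 1),
        (∏ j, c j (x j)) * (mchoose f (Finsupp.equivFunOnFinite.symm x) : ℚ) := by
      rw [mchoose, mchoose, ← Finset.prod_mul_distrib, Nat.cast_prod,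
        Finset.prod_congr rfl fun j _ => hc j (f j), Finset.prod_univ_sum]
      refine Finset.sum_congr rfl fun x _ => ?_
      rw [Finset.prod_mul_distrib, mchoose, Nat.cast_prod]
      simp
    have := congrArg (algebraMap ℚ L) this
    simpa only [map_natCast, map_sum, map_mul] using this
  rw [hval2]
  simp_rw [hexp, Finset.sum_mul]
  rw [Finset.sum_comm]
  refine Finset.sum_eq_zero fun x hx => ?_
  simp_rw [mul_assoc]
  rw [← Finset.mul_sum, ← hval, h, mul_zero]
  intro j
  have := Finset.mem_range.mp (Fintype.mem_piFinset.mp hx j)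
  simp only [Finsupp.equivFunOnFinite_symm_apply_apply, Finsupp.add_apply]
  omega

end Theta

/-! ## Generalized Wronskians -/

theorem prod_natCast_sub_eq_sum_choose {ι : Type*} (T : Finset ι) (e : ι → ℕ) (t : ℕ)
    (ht : T.card ≤ t) : ∃ d : ℕ → ℚ, ∀ x : ℕ,
      ∏ b ∈ T, ((x : ℚ) - e b) = ∑ l ∈ Finset.range (t + 1), d l * x.choose l := by
  classical
  induction T using Finset.induction_on generalizing t with
  | empty => exact ⟨fun l => if l = 0 then 1 else 0, fun x => by simp⟩
  | insert b T hb ih =>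
    rw [Finset.card_insert_of_notMem hb] at ht
    obtain ⟨t, rfl⟩ : ∃ t', t = t' + 1 := ⟨t - 1, by omega⟩
    obtain ⟨d, hd⟩ := ih t (by omega)
    refine ⟨fun l => (if l = 0 then 0 else d (l - 1) * l) +
      (if l < t + 1 then d l * (l - e b) else 0), fun x => ?_⟩
    have key : ∀ l : ℕ, ((x.choose (l + 1) : ℕ) : ℚ) * (l + 1) = x.choose l * (x - l) := by
      intro l
      rcases le_or_gt l x with h | h
      · have := Nat.choose_succ_right_eq x l
        rw [← Nat.cast_sub h]
        exact_mod_cast this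
      · rw [Nat.choose_eq_zero_of_lt h, Nat.choose_eq_zero_of_lt (by omega)]
        simp
    rw [Finset.prod_insert hb, hd]
    simp_rw [add_mul, Finset.sum_add_distrib]
    rw [Finset.sum_range_succ' (fun l => (if l = 0 then (0:ℚ) else d (l - 1) * l) *
      (x.choose l : ℚ)), Finset.sum_range_succ (fun l => (if l < t + 1 then
        d l * (l - e b) else (0:ℚ)) * (x.choose l : ℚ))]
    simp only [if_true, zero_mul, add_zero, lt_irrefl, if_false]
    rw [← Finset.sum_add_distrib, Finset.mul_sum]
    refine Finset.sum_congr rfl fun l hl => ?_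
    rw [if_neg (by omega), if_pos (Finset.mem_range.mp hl)]
    have := key l
    push_cast
    linear_combination (-d l) * this

theorem exists_det_mchoose_ne_zero {n s : ℕ} (e : Fin s → (Fin n →₀ ℕ))
    (he : Function.Injective e) : ∃ i : Fin s → (Fin n →₀ ℕ), (∀ a j, i a j < s) ∧
      (Matrix.of fun a b => (mchoose (e b) (i a) : ℚ)).det ≠ 0 := by
  classical
  let W : Set (Fin s → ℚ) :=
    {w | ∃ i : Fin n →₀ ℕ, (∀ j, i j < s) ∧ w = fun b => (mchoose (e b) i : ℚ)}
  have hspan : Submodule.span ℚ W = ⊤ := by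
    rw [eq_top_iff, ← (Pi.basisFun ℚ (Fin s)).span_eq, Submodule.span_le]
    rintro _ ⟨b, rfl⟩
    let T : Fin n → Finset (Fin s) := fun c => Finset.univ.filter fun b' => e b' c ≠ e b c
    have hT : ∀ c, (T c).card ≤ s - 1 := by
      intro c
      have : T c ⊆ Finset.univ.erase b := by
        intro b' hb'
        refine Finset.mem_erase.mpr ⟨?_, Finset.mem_univ _⟩
        rintro rfl
        exact (Finset.mem_filter.mp hb').2 rfl
      calc (T c).card ≤ (Finset.univ.erase b).card := Finset.card_le_card this
        _ = s - 1 := by simp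
    have hs : s - 1 + 1 = s := Nat.sub_add_cancel (Fin.pos b)
    choose d hd using fun c => prod_natCast_sub_eq_sum_choose (T c) (fun b' => e b' c) _ (hT c)
    have hexp : ∀ b', ∏ c, ∏ b'' ∈ T c, ((e b' c : ℚ) - e b'' c) =
        ∑ x ∈ Fintype.piFinset fun _ : Fin n => Finset.range s,
          (∏ c, d c (x c)) * (mchoose (e b') (Finsupp.equivFunOnFinite.symm x) : ℚ) := by
      intro b'
      rw [Finset.prod_congr rfl fun c _ => hd c (e b' c), Finset.prod_univ_sum]
      rw [hs]
      refine Finset.sum_congr rfl fun x _ => ?_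
      rw [Finset.prod_mul_distrib, mchoose, Nat.cast_prod]
      simp
    have hne : ∏ c, ∏ b'' ∈ T c, ((e b c : ℚ) - e b'' c) ≠ 0 := by
      refine Finset.prod_ne_zero_iff.mpr fun c _ => Finset.prod_ne_zero_iff.mpr fun b'' hb'' => ?_
      have := (Finset.mem_filter.mp hb'').2
      rw [sub_ne_zero]
      exact_mod_cast this.symm
    have hvec : (Pi.basisFun ℚ (Fin s) b) =
        (∏ c, ∏ b'' ∈ T c, ((e b c : ℚ) - e b'' c))⁻¹ •
        ∑ x ∈ Fintype.piFinset fun _ : Fin n => Finset.range s,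
          (∏ c, d c (x c)) •
            fun b' => (mchoose (e b') (Finsupp.equivFunOnFinite.symm x) : ℚ) := by
      ext b'
      simp only [Pi.smul_apply, Finset.sum_apply, smul_eq_mul]
      rw [← hexp b']
      by_cases hb : b' = b
      · subst hb
        rw [inv_mul_cancel₀ hne]
        simp
      · obtain ⟨c, hc⟩ := DFunLike.ne_iff.mp (fun h => hb (he h) : e b' ≠ e b)
        have h0 : ∏ c, ∏ b'' ∈ T c, ((e b' c : ℚ) - e b'' c) = 0 :=
          Finset.prod_eq_zero (Finset.mem_univ c) (Finset.prod_eq_zero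
            (Finset.mem_filter.mpr ⟨Finset.mem_univ b', hc⟩) (sub_self _))
        rw [h0]
        simp [hb]
    rw [SetLike.mem_coe, hvec]
    refine Submodule.smul_mem _ _ (Submodule.sum_mem _ fun x hx => Submodule.smul_mem _ _
      (Submodule.subset_span ⟨_, fun j => ?_, rfl⟩))
    simpa using Fintype.mem_piFinset.mp hx j
  obtain ⟨v, hvW, -, hv⟩ := Submodule.exists_fun_fin_finrank_span_eq ℚ W
  have hfr : Module.finrank ℚ (Submodule.span ℚ W) = s := by rw [hspan]; simp
  let v' : Fin s → (Fin s → ℚ) := fun a => v (Fin.cast hfr.symm a)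
  have hv' : LinearIndependent ℚ v' := hv.comp _ (Fin.cast_injective _)
  choose i hi hiv using fun a => hvW (Fin.cast hfr.symm a)
  refine ⟨i, hi, ?_⟩
  have hM : (Matrix.of fun a b => (mchoose (e b) (i a) : ℚ)) = Matrix.of v' := by
    ext a b
    simp [v', hiv]
  rw [hM]
  have := Matrix.linearIndependent_rows_iff_isUnit.mp (show LinearIndependent ℚ (Matrix.of v').row from hv')
  rw [Matrix.isUnit_iff_isUnit_det] at this
  exact this.ne_zero

theorem MonomialOrder.coeff_sum_prod_of_degree_le {σ R ι : Type*} [CommRing R]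
    (m : MonomialOrder σ) (T : Finset ι) (P : ι → MvPolynomial σ R) (e : ι → σ →₀ ℕ)
    (h : ∀ b ∈ T, m.toSyn (m.degree (P b)) ≤ m.toSyn (e b)) :
    m.toSyn (m.degree (∏ b ∈ T, P b)) ≤ m.toSyn (∑ b ∈ T, e b) ∧
    MvPolynomial.coeff (∑ b ∈ T, e b) (∏ b ∈ T, P b) = ∏ b ∈ T, (P b).coeff (e b) := by
  classical
  induction T using Finset.induction_on with
  | empty => simp
  | insert b T hb ih =>
    obtain ⟨ih1, ih2⟩ := ih fun b hb => h b (Finset.mem_insert_of_mem hb)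
    have hb' := h b (Finset.mem_insert_self b T)
    rw [Finset.prod_insert hb, Finset.sum_insert hb, Finset.prod_insert hb]
    refine ⟨(m.degree_mul_le).trans ?_, ?_⟩
    · rw [map_add, map_add]
      exact add_le_add hb' ih1
    · rw [m.coeff_mul_of_add_of_degree_le hb' ih1, ih2]

theorem det_theta_ne_zero_of_degree {n s : ℕ} (m : MonomialOrder (Fin n))
    (g : Fin s → MvPolynomial (Fin n) ℚ) (hg : ∀ b, g b ≠ 0) (i : Fin s → (Fin n →₀ ℕ))
    (h : (Matrix.of fun a b => (mchoose (m.degree (g b)) (i a) : ℚ)).det ≠ 0) :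
    (Matrix.of fun a b => theta (i a) (g b)).det ≠ 0 := by
  intro h0
  apply_fun MvPolynomial.coeff (∑ b, m.degree (g b)) at h0
  rw [Matrix.det_apply, MvPolynomial.coeff_sum, MvPolynomial.coeff_zero] at h0
  refine mul_ne_zero h (Finset.prod_ne_zero_iff.mpr fun b _ =>
    (m.coeff_degree_ne_zero_iff).mpr (hg b) : ∏ b, (g b).coeff (m.degree (g b)) ≠ 0) ?_
  rw [← h0, Matrix.det_apply, Finset.sum_mul]
  refine Finset.sum_congr rfl fun π _ => ?_
  have hle : ∀ b ∈ Finset.univ, m.toSyn (m.degree (theta (i (π b)) (g b))) ≤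
      m.toSyn (m.degree (g b)) := by
    intro b _
    refine m.degree_le_iff.mpr fun c hc => m.le_degree ?_
    rw [MvPolynomial.mem_support_iff, coeff_theta] at hc
    exact MvPolynomial.mem_support_iff.mpr (right_ne_zero_of_mul hc)
  have := (MonomialOrder.coeff_sum_prod_of_degree_le m Finset.univ
    (fun b => theta (i (π b)) (g b)) (fun b => m.degree (g b)) hle).2
  rw [MvPolynomial.coeff_smul]
  simp only [Matrix.of_apply]
  rw [this]
  simp_rw [coeff_theta, Finset.prod_mul_distrib, smul_mul_assoc]

/-- A nonzero generalized Wronskian of linearly independent polynomials. -/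
theorem exists_det_theta_ne_zero {n s : ℕ} (f : Fin s → MvPolynomial (Fin n) ℚ)
    (hf : LinearIndependent ℚ f) : ∃ i : Fin s → (Fin n →₀ ℕ), (∀ a j, i a j < s) ∧
      (Matrix.of fun a b => theta (i a) (f b)).det ≠ 0 := by
  classical
  let m : MonomialOrder (Fin n) := MonomialOrder.lex
  let V := Submodule.span ℚ (Set.range f)
  have hV : Module.finrank ℚ V = s := by
    simpa using finrank_span_eq_card hf
  let D : Set (Fin n →₀ ℕ) := {d | ∃ v ∈ V, v ≠ 0 ∧ m.degree v = d}
  let S : Finset (Fin n →₀ ℕ) := Finset.univ.biUnion fun b => (f b).support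
  have hVS : ∀ v ∈ V, v.support ⊆ S := by
    intro v hv
    induction hv using Submodule.span_induction with
    | mem x hx =>
      obtain ⟨b, rfl⟩ := hx
      exact Finset.subset_biUnion_of_mem (fun b => (f b).support) (Finset.mem_univ b)
    | zero => simp
    | add x y _ _ hx hy => exact MvPolynomial.support_add.trans (Finset.union_subset hx hy)
    | smul c x _ hx => exact MvPolynomial.support_smul.trans hx
  have hDfin : D.Finite := by
    refine S.finite_toSet.subset ?_
    rintro _ ⟨v, hv, hv0, rfl⟩
    exact hVS v hv (MvPolynomial.mem_support_iff.mpr (m.coeff_degree_ne_zero_iff.mpr hv0))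
  have : Fintype D := hDfin.fintype
  let φ : V →ₗ[ℚ] (D → ℚ) := LinearMap.pi fun d => (MvPolynomial.lcoeff ℚ d.1).comp V.subtype
  have hφ : Function.Injective φ := by
    rw [injective_iff_map_eq_zero]
    intro v hv
    by_contra hne
    have hv0 : (v : MvPolynomial (Fin n) ℚ) ≠ 0 := fun h => hne (Subtype.ext h)
    have := congrFun hv ⟨m.degree v.1, v.1, v.2, hv0, rfl⟩
    exact m.coeff_degree_ne_zero_iff.mpr hv0 (by simpa [φ] using this)
  have hcard : s ≤ Fintype.card D := by
    have := LinearMap.finrank_le_finrank_of_injective hφ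
    rwa [hV, Module.finrank_fintype_fun_eq_card] at this
  obtain ⟨ι⟩ : Nonempty (Fin s ↪ D) := Function.Embedding.nonempty_of_card_le (by simpa using hcard)
  choose g hgV hg0 hgd using fun b => (ι b).2
  obtain ⟨i, hi, hdet⟩ := exists_det_mchoose_ne_zero (fun b => m.degree (g b)) (by
    intro b b' h
    simp only [hgd] at h
    exact ι.injective (Subtype.ext h))
  refine ⟨i, hi, fun h0 => det_theta_ne_zero_of_degree m g hg0 i hdet ?_⟩
  choose A hA using fun b => (Submodule.mem_span_range_iff_exists_fun ℚ).mp (hgV b)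
  have : (Matrix.of fun a b => theta (i a) (g b)) =
      (Matrix.of fun a b => theta (i a) (f b)) *
        (Matrix.of fun c b => MvPolynomial.C (A b c)) := by
    ext1 a b
    rw [Matrix.mul_apply, Matrix.of_apply, ← hA b, map_sum]
    refine Finset.sum_congr rfl fun c _ => ?_
    rw [map_smul, Matrix.of_apply, Matrix.of_apply, mul_comm, MvPolynomial.C_mul']
  rw [this, Matrix.det_mul, h0, zero_mul]

/-! ## Weights, lengths and slices of polynomials -/

/-- All exponents occurring in `Q` have weight at least `t`. -/
def WeightGE {σ R : Type*} [CommSemiring R] (w : (σ →₀ ℕ) →+ ℝ) (t : ℝ)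
    (Q : MvPolynomial σ R) : Prop :=
  ∀ e, Q.coeff e ≠ 0 → t ≤ w e

namespace WeightGE

variable {σ R ι : Type*} [CommRing R] {w : (σ →₀ ℕ) →+ ℝ}

theorem mul {t u : ℝ} {P Q : MvPolynomial σ R} (hP : WeightGE w t P) (hQ : WeightGE w u Q) :
    WeightGE w (t + u) (P * Q) := by
  classical
  intro e he
  rw [MvPolynomial.coeff_mul] at he
  obtain ⟨x, hx, hne⟩ := Finset.exists_ne_zero_of_sum_ne_zero he
  rw [← Finset.HasAntidiagonal.mem_antidiagonal.mp hx, map_add]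
  exact add_le_add (hP _ (left_ne_zero_of_mul hne)) (hQ _ (right_ne_zero_of_mul hne))

theorem prod {T : Finset ι} {t : ι → ℝ} {P : ι → MvPolynomial σ R}
    (h : ∀ i ∈ T, WeightGE w (t i) (P i)) : WeightGE w (∑ i ∈ T, t i) (∏ i ∈ T, P i) := by
  classical
  induction T using Finset.induction_on with
  | empty =>
    intro e he
    rw [Finset.prod_empty, MvPolynomial.coeff_one] at he
    have : e = 0 := by
      by_contra hne
      exact he (if_neg (Ne.symm hne))
    simp [this]
  | insert b T hb ih =>
    rw [Finset.prod_insert hb, Finset.sum_insert hb]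
    exact (h b (Finset.mem_insert_self b T)).mul
      (ih fun i hi => h i (Finset.mem_insert_of_mem hi))

theorem det {s : ℕ} {t : Fin s → ℝ} {M : Matrix (Fin s) (Fin s) (MvPolynomial σ R)}
    (h : ∀ a b, WeightGE w (t b) (M a b)) : WeightGE w (∑ b, t b) M.det := by
  intro e he
  rw [Matrix.det_apply, MvPolynomial.coeff_sum] at he
  obtain ⟨π, -, hne⟩ := Finset.exists_ne_zero_of_sum_ne_zero he
  refine prod (T := Finset.univ) (fun b _ => h (π b) b) e fun h0 => hne ?_
  rw [MvPolynomial.coeff_smul, h0, smul_zero]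

end WeightGE

/-- The sum of the absolute values of the coefficients. -/
noncomputable def length {σ : Type*} (P : MvPolynomial σ ℤ) : ℝ :=
  ∑ f ∈ P.support, |((P.coeff f : ℤ) : ℝ)|

section Length

variable {σ τ ι : Type*}

theorem length_eq_sum {P : MvPolynomial σ ℤ} {S : Finset (σ →₀ ℕ)} (h : P.support ⊆ S) :
    length P = ∑ f ∈ S, |((P.coeff f : ℤ) : ℝ)| := by
  refine Finset.sum_subset h fun f _ hf => ?_
  rw [MvPolynomial.notMem_support_iff.mp hf]
  simp

theorem length_nonneg (P : MvPolynomial σ ℤ) : 0 ≤ length P :=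
  Finset.sum_nonneg fun _ _ => abs_nonneg _

theorem one_le_length {P : MvPolynomial σ ℤ} (h : P ≠ 0) : 1 ≤ length P := by
  obtain ⟨f, hf⟩ := MvPolynomial.support_nonempty.mpr h
  have h1 : (1 : ℝ) ≤ |((P.coeff f : ℤ) : ℝ)| := by
    exact_mod_cast Int.one_le_abs (MvPolynomial.mem_support_iff.mp hf)
  exact h1.trans (Finset.single_le_sum (f := fun f => |((P.coeff f : ℤ) : ℝ)|)
    (fun _ _ => abs_nonneg _) hf)

theorem length_add_le (P Q : MvPolynomial σ ℤ) : length (P + Q) ≤ length P + length Q := by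
  classical
  rw [length_eq_sum (MvPolynomial.support_add (p := P) (q := Q)),
    length_eq_sum (Finset.subset_union_left (s₁ := P.support) (s₂ := Q.support)),
    length_eq_sum (Finset.subset_union_right (s₁ := P.support) (s₂ := Q.support)),
    ← Finset.sum_add_distrib]
  refine Finset.sum_le_sum fun f _ => ?_
  rw [MvPolynomial.coeff_add, Int.cast_add]
  exact abs_add_le _ _

theorem length_sum_le (T : Finset ι) (P : ι → MvPolynomial σ ℤ) :
    length (∑ i ∈ T, P i) ≤ ∑ i ∈ T, length (P i) := by
  classical
  induction T using Finset.induction_on with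
  | empty => simp [length]
  | insert b T hb ih =>
    rw [Finset.sum_insert hb, Finset.sum_insert hb]
    exact (length_add_le _ _).trans (by gcongr)

theorem length_monomial (u : σ →₀ ℕ) (a : ℤ) :
    length (MvPolynomial.monomial u a) = |(a : ℝ)| := by
  classical
  rw [length_eq_sum MvPolynomial.support_monomial_subset, Finset.sum_singleton,
    MvPolynomial.coeff_monomial, if_pos rfl]

theorem length_mul_le (P Q : MvPolynomial σ ℤ) : length (P * Q) ≤ length P * length Q := by
  conv_lhs => rw [P.as_sum, Q.as_sum, Finset.sum_mul_sum]
  refine (length_sum_le _ _).trans ?_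
  rw [length, length, Finset.sum_mul_sum]
  refine Finset.sum_le_sum fun f _ => (length_sum_le _ _).trans (Finset.sum_le_sum fun g _ => ?_)
  rw [MvPolynomial.monomial_mul, length_monomial, Int.cast_mul, abs_mul]

theorem length_prod_le (T : Finset ι) (P : ι → MvPolynomial σ ℤ) :
    length (∏ i ∈ T, P i) ≤ ∏ i ∈ T, length (P i) := by
  classical
  induction T using Finset.induction_on with
  | empty =>
    rw [Finset.prod_empty, Finset.prod_empty, ← MvPolynomial.C_1, ← MvPolynomial.monomial_zero',
      length_monomial]
    simp
  | insert b T hb ih =>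
    rw [Finset.prod_insert hb, Finset.prod_insert hb]
    exact (length_mul_le _ _).trans (mul_le_mul_of_nonneg_left ih (length_nonneg _))

theorem length_neg (P : MvPolynomial σ ℤ) : length (-P) = length P := by
  simp [length, MvPolynomial.support_neg]

theorem length_det_le {s : ℕ} (M : Matrix (Fin s) (Fin s) (MvPolynomial σ ℤ)) {B : ℝ}
    (hM : ∀ a b, length (M a b) ≤ B) : length M.det ≤ (s.factorial : ℝ) * B ^ s := by
  rw [Matrix.det_apply]
  refine (length_sum_le _ _).trans ?_
  calc ∑ π : Equiv.Perm (Fin s), length (Equiv.Perm.sign π • ∏ b, M (π b) b)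
      ≤ ∑ _π : Equiv.Perm (Fin s), B ^ s := by
        refine Finset.sum_le_sum fun π _ => ?_
        have h1 : length (Equiv.Perm.sign π • ∏ b, M (π b) b) = length (∏ b, M (π b) b) := by
          rcases Int.units_eq_one_or (Equiv.Perm.sign π) with h | h <;> rw [h]
          · rw [one_smul]
          · rw [Units.neg_smul, one_smul, length_neg]
        rw [h1]
        refine (length_prod_le _ _).trans ?_
        calc ∏ b, length (M (π b) b) ≤ ∏ _b : Fin s, B :=
              Finset.prod_le_prod (fun _ _ => length_nonneg _) fun b _ => hM _ _
          _ = B ^ s := by simp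
    _ = (s.factorial : ℝ) * B ^ s := by simp [Fintype.card_perm]

theorem mchoose_le [Fintype σ] (f e : σ →₀ ℕ) : mchoose f e ≤ 2 ^ ∑ j, f j := by
  rw [← Finset.prod_pow_eq_pow_sum]
  exact Finset.prod_le_prod' fun j _ => Nat.choose_le_two_pow _ _

theorem length_theta_le [Fintype σ] (e : σ →₀ ℕ) (P : MvPolynomial σ ℤ) {N : ℕ}
    (hN : ∀ f, P.coeff f ≠ 0 → ∑ j, f j ≤ N) : length (theta e P) ≤ 2 ^ N * length P := by
  have hsub : (theta e P).support ⊆ P.support := by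
    intro f hf
    rw [MvPolynomial.mem_support_iff, coeff_theta] at hf
    exact MvPolynomial.mem_support_iff.mpr (right_ne_zero_of_mul hf)
  rw [length_eq_sum hsub, length, Finset.mul_sum]
  refine Finset.sum_le_sum fun f hf => ?_
  rw [coeff_theta, Int.cast_mul, abs_mul]
  gcongr
  have h1 : mchoose f e ≤ 2 ^ N := (mchoose_le f e).trans
    (Nat.pow_le_pow_right two_pos (hN f (MvPolynomial.mem_support_iff.mp hf)))
  have h2 : ((mchoose f e : ℕ) : ℝ) ≤ 2 ^ N := by exact_mod_cast h1
  simpa using h2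

/-- The polynomial whose coefficients are those of `W` along an injective map of exponents. -/
noncomputable def slice (φ : (τ →₀ ℕ) → (σ →₀ ℕ)) (hφ : Function.Injective φ)
    (W : MvPolynomial σ ℤ) : MvPolynomial τ ℤ :=
  ∑ e ∈ W.support.preimage φ hφ.injOn, MvPolynomial.monomial e (W.coeff (φ e))

theorem coeff_slice (φ : (τ →₀ ℕ) → (σ →₀ ℕ)) (hφ : Function.Injective φ)
    (W : MvPolynomial σ ℤ) (e : τ →₀ ℕ) : (slice φ hφ W).coeff e = W.coeff (φ e) := by
  classical
  rw [slice, MvPolynomial.coeff_sum]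
  simp_rw [MvPolynomial.coeff_monomial]
  rw [Finset.sum_ite_eq']
  split_ifs with h
  · rfl
  · rw [Finset.mem_preimage, MvPolynomial.notMem_support_iff] at h
    exact h.symm

theorem length_slice_le (φ : (τ →₀ ℕ) → (σ →₀ ℕ)) (hφ : Function.Injective φ)
    (W : MvPolynomial σ ℤ) : length (slice φ hφ W) ≤ length W := by
  classical
  refine (length_sum_le _ _).trans ?_
  simp_rw [length_monomial]
  rw [Finset.sum_preimage' φ W.support hφ.injOn fun f => |((W.coeff f : ℤ) : ℝ)|]
  exact Finset.sum_le_sum_of_subset_of_nonneg (Finset.filter_subset _ _)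
    fun _ _ _ => abs_nonneg _

end Length

/-! ## Separation of variables -/

section Separate

variable {R L : Type*} [CommRing R] [CommRing L] [Algebra R L] {m : ℕ}

/-- The product of a polynomial in the variables `1, …, m` and a polynomial in the
variable `0`. -/
noncomputable def separated (U : MvPolynomial (Fin m) R) (V : MvPolynomial (Fin 1) R) :
    MvPolynomial (Fin (m + 1)) R :=
  MvPolynomial.rename Fin.succ U * MvPolynomial.rename (fun _ => 0) V

theorem separated_monomial (e : Fin m →₀ ℕ) (k : Fin 1 →₀ ℕ) (u v : R) :
    separated (MvPolynomial.monomial e u) (MvPolynomial.monomial k v) =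
      MvPolynomial.monomial (Finsupp.cons (k 0) e) (u * v) := by
  rw [separated, MvPolynomial.rename_monomial, MvPolynomial.rename_monomial,
    MvPolynomial.monomial_mul]
  refine congrArg (fun f => MvPolynomial.monomial f (u * v)) ?_
  ext j
  rw [Finsupp.add_apply]
  refine Fin.cases ?_ (fun j => ?_) j
  · rw [Finsupp.cons_zero, Finsupp.mapDomain_of_notMem_range _ _ (by simp), zero_add]
    have : k = Finsupp.single 0 (k 0) := Finsupp.ext fun j => by fin_cases j; simp
    rw [this, Finsupp.mapDomain_single]
    simp
  · rw [Finsupp.cons_succ, Finsupp.mapDomain_apply (Fin.succ_injective m),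
      Finsupp.mapDomain_of_notMem_range _ _ (by simp [Fin.succ_ne_zero]), add_zero]

theorem separated_add_left (U U' : MvPolynomial (Fin m) R) (V : MvPolynomial (Fin 1) R) :
    separated (U + U') V = separated U V + separated U' V := by
  simp [separated, add_mul]

theorem separated_add_right (U : MvPolynomial (Fin m) R) (V V' : MvPolynomial (Fin 1) R) :
    separated U (V + V') = separated U V + separated U V' := by
  simp [separated, mul_add]

theorem separated_induction {p : MvPolynomial (Fin m) R → MvPolynomial (Fin 1) R → Prop}
    (hm : ∀ e u k v, p (MvPolynomial.monomial e u) (MvPolynomial.monomial k v))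
    (hl : ∀ U U' V, p U V → p U' V → p (U + U') V)
    (hr : ∀ U V V', p U V → p U V' → p U (V + V')) (U : MvPolynomial (Fin m) R)
    (V : MvPolynomial (Fin 1) R) : p U V := by
  induction U using MvPolynomial.induction_on' with
  | monomial e u =>
    induction V using MvPolynomial.induction_on' with
    | monomial k v => exact hm e u k v
    | add V V' h h' => exact hr _ _ _ h h'
  | add U U' h h' => exact hl _ _ _ h h'

theorem coeff_separated (U : MvPolynomial (Fin m) R) (V : MvPolynomial (Fin 1) R)
    (k : Fin 1 →₀ ℕ) (e : Fin m →₀ ℕ) :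
    (separated U V).coeff (Finsupp.cons (k 0) e) = U.coeff e * V.coeff k := by
  classical
  induction U, V using separated_induction with
  | hm e' u k' v =>
    rw [separated_monomial]
    simp only [MvPolynomial.coeff_monomial]
    have hiff : Finsupp.cons (k' 0) e' = Finsupp.cons (k 0) e ↔ e' = e ∧ k' = k := by
      rw [Finsupp.cons_injective2.eq_iff, and_comm]
      refine and_congr Iff.rfl ⟨fun h => ?_, fun h => by rw [h]⟩
      exact Finsupp.ext fun j => by fin_cases j; exact h
    simp only [hiff]
    by_cases h1 : e' = e <;> by_cases h2 : k' = k <;> simp [h1, h2]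
  | hl U U' V h h' =>
    rw [separated_add_left, MvPolynomial.coeff_add, h, h', MvPolynomial.coeff_add, add_mul]
  | hr U V V' h h' =>
    rw [separated_add_right, MvPolynomial.coeff_add, h, h', MvPolynomial.coeff_add, mul_add]

theorem mchoose_cons (f e : Fin m →₀ ℕ) (k l : Fin 1 →₀ ℕ) :
    mchoose (Finsupp.cons (l 0) f) (Finsupp.cons (k 0) e) = mchoose f e * mchoose l k := by
  simp [mchoose, Fin.prod_univ_succ, mul_comm]

theorem theta_separated (U : MvPolynomial (Fin m) R) (V : MvPolynomial (Fin 1) R)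
    (k : Fin 1 →₀ ℕ) (e : Fin m →₀ ℕ) :
    theta (Finsupp.cons (k 0) e) (separated U V) = separated (theta e U) (theta k V) := by
  induction U, V using separated_induction with
  | hm e' u k' v =>
    rw [separated_monomial, theta_monomial, theta_monomial, theta_monomial, separated_monomial,
      mchoose_cons]
    push_cast
    congr 1
    ring
  | hl U U' V h h' => rw [separated_add_left, map_add, h, h', map_add, separated_add_left]
  | hr U V V' h h' => rw [separated_add_right, map_add, h, h', map_add, separated_add_right]

theorem aeval_separated (ξ : Fin (m + 1) → L) (U : MvPolynomial (Fin m) R)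
    (V : MvPolynomial (Fin 1) R) : MvPolynomial.aeval ξ (separated U V) =
      MvPolynomial.aeval (fun j => ξ j.succ) U * MvPolynomial.aeval (fun _ => ξ 0) V := by
  rw [separated, map_mul, MvPolynomial.aeval_rename, MvPolynomial.aeval_rename]
  rfl

end Separate

theorem finsupp_fin_one_eq {k l : Fin 1 →₀ ℕ} (h : k 0 = l 0) : k = l :=
  Finsupp.ext fun j => by fin_cases j; exact h

/-- A polynomial separates as a sum of products with linearly independent factors. -/
theorem exists_eq_sum_separated {m : ℕ} (P : MvPolynomial (Fin (m + 1)) ℚ) (hP : P ≠ 0) {r : ℕ}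
    (hr : ∀ e, P.coeff e ≠ 0 → e 0 ≤ r) : ∃ s, 1 ≤ s ∧ s ≤ r + 1 ∧
      ∃ (f : Fin s → MvPolynomial (Fin m) ℚ) (g : Fin s → MvPolynomial (Fin 1) ℚ),
        LinearIndependent ℚ f ∧ LinearIndependent ℚ g ∧ P = ∑ l, separated (f l) (g l) := by
  classical
  let c : Fin (r + 1) → MvPolynomial (Fin m) ℚ :=
    fun k => (MvPolynomial.finSuccEquiv ℚ m P).coeff k
  have hc : ∀ k e, (c k).coeff e = P.coeff (Finsupp.cons k e) := fun k e =>
    MvPolynomial.finSuccEquiv_coeff_coeff e P k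
  let V := Submodule.span ℚ (Set.range c)
  have hcV : ∀ k, c k ∈ V := fun k => Submodule.subset_span ⟨k, rfl⟩
  have : Module.Finite ℚ V := FiniteDimensional.span_of_finite ℚ (Set.finite_range c)
  let B : Module.Basis (Fin (Module.finrank ℚ V)) ℚ V := Module.finBasis ℚ V
  let g : Fin (Module.finrank ℚ V) → MvPolynomial (Fin 1) ℚ := fun l =>
    ∑ k : Fin (r + 1), MvPolynomial.monomial (Finsupp.single 0 (k : ℕ)) (B.repr ⟨c k, hcV k⟩ l)
  have hg : ∀ l (k : Fin (r + 1)), (g l).coeff (Finsupp.single 0 (k : ℕ)) =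
      B.repr ⟨c k, hcV k⟩ l := by
    intro l k
    simp only [g, MvPolynomial.coeff_sum, MvPolynomial.coeff_monomial]
    rw [Finset.sum_eq_single k]
    · rw [if_pos rfl]
    · intro k' _ hk'
      rw [if_neg]
      intro h
      exact hk' (Fin.ext (Finsupp.single_injective 0 h))
    · simp
  have hg0 : ∀ l (k : Fin 1 →₀ ℕ), ¬ k 0 < r + 1 → (g l).coeff k = 0 := by
    intro l k hk
    simp only [g, MvPolynomial.coeff_sum, MvPolynomial.coeff_monomial]
    refine Finset.sum_eq_zero fun k' _ => if_neg ?_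
    rintro rfl
    exact hk (by simpa using k'.2)
  refine ⟨Module.finrank ℚ V, ?_, ?_, fun l => (B l : MvPolynomial (Fin m) ℚ), g, ?_, ?_, ?_⟩
  · by_contra h
    have h0 : Module.finrank ℚ V = 0 := by omega
    have hbot : V = ⊥ := Submodule.finrank_eq_zero.mp h0
    apply hP
    ext e
    rw [MvPolynomial.coeff_zero]
    by_contra hne
    have hlt : e 0 < r + 1 := Nat.lt_succ_of_le (hr e hne)
    have h1 : c ⟨e 0, hlt⟩ = 0 := by
      have := hcV ⟨e 0, hlt⟩
      rwa [hbot, Submodule.mem_bot] at this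
    apply hne
    rw [← Finsupp.cons_tail e]
    have := hc ⟨e 0, hlt⟩ e.tail
    rw [h1, MvPolynomial.coeff_zero] at this
    exact this.symm
  · exact (finrank_range_le_card (R := ℚ) c).trans_eq (Fintype.card_fin _)
  · exact B.linearIndependent.map' V.subtype (Submodule.ker_subtype V)
  · rw [Fintype.linearIndependent_iff]
    intro d hd
    have h1 : ∀ v ∈ V, ∀ hv : v ∈ V, ∑ l, d l * B.repr ⟨v, hv⟩ l = 0 := by
      intro v hv
      induction hv using Submodule.span_induction with
      | mem x hx =>
        obtain ⟨k, rfl⟩ := hx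
        intro hv
        have := congrArg (MvPolynomial.coeff (Finsupp.single 0 (k : ℕ))) hd
        rw [MvPolynomial.coeff_sum, MvPolynomial.coeff_zero] at this
        rw [← this]
        refine Finset.sum_congr rfl fun l _ => ?_
        rw [MvPolynomial.coeff_smul, hg, smul_eq_mul]
      | zero =>
        intro hv
        rw [show (⟨0, hv⟩ : V) = 0 from rfl, map_zero]
        simp
      | add x y hx hy ihx ihy =>
        intro hv
        rw [show (⟨x + y, hv⟩ : V) = ⟨x, hx⟩ + ⟨y, hy⟩ from rfl, map_add]
        simp only [Finsupp.add_apply, mul_add, Finset.sum_add_distrib, ihx hx, ihy hy, add_zero]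
      | smul t x hx ihx =>
        intro hv
        rw [show (⟨t • x, hv⟩ : V) = t • ⟨x, hx⟩ from rfl, map_smul]
        simp only [Finsupp.smul_apply, smul_eq_mul, mul_left_comm _ t, ← Finset.mul_sum, ihx hx,
          mul_zero]
    intro l
    have := h1 (B l) (B l).2 (B l).2
    simpa [Finsupp.single_apply] using this
  · ext e
    rw [← Finsupp.cons_tail e, MvPolynomial.coeff_sum]
    have h1 : ∀ l, (separated (B l : MvPolynomial (Fin m) ℚ) (g l)).coeff
        (Finsupp.cons (e 0) e.tail) = (B l : MvPolynomial (Fin m) ℚ).coeff e.tail *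
          (g l).coeff (Finsupp.single 0 (e 0)) := by
      intro l
      have := coeff_separated (B l : MvPolynomial (Fin m) ℚ) (g l) (Finsupp.single 0 (e 0)) e.tail
      simpa using this
    simp_rw [h1]
    by_cases hlt : e 0 < r + 1
    · have h2 := hc ⟨e 0, hlt⟩ e.tail
      have h3 := B.sum_repr ⟨c ⟨e 0, hlt⟩, hcV _⟩
      have h4 := congrArg (fun v : V => (v : MvPolynomial (Fin m) ℚ).coeff e.tail) h3
      simp only [Submodule.coe_sum, MvPolynomial.coeff_sum, Submodule.coe_smul,
        MvPolynomial.coeff_smul, smul_eq_mul] at h4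
      rw [← h2, ← h4]
      refine Finset.sum_congr rfl fun l _ => ?_
      rw [hg l ⟨e 0, hlt⟩, mul_comm]
    · rw [Finset.sum_eq_zero fun l _ => by rw [hg0 l _ (by simpa using hlt), mul_zero]]
      by_contra hne
      have := hr _ hne
      simp only [Finsupp.cons_zero] at this
      omega

/-- A nonzero Wronskian of a polynomial which separates the first variable. -/
theorem exists_det_theta_eq_separated {m : ℕ} (P : MvPolynomial (Fin (m + 1)) ℚ) (hP : P ≠ 0)
    {r : ℕ} (hr : ∀ e, P.coeff e ≠ 0 → e 0 ≤ r) : ∃ s, 1 ≤ s ∧ s ≤ r + 1 ∧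
      ∃ (i : Fin s → (Fin m →₀ ℕ)) (k : Fin s ≃ Fin s), (∀ a j, i a j < s) ∧
      ∃ (U : MvPolynomial (Fin m) ℚ) (V : MvPolynomial (Fin 1) ℚ), U ≠ 0 ∧ V ≠ 0 ∧
        (Matrix.of fun a b => theta (Finsupp.cons (k b : ℕ) (i a)) P).det = separated U V := by
  obtain ⟨s, hs1, hsr, f, g, hf, hg, hPfg⟩ := exists_eq_sum_separated P hP hr
  obtain ⟨i, hi, hF⟩ := exists_det_theta_ne_zero f hf
  obtain ⟨k, hk, hG⟩ := exists_det_theta_ne_zero g hg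
  have hinj : Function.Injective fun b => (⟨k b 0, hk b 0⟩ : Fin s) := by
    intro b b' h
    by_contra hne
    refine hG (Matrix.det_zero_of_row_eq hne ?_)
    ext1 l
    have : k b = k b' := finsupp_fin_one_eq (by simpa using h)
    simp [this]
  refine ⟨s, hs1, hsr, i, Equiv.ofBijective _ (Finite.injective_iff_bijective.mp hinj), hi, _, _,
    hF, by rw [← Matrix.det_transpose] at hG; exact hG, ?_⟩
  rw [separated, AlgHom.map_det, AlgHom.map_det, ← Matrix.det_mul]
  congr 1
  ext1 a b
  rw [Matrix.mul_apply, Matrix.of_apply, hPfg, map_sum]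
  refine Finset.sum_congr rfl fun l _ => ?_
  exact theta_separated (f l) (g l) (k b) (i a)

theorem cons_injective_right {m : ℕ} (k : ℕ) :
    Function.Injective fun e : Fin m →₀ ℕ => (Finsupp.cons k e : Fin (m + 1) →₀ ℕ) :=
  fun _ _ h => (Finsupp.cons_injective2 h).2

theorem cons_injective_left {m : ℕ} (e : Fin m →₀ ℕ) :
    Function.Injective fun k : Fin 1 →₀ ℕ => (Finsupp.cons (k 0) e : Fin (m + 1) →₀ ℕ) :=
  fun _ _ h => finsupp_fin_one_eq (Finsupp.cons_injective2 h).1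

/-- An integral version of `exists_det_theta_eq_separated`. -/
theorem exists_det_theta_mul_eq_separated {m : ℕ} (P : MvPolynomial (Fin (m + 1)) ℤ) (hP : P ≠ 0)
    {r : ℕ} (hr : ∀ e, P.coeff e ≠ 0 → e 0 ≤ r) : ∃ s, 1 ≤ s ∧ s ≤ r + 1 ∧
      ∃ (i : Fin s → (Fin m →₀ ℕ)) (k : Fin s ≃ Fin s), (∀ a j, i a j < s) ∧
      ∃ W, W = (Matrix.of fun a b => theta (Finsupp.cons (k b : ℕ) (i a)) P).det ∧
      ∃ (U : MvPolynomial (Fin m) ℤ) (V : MvPolynomial (Fin 1) ℤ) (c : ℤ), U ≠ 0 ∧ V ≠ 0 ∧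
        MvPolynomial.C c * W = separated U V ∧ length U ≤ length W ∧ length V ≤ length W ∧
        (∀ e, U.coeff e ≠ 0 → ∃ l : ℕ, W.coeff (Finsupp.cons l e) ≠ 0) ∧
        (∀ l, V.coeff l ≠ 0 → ∃ e, W.coeff (Finsupp.cons (l 0) e) ≠ 0) := by
  classical
  have hinj : Function.Injective (MvPolynomial.map (σ := Fin (m + 1)) (Int.castRingHom ℚ)) :=
    MvPolynomial.map_injective _ Int.cast_injective
  obtain ⟨s, hs1, hsr, i, k, hi, U₀, V₀, hU₀, hV₀, hdet⟩ :=
    exists_det_theta_eq_separated (MvPolynomial.map (Int.castRingHom ℚ) P)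
      (fun h => hP (hinj (by rw [h, map_zero]))) (r := r)
      (fun e he => hr e fun h => he (by rw [MvPolynomial.coeff_map, h, map_zero]))
  refine ⟨s, hs1, hsr, i, k, hi, _, rfl, ?_⟩
  set W := (Matrix.of fun a b => theta (Finsupp.cons (k b : ℕ) (i a)) P).det with hW
  have hmapW : MvPolynomial.map (Int.castRingHom ℚ) W = separated U₀ V₀ := by
    rw [← hdet, hW, RingHom.map_det]
    congr 1
    ext1 a b
    simp [map_theta]
  have hcoeff : ∀ (l : Fin 1 →₀ ℕ) (e : Fin m →₀ ℕ),
      ((W.coeff (Finsupp.cons (l 0) e) : ℤ) : ℚ) = U₀.coeff e * V₀.coeff l := by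
    intro l e
    rw [← coeff_separated, ← hmapW, MvPolynomial.coeff_map]
    rfl
  obtain ⟨e₀, he₀⟩ := MvPolynomial.ne_zero_iff.mp hU₀
  obtain ⟨l₀, hl₀⟩ := MvPolynomial.ne_zero_iff.mp hV₀
  have hne : W.coeff (Finsupp.cons (l₀ 0) e₀) ≠ 0 := by
    have := mul_ne_zero he₀ hl₀
    rw [← hcoeff] at this
    exact_mod_cast this
  refine ⟨slice _ (cons_injective_right (l₀ 0)) W, slice _ (cons_injective_left e₀) W,
    W.coeff (Finsupp.cons (l₀ 0) e₀), ?_, ?_, ?_, length_slice_le _ _ _, length_slice_le _ _ _,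
    ?_, ?_⟩
  · exact MvPolynomial.ne_zero_iff.mpr ⟨e₀, by rwa [coeff_slice]⟩
  · exact MvPolynomial.ne_zero_iff.mpr ⟨l₀, by rwa [coeff_slice]⟩
  · ext e
    rw [← Finsupp.cons_tail e, MvPolynomial.coeff_C_mul]
    have h1 := coeff_separated (slice _ (cons_injective_right (l₀ 0)) W)
      (slice _ (cons_injective_left e₀) W) (Finsupp.single 0 (e 0)) e.tail
    rw [Finsupp.single_eq_same] at h1
    rw [h1, coeff_slice, coeff_slice]
    have h2 := hcoeff l₀ e₀
    have h3 := hcoeff (Finsupp.single 0 (e 0)) e.tail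
    have h4 := hcoeff l₀ e.tail
    have h5 := hcoeff (Finsupp.single 0 (e 0)) e₀
    have h6 : ((W.coeff (Finsupp.cons (l₀ 0) e₀) *
        W.coeff (Finsupp.cons ((Finsupp.single 0 (e 0) : Fin 1 →₀ ℕ) 0) e.tail) : ℤ) : ℚ) =
        ((W.coeff (Finsupp.cons (l₀ 0) e.tail) *
        W.coeff (Finsupp.cons ((Finsupp.single 0 (e 0) : Fin 1 →₀ ℕ) 0) e₀) : ℤ) : ℚ) := by
      push_cast
      rw [h2, h3, h4, h5]
      ring
    have h7 := Int.cast_injective h6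
    simpa using h7
  · intro e he
    exact ⟨l₀ 0, by rwa [coeff_slice] at he⟩
  · intro l hl
    exact ⟨e₀, by rwa [coeff_slice] at hl⟩

/-- The weight of a multi-index, relative to the degrees `r`. -/
noncomputable def relWeight {m : ℕ} (r : Fin m → ℕ) : (Fin m →₀ ℕ) →+ ℝ where
  toFun e := ∑ j, (e j : ℝ) / r j
  map_zero' := by simp
  map_add' e f := by simp [add_div, Finset.sum_add_distrib]

theorem relWeight_apply {m : ℕ} (r : Fin m → ℕ) (e : Fin m →₀ ℕ) :
    relWeight r e = ∑ j, (e j : ℝ) / r j := rfl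

theorem relWeight_nonneg {m : ℕ} (r : Fin m → ℕ) (e : Fin m →₀ ℕ) : 0 ≤ relWeight r e := by
  rw [relWeight_apply]
  positivity

theorem relWeight_mono {m : ℕ} (r : Fin m → ℕ) {e f : Fin m →₀ ℕ} (h : e ≤ f) :
    relWeight r e ≤ relWeight r f := by
  rw [relWeight_apply, relWeight_apply]
  gcongr with j
  exact h j

theorem relWeight_cons {m : ℕ} (r : Fin (m + 1) → ℕ) (k : ℕ) (e : Fin m →₀ ℕ) :
    relWeight r (Finsupp.cons k e) = k / r 0 + relWeight (fun j => r j.succ) e := by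
  simp [relWeight_apply, Fin.sum_univ_succ]

/-- Integral polynomials in one variable vanish at `ξ` only to a low order, measured by
their length and degree. -/
def LowOrder {L : Type*} [Field L] (C h : ℝ) (ξ : L) : Prop :=
  ∀ f : MvPolynomial (Fin 1) ℤ, f ≠ 0 → ∀ D : ℕ, (∀ e, f.coeff e ≠ 0 → e 0 ≤ D) →
    ∃ k : Fin 1 →₀ ℕ, (k 0 : ℝ) * h ≤ C * (Real.log (length f) + D + 1) ∧
      MvPolynomial.aeval (fun _ => ξ) (theta k f) ≠ 0

theorem sum_max_sub_ge {s r : ℕ} (hs : 1 ≤ s) (hsr : s ≤ r + 1) (hr : 1 ≤ r) (k : Fin s ≃ Fin s)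
    {θ : ℝ} (h0 : 0 < θ) (h1 : θ ≤ 1) :
    (s : ℝ) * θ ^ 2 / 8 ≤ ∑ b, max 0 (θ - (k b : ℕ) / (r : ℝ)) := by
  rw [Equiv.sum_comp k fun b => max 0 (θ - ((b : ℕ) : ℝ) / (r : ℝ)),
    Fin.sum_univ_eq_sum_range fun b => max 0 (θ - (b : ℝ) / (r : ℝ))]
  have hs0 : (1 : ℝ) ≤ s := by exact_mod_cast hs
  have hr0 : (1 : ℝ) ≤ r := by exact_mod_cast hr
  have hsr' : (s : ℝ) ≤ 2 * r := by
    have : (s : ℝ) ≤ r + 1 := by exact_mod_cast hsr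
    linarith
  set N := ⌊θ * s / 4⌋₊ with hN
  have hNle : (N : ℝ) ≤ θ * s / 4 := Nat.floor_le (by positivity)
  have hNlt : θ * s / 4 < N + 1 := Nat.lt_floor_add_one _
  have hNs : N + 1 ≤ s := by
    have : (N : ℝ) < s := by nlinarith
    exact_mod_cast this
  calc (s : ℝ) * θ ^ 2 / 8 ≤ ((N : ℝ) + 1) * (θ / 2) := by nlinarith
    _ = ∑ b ∈ Finset.range (N + 1), θ / 2 := by simp
    _ ≤ ∑ b ∈ Finset.range (N + 1), max 0 (θ - (b : ℝ) / (r : ℝ)) := by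
        refine Finset.sum_le_sum fun b hb => le_max_of_le_right ?_
        have hb' : (b : ℝ) ≤ N := by exact_mod_cast Nat.lt_succ_iff.mp (Finset.mem_range.mp hb)
        have : (b : ℝ) / r ≤ θ / 2 := by
          rw [div_le_iff₀ (by linarith)]
          nlinarith
        linarith
    _ ≤ ∑ b ∈ Finset.range s, max 0 (θ - (b : ℝ) / (r : ℝ)) :=
        Finset.sum_le_sum_of_subset_of_nonneg (Finset.range_mono hNs)
          fun _ _ _ => le_max_left _ _

theorem length_det_theta_le {m s : ℕ} {P : MvPolynomial (Fin (m + 1)) ℤ} (hP : P ≠ 0)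
    {r : Fin (m + 1) → ℕ} (hr : ∀ e, P.coeff e ≠ 0 → ∀ j, e j ≤ r j) (hsr : s ≤ r 0 + 1)
    (v : Fin s → Fin s → (Fin (m + 1) →₀ ℕ)) :
    length (Matrix.of fun a b => theta (v a b) P).det ≤
      Real.exp (2 * s * (∑ j, (r j : ℝ) + Real.log (length P))) := by
  have hl := one_le_length hP
  have hlog : 0 ≤ Real.log (length P) := Real.log_nonneg hl
  set N := ∑ j, r j with hN
  have hNr : (∑ j, (r j : ℝ)) = N := by rw [hN]; push_cast; rfl
  have h1 : ∀ a b, length ((Matrix.of fun a b => theta (v a b) P) a b) ≤ 2 ^ N * length P :=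
    fun a b => length_theta_le _ _ fun f hf => Finset.sum_le_sum fun j _ => hr f hf j
  refine (length_det_le _ h1).trans ?_
  have h2 : (s.factorial : ℝ) ≤ (Real.exp N) ^ s := by
    have h3 : (s.factorial : ℝ) ≤ (s : ℝ) ^ s := by exact_mod_cast Nat.factorial_le_pow s
    have h4 : (s : ℝ) ≤ N + 1 := by
      have : r 0 ≤ N := Finset.single_le_sum (f := r) (fun _ _ => Nat.zero_le _) (Finset.mem_univ 0)
      exact_mod_cast hsr.trans (Nat.succ_le_succ this)
    exact h3.trans (by gcongr; exact h4.trans (Real.add_one_le_exp _))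
  have h5 : (2 : ℝ) ^ N ≤ Real.exp N := by
    have : (2 : ℝ) ≤ Real.exp 1 := by
      have := Real.add_one_le_exp (1 : ℝ)
      linarith
    calc (2 : ℝ) ^ N ≤ (Real.exp 1) ^ N := by gcongr
      _ = Real.exp N := by rw [← Real.exp_nat_mul, mul_one]
  calc (s.factorial : ℝ) * (2 ^ N * length P) ^ s
      ≤ (Real.exp N) ^ s * (Real.exp N * Real.exp (Real.log (length P))) ^ s := by
        rw [Real.exp_log (by linarith)]
        gcongr
    _ = Real.exp (s * (2 * N + Real.log (length P))) := by
        rw [← Real.exp_add, ← Real.exp_nat_mul, ← Real.exp_nat_mul, ← Real.exp_add]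
        ring_nf
    _ ≤ _ := by
        rw [hNr]
        refine Real.exp_le_exp.mpr ?_
        have : 0 ≤ (s : ℝ) * Real.log (length P) := by positivity
        nlinarith

/-- **Roth's lemma**: under suitable growth conditions, an integral polynomial in several
variables has small index at points whose coordinates have the low order property. -/
theorem exists_relWeight_le_aeval_theta_ne_zero {L : Type*} [Field L] [Algebra ℚ L] {C : ℝ}
    (hC : 1 ≤ C) (m : ℕ) : ∀ ε : ℝ, 0 < ε → ∃ δ : ℝ, 0 < δ ∧ ∀ (ξ : Fin m → L) (h : Fin m → ℝ)
      (r : Fin m → ℕ), (∀ j, 0 < h j) → (∀ j, LowOrder C (h j) (ξ j)) → (∀ j, 1 ≤ r j) →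
      (∀ i j, i < j → (r i : ℝ) ≤ δ * r j) → ∀ P : MvPolynomial (Fin m) ℤ, P ≠ 0 →
      (∀ e, P.coeff e ≠ 0 → ∀ j, e j ≤ r j) →
      (∀ j, ∑ i, (r i : ℝ) + Real.log (length P) ≤ δ * r j * h j) →
      ∃ e, relWeight r e ≤ ε ∧ MvPolynomial.aeval ξ (theta e P) ≠ 0 := by
  induction m with
  | zero =>
    intro ε hε
    refine ⟨1, one_pos, fun ξ h r _ _ _ _ P hP _ _ => ⟨0, by rw [map_zero]; exact hε.le, ?_⟩⟩
    rw [← coeff_dilate]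
    obtain ⟨c, rfl⟩ := MvPolynomial.C_surjective (Fin 0) P
    have hc : c ≠ 0 := fun h => hP (by rw [h, map_zero])
    rw [← MvPolynomial.algebraMap_eq, AlgHom.commutes,
      IsScalarTower.algebraMap_apply ℤ L (MvPolynomial (Fin 0) L), MvPolynomial.algebraMap_eq,
      MvPolynomial.coeff_zero_C]
    have : CharZero L := algebraRat.charZero L
    simpa using hc
  | succ m ih =>
    suffices hsuff : ∀ ε : ℝ, 0 < ε → ε ≤ 1 → ∃ δ : ℝ, 0 < δ ∧ ∀ (ξ : Fin (m + 1) → L)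
        (h : Fin (m + 1) → ℝ) (r : Fin (m + 1) → ℕ), (∀ j, 0 < h j) →
        (∀ j, LowOrder C (h j) (ξ j)) → (∀ j, 1 ≤ r j) →
        (∀ i j, i < j → (r i : ℝ) ≤ δ * r j) → ∀ P : MvPolynomial (Fin (m + 1)) ℤ, P ≠ 0 →
        (∀ e, P.coeff e ≠ 0 → ∀ j, e j ≤ r j) →
        (∀ j, ∑ i, (r i : ℝ) + Real.log (length P) ≤ δ * r j * h j) →
        ∃ e, relWeight r e ≤ ε ∧ MvPolynomial.aeval ξ (theta e P) ≠ 0 by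
      intro ε hε
      obtain ⟨δ, hδ, H⟩ := hsuff (min ε 1) (lt_min hε one_pos) (min_le_right _ _)
      refine ⟨δ, hδ, fun ξ h r h1 h2 h3 h4 P hP h5 h6 => ?_⟩
      obtain ⟨e, he, hne⟩ := H ξ h r h1 h2 h3 h4 P hP h5 h6
      exact ⟨e, he.trans (min_le_left _ _), hne⟩
    intro ε hε hε1
    obtain ⟨δ', hδ', H⟩ := ih (ε ^ 2 / 128) (by positivity)
    have hm : (0 : ℝ) < 2 * (m + 1) := by positivity
    refine ⟨min (δ' / 3) (min (ε / (2 * (m + 1))) (ε ^ 2 / (512 * C))), by positivity,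
      fun ξ h r hh hlow hr1 hrr P hP hdeg hE => ?_⟩
    set δ := min (δ' / 3) (min (ε / (2 * (m + 1))) (ε ^ 2 / (512 * C))) with hδdef
    have hδ : 0 < δ := by positivity
    have hδ1 : 3 * δ ≤ δ' := by
      have : δ ≤ δ' / 3 := min_le_left _ _
      linarith
    have hδ2 : m * δ ≤ ε / 2 := by
      have : δ ≤ ε / (2 * (m + 1)) := (min_le_right _ _).trans (min_le_left _ _)
      rw [le_div_iff₀ hm] at this
      nlinarith
    have hδ3 : 4 * C * δ ≤ ε ^ 2 / 128 := by
      have : δ ≤ ε ^ 2 / (512 * C) := (min_le_right _ _).trans (min_le_right _ _)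
      rw [le_div_iff₀ (by positivity)] at this
      linarith
    by_contra hcon
    push Not at hcon
    obtain ⟨s, hs1, hsr, i, k, hi, W, hW, U, V, c, hU, hV, hcW, hlU, hlV, hUW, hVW⟩ :=
      exists_det_theta_mul_eq_separated P hP (fun e he => hdeg e he 0)
    have hs0 : (1 : ℝ) ≤ s := by exact_mod_cast hs1
    have hr0 : ∀ j, (1 : ℝ) ≤ r j := fun j => by exact_mod_cast hr1 j
    set E := ∑ j, (r j : ℝ) + Real.log (length P) with hEdef
    have hlogP : 0 ≤ Real.log (length P) := Real.log_nonneg (one_le_length hP)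
    have hEsum : ∑ j, (r j : ℝ) ≤ E := by linarith
    have hlenW : length W ≤ Real.exp (2 * s * E) := by
      rw [hW]
      exact length_det_theta_le hP hdeg hsr fun a b => Finsupp.cons (k b : ℕ) (i a)
    have hlogU : Real.log (length U) ≤ 2 * s * E := by
      rw [Real.log_le_iff_le_exp (by linarith [one_le_length hU])]
      exact hlU.trans hlenW
    have hlogV : Real.log (length V) ≤ 2 * s * E := by
      rw [Real.log_le_iff_le_exp (by linarith [one_le_length hV])]
      exact hlV.trans hlenW
    have hdegW : ∀ e, W.coeff e ≠ 0 → ∀ j, e j ≤ s * r j := by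
      intro e he j
      let w : (Fin (m + 1) →₀ ℕ) →+ ℝ :=
        { toFun := fun e => -(e j : ℝ), map_zero' := by simp
          map_add' := fun e f => by simp [add_comm] }
      have := WeightGE.det (w := w) (t := fun _ : Fin s => -(r j : ℝ))
        (M := Matrix.of fun a b => theta (Finsupp.cons (k b : ℕ) (i a)) P) (by
          intro a b f hf
          rw [Matrix.of_apply, coeff_theta] at hf
          have := hdeg f (right_ne_zero_of_mul hf) j
          simpa [w] using this)
      rw [← hW] at this
      have h2 := this e he
      simp only [Finset.sum_const, Finset.card_univ, Fintype.card_fin, nsmul_eq_mul, w,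
        AddMonoidHom.coe_mk, ZeroHom.coe_mk, mul_neg, neg_le_neg_iff] at h2
      exact_mod_cast h2
    have hCW : ∀ (l : Fin 1 →₀ ℕ) (e : Fin m →₀ ℕ),
        MvPolynomial.aeval (fun j : Fin m => ξ j.succ) (theta e U) ≠ 0 →
        MvPolynomial.aeval (fun _ => ξ 0) (theta l V) ≠ 0 →
        (dilate ξ W).coeff (Finsupp.cons (l 0) e) ≠ 0 := by
      intro l e h1 h2 h3
      rw [coeff_dilate] at h3
      have h4 : MvPolynomial.aeval ξ (theta (Finsupp.cons (l 0) e) (separated U V)) ≠ 0 := by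
        rw [theta_separated, aeval_separated]
        exact mul_ne_zero h1 h2
      rw [← hcW, MvPolynomial.C_mul', map_smul, map_smul, h3, smul_zero] at h4
      exact h4 rfl
    obtain ⟨eU, heU, hneU⟩ := H (fun j => ξ j.succ) (fun j => h j.succ) (fun j => s * r j.succ)
      (fun j => hh _) (fun j => hlow _) (fun j => Nat.mul_pos hs1 (hr1 _))
      (by
        intro a b hab
        have h1 := hrr a.succ b.succ (Fin.succ_lt_succ_iff.mpr hab)
        have h2 : δ * r b.succ ≤ δ' * r b.succ := by
          gcongr
          linarith
        push_cast
        nlinarith)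
      U hU
      (by
        intro e he j
        obtain ⟨l, hl⟩ := hUW e he
        simpa using hdegW _ hl j.succ)
      (by
        intro j
        have h1 := hE j.succ
        push_cast
        rw [← Finset.mul_sum]
        have h2 : ∑ j : Fin m, (r j.succ : ℝ) ≤ E := by
          rw [Fin.sum_univ_succ] at hEsum
          linarith [hr0 0]
        calc (s : ℝ) * ∑ j : Fin m, (r j.succ : ℝ) + Real.log (length U)
            ≤ s * E + 2 * s * E := by gcongr
          _ = 3 * s * E := by ring
          _ ≤ 3 * s * (δ * r j.succ * h j.succ) := by gcongr
          _ = (3 * δ) * (s * r j.succ) * h j.succ := by ring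
          _ ≤ δ' * (s * r j.succ) * h j.succ := by
            have := (hh j.succ).le
            gcongr)
    obtain ⟨l, hl, hneV⟩ := hlow 0 V hV (s * r 0) (by
      intro l hl
      obtain ⟨e, he⟩ := hVW l hl
      simpa using hdegW _ he 0)
    have hlr : (l 0 : ℝ) / r 0 ≤ s * (ε ^ 2 / 128) := by
      have h1 : (l 0 : ℝ) * h 0 ≤ (s * (4 * C * δ)) * r 0 * h 0 := by
        refine hl.trans ?_
        push_cast
        have h2 : (r 0 : ℝ) ≤ E := (Finset.single_le_sum (f := fun j => (r j : ℝ))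
          (fun _ _ => Nat.cast_nonneg _) (Finset.mem_univ 0)).trans hEsum
        have h4 : 1 ≤ s * E := by nlinarith [hr0 0]
        calc C * (Real.log (length V) + s * r 0 + 1) ≤ C * (2 * s * E + s * E + s * E) := by gcongr
          _ = 4 * C * s * E := by ring
          _ ≤ 4 * C * s * (δ * r 0 * h 0) := by gcongr; exact hE 0
          _ = _ := by ring
      have h3 := le_of_mul_le_mul_right h1 (hh 0)
      rw [div_le_iff₀ (by linarith [hr0 0])]
      refine h3.trans ?_
      gcongr
    have hweight : relWeight r (Finsupp.cons (l 0) eU) ≤ s * (ε ^ 2 / 64) := by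
      rw [relWeight_cons]
      have h1 : relWeight (fun j : Fin m => r j.succ) eU ≤ s * (ε ^ 2 / 128) := by
        have : relWeight (fun j : Fin m => r j.succ) eU =
            s * relWeight (fun j : Fin m => s * r j.succ) eU := by
          rw [relWeight_apply, relWeight_apply, Finset.mul_sum]
          refine Finset.sum_congr rfl fun j _ => ?_
          have := hr0 j.succ
          push_cast
          field_simp
        rw [this]
        gcongr
      linarith
    have hge := WeightGE.det (w := relWeight r)
      (t := fun b : Fin s => max 0 ((ε - m * δ) - (k b : ℕ) / (r 0 : ℝ)))
      (M := Matrix.of fun a b => dilate ξ (theta (Finsupp.cons (k b : ℕ) (i a)) P)) (by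
        intro a b e he
        refine max_le (relWeight_nonneg r e) ?_
        by_contra hlt
        push Not at hlt
        rw [Matrix.of_apply, coeff_dilate] at he
        refine he (aeval_theta_theta_eq_zero ξ P e _ fun f hf => hcon f ?_)
        refine (relWeight_mono r hf).trans ?_
        rw [map_add, relWeight_cons]
        have hia : relWeight (fun j : Fin m => r j.succ) (i a) ≤ m * δ := by
          rw [relWeight_apply]
          calc ∑ j, (i a j : ℝ) / r j.succ ≤ ∑ _j : Fin m, δ := by
                refine Finset.sum_le_sum fun j _ => ?_
                rw [div_le_iff₀ (by linarith [hr0 j.succ])]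
                have h1 : i a j ≤ r 0 := by
                  have := hi a j
                  omega
                have h2 : (i a j : ℝ) ≤ r 0 := by exact_mod_cast h1
                exact h2.trans (hrr 0 j.succ (Fin.succ_pos j))
            _ = m * δ := by simp
        linarith)
    have hdetW : (Matrix.of fun a b => dilate ξ (theta (Finsupp.cons (k b : ℕ) (i a)) P)).det =
        dilate ξ W := by
      rw [hW, AlgHom.map_det]
      rfl
    rw [hdetW] at hge
    have h1 := (hge _ (hCW l eU hneU hneV)).trans hweight
    have h2 := sum_max_sub_ge hs1 hsr (hr1 0) k (θ := ε - m * δ) (by linarith) (by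
      have : 0 ≤ m * δ := by positivity
      linarith)
    have h3 : (ε / 2) ^ 2 ≤ (ε - m * δ) ^ 2 := by
      gcongr
      linarith
    have h4 : (0 : ℝ) < s * ε ^ 2 := by positivity
    have h5 : (s : ℝ) * (ε / 2) ^ 2 ≤ s * (ε - m * δ) ^ 2 := by gcongr
    linarith

section Liouville

open scoped Matrix

/-! ## Powers of an algebraic number and Liouville's inequality -/

/-- Multiplication by a multiple of an algebraic number is given by an integral matrix. -/
theorem exists_int_matrix_mulVec {K : Type*} [Field K] [CharZero K] [Algebra ℚ K] {α : K}
    (hα : IsAlgebraic ℚ α) : ∃ (d : ℕ) (A : Matrix (Fin (d + 1)) (Fin (d + 1)) ℤ) (a : ℤ), 0 < a ∧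
      LinearIndependent ℚ (fun l : Fin (d + 1) => α ^ (l : ℕ)) ∧
      (A.map (Int.cast : ℤ → K)) *ᵥ (fun l => α ^ (l : ℕ)) =
        ((a : K) * α) • fun l : Fin (d + 1) => α ^ (l : ℕ) := by
  have hint := hα.isIntegral
  have hd := minpoly.natDegree_pos hint
  obtain ⟨d, hd'⟩ : ∃ d, (minpoly ℚ α).natDegree = d + 1 := ⟨_, (Nat.sub_add_cancel hd).symm⟩
  have hLI : LinearIndependent ℚ (fun l : Fin (d + 1) => α ^ (l : ℕ)) := by
    have := linearIndependent_pow (K := ℚ) α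
    rwa [hd'] at this
  let B : Fin (d + 1) → Fin (d + 1) → ℚ := fun l i =>
    ((X ^ ((l : ℕ) + 1) : ℚ[X]) %ₘ minpoly ℚ α).coeff i
  have hB : ∀ l : Fin (d + 1), ∑ i, ((B l i : ℚ) : K) * α ^ (i : ℕ) = α ^ ((l : ℕ) + 1) := by
    intro l
    have h1 := aeval_modByMonic_eq_self_of_root (p := (X ^ ((l : ℕ) + 1) : ℚ[X]))
      (q := minpoly ℚ α) (x := α) (minpoly.aeval ℚ α)
    have h2 : ((X ^ ((l : ℕ) + 1) : ℚ[X]) %ₘ minpoly ℚ α).natDegree < d + 1 := by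
      exact (natDegree_modByMonic_lt (X ^ ((l : ℕ) + 1)) (minpoly.monic hint)
        (minpoly.ne_one ℚ α)).trans_eq hd'
    rw [aeval_eq_sum_range' h2, map_pow, aeval_X] at h1
    rw [← h1, ← Fin.sum_univ_eq_sum_range
      (fun i => ((X ^ ((l : ℕ) + 1) : ℚ[X]) %ₘ minpoly ℚ α).coeff i • α ^ i)]
    refine Finset.sum_congr rfl fun i _ => ?_
    rw [Algebra.smul_def]
    simp [B]
  let a : ℕ := ∏ l, ∏ i, (B l i).den
  have ha : ∀ l i, ∃ z : ℤ, (z : ℚ) = a * B l i := by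
    intro l i
    obtain ⟨c, hc⟩ : (B l i).den ∣ a :=
      (Finset.dvd_prod_of_mem _ (Finset.mem_univ i)).trans
        (Finset.dvd_prod_of_mem (fun l => ∏ i, (B l i).den) (Finset.mem_univ l))
    refine ⟨c * (B l i).num, ?_⟩
    rw [hc]
    push_cast
    have := Rat.mul_den_eq_num (B l i)
    rw [← this]
    ring
  choose A hA using ha
  refine ⟨d, Matrix.of A, a, ?_, hLI, ?_⟩
  · exact_mod_cast Finset.prod_pos fun l _ => Finset.prod_pos fun i _ => (B l i).den_pos
  · ext l
    have h1 : ∀ i, ((A l i : ℤ) : K) = a * ((B l i : ℚ) : K) := by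
      intro i
      have := congrArg (fun q : ℚ => (q : K)) (hA l i)
      simpa using this
    simp only [Matrix.mulVec, dotProduct, Matrix.map_apply, Matrix.of_apply, h1, Pi.smul_apply,
      smul_eq_mul]
    simp_rw [mul_assoc, ← Finset.mul_sum]
    rw [hB]
    push_cast
    ring

theorem abs_matrix_pow_le {d : ℕ} (A : Matrix (Fin (d + 1)) (Fin (d + 1)) ℤ) :
    ∃ B : ℝ, 1 ≤ B ∧ ∀ n i j, |(((A ^ n) i j : ℤ) : ℝ)| ≤ B ^ n := by
  refine ⟨1 + ∑ i, ∑ j, |((A i j : ℤ) : ℝ)|, ?_, fun n => ?_⟩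
  · have : 0 ≤ ∑ i, ∑ j, |((A i j : ℤ) : ℝ)| := by positivity
    linarith
  · set B := 1 + ∑ i, ∑ j, |((A i j : ℤ) : ℝ)|
    have hB : ∀ i, ∑ j, |((A i j : ℤ) : ℝ)| ≤ B := by
      intro i
      have := Finset.single_le_sum (f := fun i => ∑ j, |((A i j : ℤ) : ℝ)|)
        (fun _ _ => by positivity) (Finset.mem_univ i)
      simp only [B]
      linarith
    induction n with
    | zero =>
      intro i j
      rw [pow_zero, pow_zero, Matrix.one_apply]
      split_ifs <;> simp
    | succ n ih =>
      intro i j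
      have hB0 : 0 ≤ B := by positivity
      rw [pow_succ', Matrix.mul_apply, Int.cast_sum]
      refine (Finset.abs_sum_le_sum_abs _ _).trans ?_
      calc ∑ l, |((A i l * (A ^ n) l j : ℤ) : ℝ)| ≤ ∑ l, |((A i l : ℤ) : ℝ)| * B ^ n := by
            refine Finset.sum_le_sum fun l _ => ?_
            rw [Int.cast_mul, abs_mul]
            gcongr
            exact ih l j
        _ ≤ B * B ^ n := by
            rw [← Finset.sum_mul]
            gcongr
            exact hB i
        _ = B ^ (n + 1) := (pow_succ' _ _).symm

theorem one_le_abs_mul_norm_intCast {p : ℕ} [hp : Fact p.Prime] {z : ℤ} (hz : z ≠ 0) :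
    1 ≤ |(z : ℝ)| * ‖(z : ℚ_[p])‖ := by
  have h0 : (z : ℚ_[p]) ≠ 0 := by exact_mod_cast hz
  rw [Padic.norm_eq_zpow_neg_valuation h0, Padic.valuation_intCast, zpow_neg, zpow_natCast]
  have hpos : (0 : ℝ) < (p : ℝ) ^ padicValInt p z := by
    have : (0 : ℝ) < p := by exact_mod_cast hp.out.pos
    positivity
  rw [← div_eq_mul_inv, one_le_div hpos]
  have hdvd : (p : ℤ) ^ padicValInt p z ∣ z := padicValInt_dvd z
  have := Int.le_of_dvd (abs_pos.mpr hz) ((dvd_abs _ _).mpr hdvd)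
  exact_mod_cast this

theorem matrix_pow_mulVec {K ι : Type*} [Field K] [Fintype ι] [DecidableEq ι] {A : Matrix ι ι K}
    {v : ι → K} {c : K} (h : A *ᵥ v = c • v) (n : ℕ) : (A ^ n) *ᵥ v = c ^ n • v := by
  induction n with
  | zero => simp
  | succ n ih => rw [pow_succ, ← Matrix.mulVec_mulVec, h, Matrix.mulVec_smul, ih, smul_smul, pow_succ']

/-- **Liouville's inequality** for the `p`-adic values of integral polynomials. -/
theorem exists_liouville {p : ℕ} [hp : Fact p.Prime] {α : ℚ_[p]} (hα : IsAlgebraic ℚ α) :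
    ∃ C : ℝ, 1 ≤ C ∧ ∀ (F : ℤ[X]) (r : ℕ) (M : ℝ), F.natDegree ≤ r →
      (∀ i, |((F.coeff i : ℤ) : ℝ)| ≤ M) → aeval α F ≠ 0 →
      -Real.log ‖aeval α F‖ ≤ C * (Real.log M + r + 1) := by
  obtain ⟨d, A, a, ha, hLI, hA⟩ := exists_int_matrix_mulVec hα
  obtain ⟨B, hB1, hB⟩ := abs_matrix_pow_le A
  set v : Fin (d + 1) → ℚ_[p] := fun l => α ^ (l : ℕ) with hv
  have ha1 : (1 : ℝ) ≤ a := by exact_mod_cast ha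
  set R := max 1 ‖α‖ with hR
  have hR1 : 1 ≤ R := le_max_left _ _
  set D : ℝ := (d : ℝ) + 1 with hD
  have hD1 : 1 ≤ D := by simp [hD]
  set C : ℝ := D * (1 + Real.log B + Real.log a) + Real.log (d + 1).factorial + d * Real.log R
    with hC
  have hlogB := Real.log_nonneg hB1
  have hloga := Real.log_nonneg ha1
  have hlogR := Real.log_nonneg hR1
  have hlogd : 0 ≤ Real.log (d + 1).factorial :=
    Real.log_nonneg (by exact_mod_cast Nat.one_le_iff_ne_zero.mpr (Nat.factorial_ne_zero _))
  have hCD : D ≤ C := by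
    have h1 : 0 ≤ d * Real.log R := by positivity
    nlinarith
  refine ⟨C, hD1.trans hCD, fun F r M hr hM hF => ?_⟩
  have hM1 : 1 ≤ M := by
    have hF0 : F ≠ 0 := by
      rintro rfl
      exact hF (map_zero _)
    obtain ⟨i, hi⟩ : ∃ i, F.coeff i ≠ 0 := by
      by_contra h
      push Not at h
      exact hF0 (Polynomial.ext h)
    exact le_trans (by exact_mod_cast Int.one_le_abs hi) (hM i)
  have hlogM := Real.log_nonneg hM1
  let N : Matrix (Fin (d + 1)) (Fin (d + 1)) ℤ :=
    ∑ i ∈ Finset.range (r + 1), (F.coeff i * a ^ (r - i)) • A ^ i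
  have hmapN : N.map (Int.cast : ℤ → ℚ_[p]) = ∑ i ∈ Finset.range (r + 1),
      (((F.coeff i : ℤ) : ℚ_[p]) * (a : ℚ_[p]) ^ (r - i)) • (A.map (Int.cast : ℤ → ℚ_[p])) ^ i := by
    have h1 : ∀ Q : Matrix (Fin (d + 1)) (Fin (d + 1)) ℤ, Q.map (Int.cast : ℤ → ℚ_[p]) =
        (Int.castRingHom ℚ_[p]).mapMatrix Q := fun Q => rfl
    rw [h1, h1, map_sum]
    refine Finset.sum_congr rfl fun i _ => ?_
    rw [← map_pow]
    ext j l
    simp only [RingHom.mapMatrix_apply, Matrix.map_apply, Matrix.smul_apply, smul_eq_mul,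
      eq_intCast]
    push_cast
    rfl
  have hNv : N.map (Int.cast : ℤ → ℚ_[p]) *ᵥ v = ((a : ℚ_[p]) ^ r * aeval α F) • v := by
    rw [hmapN, Matrix.sum_mulVec, aeval_eq_sum_range' (Nat.lt_succ_of_le hr), Finset.mul_sum,
      Finset.sum_smul]
    refine Finset.sum_congr rfl fun i hi => ?_
    rw [Matrix.smul_mulVec, matrix_pow_mulVec hA, smul_smul]
    congr 1
    have : r = (r - i) + i := by
      have := Finset.mem_range.mp hi
      omega
    conv_rhs => rw [this, pow_add]
    rw [zsmul_eq_mul, mul_pow]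
    ring
  set β := (a : ℚ_[p]) ^ r * aeval α F with hβ
  have hβ0 : β ≠ 0 := mul_ne_zero (pow_ne_zero _ (by exact_mod_cast ha.ne')) hF
  have hdet : N.det ≠ 0 := by
    intro h0
    obtain ⟨u, hu0, hu⟩ := Matrix.exists_vecMul_eq_zero_iff.mpr h0
    have h1 : (fun i => ((u i : ℤ) : ℚ_[p])) ᵥ* N.map (Int.cast : ℤ → ℚ_[p]) = 0 := by
      ext j
      have := congrArg (fun z : ℤ => (z : ℚ_[p])) (congrFun hu j)
      simpa [Matrix.vecMul, dotProduct] using this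
    have h2 : (fun i => ((u i : ℤ) : ℚ_[p])) ⬝ᵥ (N.map (Int.cast : ℤ → ℚ_[p]) *ᵥ v) = 0 := by
      rw [Matrix.dotProduct_mulVec, h1, zero_dotProduct]
    rw [hNv, dotProduct_smul, smul_eq_mul, mul_eq_zero, or_iff_right hβ0] at h2
    rw [Fintype.linearIndependent_iff] at hLI
    have h3 := hLI (fun i => (u i : ℚ)) (by
      rw [← h2, dotProduct]
      refine Finset.sum_congr rfl fun i _ => ?_
      rw [Algebra.smul_def]
      simp [hv])
    exact hu0 (funext fun i => by exact_mod_cast h3 i)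
  have hadj : ((N.det : ℤ) : ℚ_[p]) =
      β * ((N.adjugate.map (Int.cast : ℤ → ℚ_[p])) *ᵥ v) 0 := by
    have h1 : (N.adjugate.map (Int.cast : ℤ → ℚ_[p])) * (N.map (Int.cast : ℤ → ℚ_[p])) =
        ((N.det : ℤ) : ℚ_[p]) • 1 := by
      have h2 := congrArg (Int.castRingHom ℚ_[p]).mapMatrix (Matrix.adjugate_mul N)
      rw [map_mul] at h2
      refine h2.trans ?_
      ext i j
      simp only [RingHom.mapMatrix_apply, Matrix.map_apply, Matrix.smul_apply, smul_eq_mul,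
        eq_intCast, Matrix.one_apply]
      split_ifs <;> simp
    have h3 := congrArg (fun Q => (Q *ᵥ v) 0) h1
    simp only [← Matrix.mulVec_mulVec, hNv, Matrix.mulVec_smul, Matrix.smul_mulVec,
      Matrix.one_mulVec, Pi.smul_apply, smul_eq_mul] at h3
    rw [h3]
    simp [hv]
  have hnorm : ‖((N.det : ℤ) : ℚ_[p])‖ ≤ ‖aeval α F‖ * R ^ d := by
    rw [hadj, norm_mul]
    have h1 : ‖β‖ ≤ ‖aeval α F‖ := by
      rw [hβ, norm_mul, norm_pow]
      exact mul_le_of_le_one_left (norm_nonneg _)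
        (pow_le_one₀ (norm_nonneg _) (Padic.norm_int_le_one _))
    gcongr
    rw [Matrix.mulVec, dotProduct]
    refine IsUltrametricDist.norm_sum_le_of_forall_le_of_nonneg (by positivity) fun i _ => ?_
    rw [norm_mul, Matrix.map_apply]
    refine (mul_le_of_le_one_left (norm_nonneg _) (Padic.norm_int_le_one _)).trans ?_
    rw [hv, norm_pow]
    calc ‖α‖ ^ (i : ℕ) ≤ R ^ (i : ℕ) := by gcongr; exact le_max_right _ _
      _ ≤ R ^ d := pow_le_pow_right₀ hR1 (Nat.lt_succ_iff.mp i.2)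
  have hentry : ∀ i j, |((N i j : ℤ) : ℝ)| ≤ Real.exp r * M * (a * B) ^ r := by
    intro i j
    have h1 : ((N i j : ℤ) : ℝ) = ∑ l ∈ Finset.range (r + 1),
        ((F.coeff l : ℤ) : ℝ) * (a : ℝ) ^ (r - l) * (((A ^ l) i j : ℤ) : ℝ) := by
      simp only [N, Matrix.sum_apply, Matrix.smul_apply, smul_eq_mul]
      push_cast
      rfl
    rw [h1]
    refine (Finset.abs_sum_le_sum_abs _ _).trans ?_
    calc _ ≤ ∑ l ∈ Finset.range (r + 1), M * (a * B) ^ r := by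
          refine Finset.sum_le_sum fun l hl => ?_
          have hlr : l ≤ r := Nat.lt_succ_iff.mp (Finset.mem_range.mp hl)
          rw [abs_mul, abs_mul, abs_pow, abs_of_pos (by linarith : (0 : ℝ) < a), mul_assoc]
          refine mul_le_mul (hM l) ?_ (by positivity) (by linarith)
          rw [mul_pow]
          refine mul_le_mul (pow_le_pow_right₀ ha1 (Nat.sub_le _ _))
            ((hB l i j).trans (pow_le_pow_right₀ hB1 hlr)) (abs_nonneg _) (by positivity)
      _ = (r + 1 : ℝ) * (M * (a * B) ^ r) := by simp
      _ ≤ Real.exp r * (M * (a * B) ^ r) := by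
          gcongr
          exact Real.add_one_le_exp _
      _ = _ := by ring
  have hdetle : |((N.det : ℤ) : ℝ)| ≤
      (d + 1).factorial * (Real.exp r * M * (a * B) ^ r) ^ (d + 1) := by
    have := Matrix.det_le (A := N.map (Int.cast : ℤ → ℝ)) (abv := AbsoluteValue.abs)
      (x := Real.exp r * M * (a * B) ^ r) (by simpa using hentry)
    have h2 : (N.map (Int.cast : ℤ → ℝ)).det = ((N.det : ℤ) : ℝ) := (Int.cast_det N).symm
    rw [h2] at this
    simpa using this
  have hFpos : 0 < ‖aeval α F‖ := norm_pos_iff.mpr hF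
  have hfin := one_le_abs_mul_norm_intCast (p := p) hdet
  have hfin2 : 1 ≤ ((d + 1).factorial * (Real.exp r * M * (a * B) ^ r) ^ (d + 1)) *
      (‖aeval α F‖ * R ^ d) :=
    hfin.trans (mul_le_mul hdetle hnorm (norm_nonneg _) (by positivity))
  have hlog := Real.log_nonneg hfin2
  have hfac : ((d + 1).factorial : ℝ) ≠ 0 := by exact_mod_cast Nat.factorial_ne_zero _
  have haB : (a : ℝ) ≠ 0 := by linarith
  have hB0 : B ≠ 0 := by linarith
  have hM0 : M ≠ 0 := by linarith
  have hR0 : R ≠ 0 := by linarith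
  rw [Real.log_mul (by positivity) (by positivity), Real.log_mul hfac (by positivity),
    Real.log_mul hFpos.ne' (by positivity), Real.log_pow, Real.log_pow,
    Real.log_mul (by positivity) (by positivity), Real.log_mul (by positivity) hM0, Real.log_exp,
    Real.log_pow, Real.log_mul haB hB0] at hlog
  push_cast at hlog
  have hr0 : (0 : ℝ) ≤ r := Nat.cast_nonneg r
  have hkey : (d + 1 : ℝ) * (r + Real.log M + r * (Real.log a + Real.log B)) +
      Real.log (d + 1).factorial + d * Real.log R ≤ C * (Real.log M + r + 1) := by
    have h1 : 0 ≤ d * Real.log R := by positivity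
    have h2 : 0 ≤ Real.log B + Real.log a := by positivity
    have h3 : 0 ≤ D * (Real.log B + Real.log a) := by positivity
    have h4 : C * (Real.log M + r + 1) = D * Real.log M + D * r + D +
        D * (Real.log B + Real.log a) * (Real.log M + 1) + D * (Real.log B + Real.log a) * r +
        (Real.log (d + 1).factorial + d * Real.log R) * (Real.log M + r) +
        (Real.log (d + 1).factorial + d * Real.log R) := by
      rw [hC]; ring
    rw [h4, ← hD]
    have h5 : 0 ≤ D * (Real.log B + Real.log a) * (Real.log M + 1) := by positivity
    have h6 : 0 ≤ (Real.log (d + 1).factorial + d * Real.log R) * (Real.log M + r) := by positivity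
    nlinarith
  linarith

end Liouville

/-! ## Vanishing orders at good approximations -/

theorem eval_hasseDeriv_X_sub_C_pow_mul {K : Type*} [CommRing K] (s : ℕ) (q : K[X]) (a : K) :
    (hasseDeriv s ((X - C a) ^ s * q)).eval a = q.eval a := by
  rw [← taylor_coeff, taylor_mul, taylor_pow, map_sub, taylor_X, taylor_C, add_sub_cancel_right,
    coeff_X_pow_mul', if_pos le_rfl, Nat.sub_self, taylor_coeff_zero]

theorem norm_coeff_mul_pow_le_of_eq_X_sub_C_mul {K : Type*} [NormedField K] [IsUltrametricDist K]
    {G q : K[X]} {γ : K} {ρ M : ℝ} (hγ : ‖γ‖ ≤ ρ) (hρ : 1 ≤ ρ) (hG : G = (X - C γ) * q)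
    (hM : ∀ i, ‖G.coeff i‖ * ρ ^ i ≤ M) (i : ℕ) : ‖q.coeff i‖ * ρ ^ i ≤ M := by
  have hM0 : 0 ≤ M := le_trans (by positivity) (hM 0)
  have key : ∀ n i : ℕ, q.natDegree < i + n → ‖q.coeff i‖ * ρ ^ i ≤ M := by
    intro n
    induction n with
    | zero =>
      intro i hi
      rw [coeff_eq_zero_of_natDegree_lt (by omega), norm_zero, zero_mul]
      exact hM0
    | succ n ih =>
      intro i hi
      have h1 : q.coeff i = G.coeff (i + 1) + γ * q.coeff (i + 1) := by
        rw [hG, sub_mul, coeff_sub, coeff_X_mul, coeff_C_mul]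
        ring
      have hr : ρ ^ i ≤ ρ ^ (i + 1) := pow_le_pow_right₀ hρ (Nat.le_succ i)
      have hρi : 0 ≤ ρ ^ i := by positivity
      rw [h1]
      refine (mul_le_mul_of_nonneg_right (IsUltrametricDist.norm_add_le_max _ _) hρi).trans ?_
      rw [max_mul_of_nonneg _ _ hρi]
      refine max_le ((mul_le_mul_of_nonneg_left hr (norm_nonneg _)).trans (hM _)) ?_
      refine le_trans ?_ (ih (i + 1) (by omega))
      rw [norm_mul, pow_succ]
      have h2 : 0 ≤ ‖q.coeff (i + 1)‖ := norm_nonneg _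
      calc ‖γ‖ * ‖q.coeff (i + 1)‖ * ρ ^ i ≤ ρ * ‖q.coeff (i + 1)‖ * ρ ^ i := by gcongr
        _ = _ := by ring
  exact key (q.natDegree + 1) i (by omega)

theorem norm_coeff_mul_pow_le_of_eq_X_sub_C_pow_mul {K : Type*} [NormedField K]
    [IsUltrametricDist K] {γ : K} {ρ M : ℝ} (hγ : ‖γ‖ ≤ ρ) (hρ : 1 ≤ ρ) {q : K[X]} (s : ℕ) :
    ∀ G : K[X], G = (X - C γ) ^ s * q → (∀ i, ‖G.coeff i‖ * ρ ^ i ≤ M) →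
      ∀ i, ‖q.coeff i‖ * ρ ^ i ≤ M := by
  induction s with
  | zero =>
    rintro G rfl h
    simpa using h
  | succ s ih =>
    intro G hG h
    exact ih ((X - C γ) ^ s * q) rfl fun i =>
      norm_coeff_mul_pow_le_of_eq_X_sub_C_mul hγ hρ (by rw [hG]; ring) h i

theorem aeval_theta_eq_sum {σ R L : Type*} [Fintype σ] [CommRing R] [CommRing L] [Algebra R L]
    (ξ : σ → L) (P : MvPolynomial σ R) (e : σ →₀ ℕ) : MvPolynomial.aeval ξ (theta e P) =
      ∑ f ∈ P.support, (mchoose f e : L) * (algebraMap R L (P.coeff f) * ∏ j, ξ j ^ f j) := by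
  conv_lhs => rw [MvPolynomial.as_sum P]
  rw [map_sum, map_sum]
  refine Finset.sum_congr rfl fun f _ => ?_
  rw [theta_monomial, MvPolynomial.aeval_monomial, Finsupp.prod_fintype _ _ (by simp)]
  simp [mul_assoc]

/-- A polynomial in one variable has small order at a good approximation to an algebraic
number. -/
theorem exists_lowOrder {p : ℕ} [hp : Fact p.Prime] {α : ℚ_[p]} (hα : IsAlgebraic ℚ α) :
    ∃ C : ℝ, 1 ≤ C ∧ ∀ (ξ : ℚ_[p]) (h : ℝ), ξ ≠ α → ξ ≠ 0 → ‖ξ‖ = ‖α‖ →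
      ‖ξ - α‖ ≤ Real.exp (-h) → LowOrder C h ξ := by
  obtain ⟨C₀, hC₀, hL⟩ := exists_liouville hα
  set ρ := max 1 ‖α‖ with hρ
  have hρ1 : 1 ≤ ρ := le_max_left _ _
  have hlogρ := Real.log_nonneg hρ1
  refine ⟨2 * C₀ + Real.log ρ, by linarith, fun ξ h hne hξ0 hnorm hclose f hf D hD => ?_⟩
  set F : ℤ[X] := ∑ e ∈ f.support, monomial (e 0) (f.coeff e) with hFdef
  have hcoeff : ∀ e, F.coeff (e 0) = f.coeff e := by
    intro e
    rw [hFdef, finsetSum_coeff]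
    simp_rw [coeff_monomial]
    rw [Finset.sum_eq_single e]
    · simp
    · intro e' _ hne'
      rw [if_neg fun h0 => hne' (finsupp_fin_one_eq h0)]
    · intro he
      simpa using he
  have hcoeffle : ∀ i, |((F.coeff i : ℤ) : ℝ)| ≤ length f := by
    intro i
    have := hcoeff (Finsupp.single 0 i)
    rw [Finsupp.single_eq_same] at this
    rw [this]
    by_cases h0 : f.coeff (Finsupp.single 0 i) = 0
    · rw [h0]
      simpa using length_nonneg f
    · exact Finset.single_le_sum (f := fun e => |((f.coeff e : ℤ) : ℝ)|)
        (fun _ _ => abs_nonneg _) (MvPolynomial.mem_support_iff.mpr h0)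
  have hF0 : F ≠ 0 := by
    obtain ⟨e, he⟩ := MvPolynomial.ne_zero_iff.mp hf
    intro h0
    apply he
    rw [← hcoeff, h0, coeff_zero]
  have hFdeg : F.natDegree ≤ D := by
    refine natDegree_sum_le_of_forall_le _ _ fun e he => ?_
    exact (natDegree_monomial_le _).trans (hD e (MvPolynomial.mem_support_iff.mp he))
  have htheta : ∀ k : Fin 1 →₀ ℕ, MvPolynomial.aeval (fun _ => ξ) (theta k f) =
      ξ ^ k 0 * aeval ξ (hasseDeriv (k 0) F) := by
    intro k
    rw [aeval_theta_eq_sum, hFdef, map_sum, map_sum, Finset.mul_sum]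
    refine Finset.sum_congr rfl fun e _ => ?_
    rw [hasseDeriv_monomial, aeval_monomial]
    simp only [mchoose, Fin.prod_univ_one]
    rcases lt_or_ge (e 0) (k 0) with hlt | hge
    · rw [Nat.choose_eq_zero_of_lt hlt]
      simp
    · conv_lhs => rw [← Nat.sub_add_cancel hge, pow_add]
      rw [Nat.sub_add_cancel hge, map_mul, map_natCast]
      ring
  set G : ℚ_[p][X] := F.map (algebraMap ℤ ℚ_[p]) with hG
  have hG0 : G ≠ 0 := (Polynomial.map_ne_zero_iff (RingHom.injective_int _)).mpr hF0
  have hGcoeff : ∀ i, ‖G.coeff i‖ * ρ ^ i ≤ ρ ^ D := by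
    intro i
    by_cases hi : i ≤ D
    · rw [hG, coeff_map]
      refine (mul_le_of_le_one_left (by positivity) ?_).trans (pow_le_pow_right₀ hρ1 hi)
      simpa using Padic.norm_int_le_one (F.coeff i)
    · rw [hG, coeff_map, coeff_eq_zero_of_natDegree_lt (by omega)]
      simp only [map_zero, norm_zero, zero_mul]
      positivity
  obtain ⟨q, hq, hqd⟩ := exists_eq_pow_rootMultiplicity_mul_and_not_dvd G hG0 ξ
  set k := G.rootMultiplicity ξ
  have hq0 : q ≠ 0 := fun h0 => hqd (h0 ▸ dvd_zero _)
  obtain ⟨g, hg, hgd⟩ := exists_eq_pow_rootMultiplicity_mul_and_not_dvd q hq0 α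
  set s := q.rootMultiplicity α
  rw [dvd_iff_isRoot, IsRoot] at hqd hgd
  have hgcoeff := norm_coeff_mul_pow_le_of_eq_X_sub_C_pow_mul (le_max_right 1 ‖α‖) hρ1 s q hg
    (norm_coeff_mul_pow_le_of_eq_X_sub_C_pow_mul (hnorm.le.trans (le_max_right 1 ‖α‖)) hρ1 k G hq
      hGcoeff)
  have hgα : ‖g.eval α‖ ≤ ρ ^ D := by
    rw [eval_eq_sum_range]
    refine IsUltrametricDist.norm_sum_le_of_forall_le_of_nonneg (by positivity) fun i _ => ?_
    rw [norm_mul, norm_pow]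
    refine le_trans ?_ (hgcoeff i)
    gcongr
    exact le_max_right _ _
  have hmap : ∀ (n : ℕ) (β : ℚ_[p]), aeval β (hasseDeriv n F) = (hasseDeriv n G).eval β := by
    intro n β
    rw [aeval_def, ← eval_map]
    congr 1
    ext i
    simp [hasseDeriv_coeff, hG]
  have hGα : (hasseDeriv s G).eval α = (α - ξ) ^ k * g.eval α := by
    have : G = (X - C α) ^ s * ((X - C ξ) ^ k * g) := by
      rw [hq, hg]
      ring
    rw [this, eval_hasseDeriv_X_sub_C_pow_mul]
    simp
  have hGξ : (hasseDeriv k G).eval ξ = q.eval ξ := by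
    rw [hq, eval_hasseDeriv_X_sub_C_pow_mul]
  refine ⟨Finsupp.single 0 k, ?_, ?_⟩
  · rw [Finsupp.single_eq_same]
    have hlen : 1 ≤ length f := one_le_length hf
    have hloglen := Real.log_nonneg hlen
    have hne0 : aeval α (hasseDeriv s F) ≠ 0 := by
      rw [hmap, hGα]
      exact mul_ne_zero (pow_ne_zero _ (sub_ne_zero.mpr hne.symm)) hgd
    have h1 := hL (hasseDeriv s F) D (2 ^ D * length f)
      ((natDegree_hasseDeriv_le F s).trans ((Nat.sub_le _ _).trans hFdeg)) (fun i => by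
        rw [hasseDeriv_coeff]
        by_cases hi : F.coeff (i + s) = 0
        · rw [hi]
          simp only [mul_zero, Int.cast_zero, abs_zero]
          have := length_nonneg f
          positivity
        · push_cast
          rw [abs_mul]
          refine mul_le_mul ?_ (hcoeffle _) (abs_nonneg _) (by positivity)
          rw [Nat.abs_cast]
          have hle : i + s ≤ D := (le_natDegree_of_ne_zero hi).trans hFdeg
          calc (((i + s).choose s : ℕ) : ℝ) ≤ ((2 ^ (i + s) : ℕ) : ℝ) := by
                exact_mod_cast Nat.choose_le_two_pow _ _
            _ ≤ 2 ^ D := by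
                push_cast
                exact pow_le_pow_right₀ (by norm_num) hle) hne0
    have h2 : ‖aeval α (hasseDeriv s F)‖ ≤ Real.exp (-h) ^ k * ρ ^ D := by
      rw [hmap, hGα, norm_mul, norm_pow, norm_sub_rev]
      gcongr
    have h3 := Real.log_le_log (norm_pos_iff.mpr hne0) h2
    rw [Real.log_mul (by positivity) (by positivity), Real.log_pow, Real.log_pow, Real.log_exp]
      at h3
    rw [Real.log_mul (by positivity) (by positivity), Real.log_pow] at h1
    have hD0 : (0 : ℝ) ≤ D := Nat.cast_nonneg D
    have hlog2 : Real.log 2 ≤ 1 := by linarith [Real.log_two_lt_d9]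
    have h4 : C₀ * (D * Real.log 2) ≤ C₀ * D := by
      have : D * Real.log 2 ≤ D := mul_le_of_le_one_right hD0 hlog2
      gcongr
    have h5 : D * Real.log ρ ≤ Real.log ρ * (Real.log (length f) + D + 1) := by
      nlinarith [mul_nonneg hlogρ hloglen]
    have h6 : 0 ≤ C₀ * Real.log (length f) := by positivity
    nlinarith
  · rw [htheta, Finsupp.single_eq_same, hmap, hGξ]
    exact mul_ne_zero (pow_ne_zero _ hξ0) hqd

/-! ## The auxiliary polynomial -/

section Siegel

open scoped Matrix

attribute [local instance] Matrix.seminormedAddCommGroup in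
theorem exists_int_vec_mulVec_eq_zero {ι κ : Type*} [Fintype ι] [Fintype κ] [Nonempty ι]
    (A : Matrix ι κ ℤ) (hc : 2 * Fintype.card ι ≤ Fintype.card κ) {M : ℝ} (hM1 : 1 ≤ M)
    (hM : ∀ i j, |((A i j : ℤ) : ℝ)| ≤ M) :
    ∃ t : κ → ℤ, t ≠ 0 ∧ A *ᵥ t = 0 ∧ ∀ j, |((t j : ℤ) : ℝ)| ≤ Fintype.card κ * M := by
  have hι : 0 < Fintype.card ι := Fintype.card_pos
  obtain ⟨t, ht0, htA, ht⟩ := Int.Matrix.exists_ne_zero_int_vec_norm_le A (by omega) hι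
  refine ⟨t, ht0, htA, fun j => ?_⟩
  have h1 : ‖A‖ ≤ M := by
    rw [Matrix.norm_le_iff (by linarith)]
    intro i j
    rw [Int.norm_eq_abs]
    exact hM i j
  have h2 : max 1 ‖A‖ ≤ M := max_le hM1 h1
  have hκ : (1 : ℝ) ≤ Fintype.card κ := by exact_mod_cast (by omega : 1 ≤ Fintype.card κ)
  have h3 : 1 ≤ (Fintype.card κ : ℝ) * max 1 ‖A‖ := by
    nlinarith [le_max_left 1 ‖A‖]
  have hc' : 2 * (Fintype.card ι : ℝ) ≤ Fintype.card κ := by exact_mod_cast hc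
  have hι' : (0 : ℝ) < Fintype.card ι := by exact_mod_cast hι
  calc |((t j : ℤ) : ℝ)| = ‖t j‖ := (Int.norm_eq_abs _).symm
    _ ≤ ‖t‖ := norm_le_pi_norm t j
    _ ≤ _ := ht
    _ ≤ ((Fintype.card κ : ℝ) * max 1 ‖A‖) ^ (1 : ℝ) := by
        refine Real.rpow_le_rpow_of_exponent_le h3 ?_
        rw [div_le_one (by linarith)]
        linarith
    _ ≤ _ := by
        rw [Real.rpow_one]
        gcongr

theorem sum_sq_sum_sub_half_le {m : ℕ} (r : Fin m → ℕ) (hr : ∀ j, 1 ≤ r j) :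
    ∑ i : (j : Fin m) → Fin (r j + 1), (∑ j, (((i j : ℕ) : ℝ) / r j - 1 / 2)) ^ 2 ≤
      (Fintype.card ((j : Fin m) → Fin (r j + 1)) : ℝ) * (m / 4) := by
  have hcross : ∀ j k : Fin m, j ≠ k → ∑ i : (j : Fin m) → Fin (r j + 1),
      (((i j : ℕ) : ℝ) / r j - 1 / 2) * (((i k : ℕ) : ℝ) / r k - 1 / 2) = 0 := by
    intro j k hjk
    let flip : ((j : Fin m) → Fin (r j + 1)) → ((j : Fin m) → Fin (r j + 1)) :=
      fun i => Function.update i j (Fin.rev (i j))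
    have hflip : Function.Involutive flip := by
      intro i
      simp [flip]
    have h1 := Equiv.sum_comp (hflip.toPerm flip) fun i : (j : Fin m) → Fin (r j + 1) =>
      (((i j : ℕ) : ℝ) / r j - 1 / 2) * (((i k : ℕ) : ℝ) / r k - 1 / 2)
    have h2 : ∀ i : (j : Fin m) → Fin (r j + 1),
        (((((hflip.toPerm flip) i) j : ℕ) : ℝ) / r j - 1 / 2) *
          (((((hflip.toPerm flip) i) k : ℕ) : ℝ) / r k - 1 / 2) =
        -((((i j : ℕ) : ℝ) / r j - 1 / 2) * (((i k : ℕ) : ℝ) / r k - 1 / 2)) := by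
      intro i
      have hrj : (r j : ℝ) ≠ 0 := by
        have := hr j
        exact_mod_cast (by omega : r j ≠ 0)
      have hle : (i j : ℕ) ≤ r j := Nat.lt_succ_iff.mp (i j).2
      have h3 : ((((hflip.toPerm flip) i) j : ℕ) : ℝ) = r j - (i j : ℕ) := by
        simp only [Function.Involutive.coe_toPerm, flip, Function.update_self, Fin.val_rev]
        rw [← Nat.cast_sub hle]
        congr 1
        omega
      have h4 : ((hflip.toPerm flip) i) k = i k := by
        simp [flip, Function.update_of_ne hjk.symm]
      rw [h3, h4, sub_div, div_self hrj]
      ring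
    simp_rw [h2, Finset.sum_neg_distrib] at h1
    linarith
  have hsq : ∀ (j : Fin m) (i : (j : Fin m) → Fin (r j + 1)),
      (((i j : ℕ) : ℝ) / r j - 1 / 2) * (((i j : ℕ) : ℝ) / r j - 1 / 2) ≤ 1 / 4 := by
    intro j i
    have h0 : 0 ≤ ((i j : ℕ) : ℝ) / r j := by positivity
    have h1 : ((i j : ℕ) : ℝ) / r j ≤ 1 := by
      refine div_le_one_of_le₀ ?_ (Nat.cast_nonneg _)
      exact_mod_cast Nat.lt_succ_iff.mp (i j).2
    nlinarith
  calc _ = ∑ j : Fin m, ∑ k : Fin m, ∑ i : (j : Fin m) → Fin (r j + 1),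
        (((i j : ℕ) : ℝ) / r j - 1 / 2) * (((i k : ℕ) : ℝ) / r k - 1 / 2) := by
        simp_rw [sq, Finset.sum_mul_sum]
        rw [Finset.sum_comm]
        refine Finset.sum_congr rfl fun j _ => ?_
        rw [Finset.sum_comm]
    _ = ∑ j : Fin m, ∑ i : (j : Fin m) → Fin (r j + 1),
        (((i j : ℕ) : ℝ) / r j - 1 / 2) * (((i j : ℕ) : ℝ) / r j - 1 / 2) := by
        refine Finset.sum_congr rfl fun j _ => ?_
        exact Finset.sum_eq_single j (fun k _ hk => hcross j k hk.symm) (by simp)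
    _ ≤ ∑ j : Fin m, ∑ i : (j : Fin m) → Fin (r j + 1), (1 / 4 : ℝ) :=
        Finset.sum_le_sum fun j _ => Finset.sum_le_sum fun i _ => hsq j i
    _ = _ := by
        rw [Finset.sum_const, Finset.sum_const, Finset.card_univ, Finset.card_univ,
          Fintype.card_fin]
        simp only [nsmul_eq_mul]
        ring

theorem card_relWeight_lt_le {m : ℕ} (hm : 1 ≤ m) (r : Fin m → ℕ) (hr : ∀ j, 1 ≤ r j) {ε : ℝ}
    (hε : 0 < ε) {D : ℕ} (hD : D ≤ 2 * ε ^ 2 * m) :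
    2 * ((Finset.univ.filter fun i : (j : Fin m) → Fin (r j + 1) =>
      ∑ j, ((i j : ℕ) : ℝ) / r j < (1 / 2 - ε) * m).card * D) ≤
        Fintype.card ((j : Fin m) → Fin (r j + 1)) := by
  set S := Finset.univ.filter fun i : (j : Fin m) → Fin (r j + 1) =>
    ∑ j, ((i j : ℕ) : ℝ) / r j < (1 / 2 - ε) * m
  set c := Fintype.card ((j : Fin m) → Fin (r j + 1))
  have hm0 : (0 : ℝ) < m := by exact_mod_cast hm
  have h1 : (S.card : ℝ) * (ε * m) ^ 2 ≤ c * (m / 4) := by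
    refine le_trans ?_ (sum_sq_sum_sub_half_le r hr)
    rw [← nsmul_eq_mul, ← Finset.sum_const]
    refine (Finset.sum_le_sum fun i hi => ?_).trans
      (Finset.sum_le_univ_sum_of_nonneg fun i => sq_nonneg _)
    have h2 := (Finset.mem_filter.mp hi).2
    rw [Finset.sum_sub_distrib]
    simp only [Finset.sum_const, Finset.card_univ, Fintype.card_fin, nsmul_eq_mul]
    have h3 : 0 < ε * m := by positivity
    nlinarith
  have h4 : (S.card : ℝ) * (4 * ε ^ 2 * m) ≤ c := by
    have : (S.card : ℝ) * (4 * ε ^ 2 * m) * m ≤ c * m := by nlinarith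
    exact le_of_mul_le_mul_right this hm0
  have h5 : (2 : ℝ) * (S.card * D) ≤ c := by
    have : (S.card : ℝ) * D ≤ S.card * (2 * ε ^ 2 * m) := by gcongr
    linarith
  exact_mod_cast h5

/-- Siegel's lemma gives an integral polynomial vanishing to high order at `(α, …, α)`. -/
theorem exists_auxiliary_polynomial {K : Type*} [Field K] [CharZero K] [Algebra ℚ K] {α : K}
    (hα : IsAlgebraic ℚ α) {ε : ℝ} (hε : 0 < ε) (hε2 : ε < 1 / 2) :
    ∃ (m₀ : ℕ) (C : ℝ), 1 ≤ C ∧ ∀ m, m₀ ≤ m → 1 ≤ m → ∀ r : Fin m → ℕ, (∀ j, 1 ≤ r j) →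
      ∃ P : MvPolynomial (Fin m) ℤ, P ≠ 0 ∧ (∀ e, P.coeff e ≠ 0 → ∀ j, e j ≤ r j) ∧
        length P ≤ C ^ ∑ j, r j ∧
        ∀ i, relWeight r i < (1 / 2 - ε) * m → MvPolynomial.aeval (fun _ => α) (theta i P) = 0 := by
  classical
  obtain ⟨d, A, a, ha, -, hA⟩ := exists_int_matrix_mulVec hα
  obtain ⟨B, hB1, hB⟩ := abs_matrix_pow_le A
  set v : Fin (d + 1) → K := fun l => α ^ (l : ℕ) with hv
  have ha1 : (1 : ℝ) ≤ a := by exact_mod_cast ha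
  have haB1 : 1 ≤ a * B := by nlinarith
  refine ⟨⌈((d + 1 : ℕ) : ℝ) / (2 * ε ^ 2)⌉₊, 8 * (a * B), by linarith, fun m hm hm1 r hr => ?_⟩
  have hm2 : ((d + 1 : ℕ) : ℝ) ≤ 2 * ε ^ 2 * m := by
    have := Nat.le_of_ceil_le hm
    rwa [div_le_iff₀' (by positivity)] at this
  have hm0 : (0 : ℝ) < m := by exact_mod_cast hm1
  let I := (j : Fin m) → Fin (r j + 1)
  let S := Finset.univ.filter fun i : I => ∑ j, ((i j : ℕ) : ℝ) / r j < (1 / 2 - ε) * m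
  let φ : I → (Fin m →₀ ℕ) := fun f => Finsupp.equivFunOnFinite.symm fun j => (f j : ℕ)
  have hφ : ∀ f j, φ f j = (f j : ℕ) := fun f j => rfl
  have hφinj : Function.Injective φ := by
    intro f g h
    ext j
    rw [← hφ, ← hφ, h]
  set N := ∑ j, r j with hN
  have hφN : ∀ f, ∑ j, φ f j ≤ N := fun f =>
    Finset.sum_le_sum fun j _ => Nat.lt_succ_iff.mp (f j).2
  have hcardI : (Fintype.card I : ℝ) ≤ 2 ^ N := by
    rw [Fintype.card_pi, hN, ← Finset.prod_pow_eq_pow_sum]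
    simp only [Fintype.card_fin]
    push_cast
    refine Finset.prod_le_prod (fun j _ => by positivity) fun j _ => ?_
    exact_mod_cast Nat.lt_two_pow_self
  let Mx : Matrix (S × Fin (d + 1)) I ℤ := fun i f =>
    (mchoose (φ f) (φ i.1) : ℤ) * (a ^ (N - ∑ j, φ f j) * (A ^ ∑ j, φ f j) 0 i.2)
  have hzero : (fun _ => 0 : I) ∈ S := by
    simp only [S, Finset.mem_filter, Finset.mem_univ, true_and]
    simp only [Fin.val_zero, Nat.cast_zero, zero_div, Finset.sum_const_zero]
    have : 0 < 1 / 2 - ε := by linarith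
    positivity
  have : Nonempty (S × Fin (d + 1)) := ⟨⟨⟨_, hzero⟩, 0⟩⟩
  obtain ⟨t, ht0, htM, ht⟩ := exists_int_vec_mulVec_eq_zero Mx
    (by
      rw [Fintype.card_prod, Fintype.card_coe, Fintype.card_fin]
      exact card_relWeight_lt_le hm1 r hr hε hm2) (M := (2 * (a * B)) ^ N)
    (one_le_pow₀ (by linarith)) (by
      intro i f
      simp only [Mx]
      push_cast
      rw [abs_mul, abs_mul, mul_pow, Nat.abs_cast, abs_pow,
        abs_of_pos (by linarith : (0 : ℝ) < a)]
      refine mul_le_mul ?_ ?_ (by positivity) (by positivity)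
      · calc (mchoose (φ f) (φ i.1) : ℝ) ≤ ((2 ^ ∑ j, φ f j : ℕ) : ℝ) := by
              exact_mod_cast mchoose_le _ _
          _ ≤ 2 ^ N := by
              push_cast
              exact pow_le_pow_right₀ (by norm_num) (hφN f)
      · rw [mul_pow]
        exact mul_le_mul (pow_le_pow_right₀ ha1 (Nat.sub_le _ _))
          ((hB _ _ _).trans (pow_le_pow_right₀ hB1 (hφN f))) (abs_nonneg _) (by positivity))
  set P : MvPolynomial (Fin m) ℤ := ∑ f : I, MvPolynomial.monomial (φ f) (t f) with hP
  have hcoeff : ∀ f, P.coeff (φ f) = t f := by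
    intro f
    rw [hP, MvPolynomial.coeff_sum]
    simp_rw [MvPolynomial.coeff_monomial]
    rw [Finset.sum_eq_single f (fun g _ hg => if_neg fun h => hg (hφinj h)) (by simp), if_pos rfl]
  refine ⟨P, ?_, ?_, ?_, ?_⟩
  · obtain ⟨f, hf⟩ := Function.ne_iff.mp ht0
    intro h0
    apply hf
    rw [← hcoeff, h0]
    simp
  · intro e he j
    rw [hP, MvPolynomial.coeff_sum] at he
    obtain ⟨f, -, hf⟩ := Finset.exists_ne_zero_of_sum_ne_zero he
    rw [MvPolynomial.coeff_monomial] at hf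
    have : φ f = e := by
      by_contra h
      exact hf (if_neg h)
    rw [← this, hφ]
    exact Nat.lt_succ_iff.mp (f j).2
  · refine (length_sum_le _ _).trans ?_
    simp_rw [length_monomial]
    calc _ ≤ ∑ f : I, (Fintype.card I : ℝ) * (2 * (a * B)) ^ N :=
          Finset.sum_le_sum fun f _ => ht f
      _ = (Fintype.card I : ℝ) * ((Fintype.card I : ℝ) * (2 * (a * B)) ^ N) := by
          rw [Finset.sum_const, Finset.card_univ, nsmul_eq_mul]
      _ ≤ 2 ^ N * (2 ^ N * (2 * (a * B)) ^ N) := by gcongr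
      _ = (8 * (a * B)) ^ N := by
          rw [← mul_pow, ← mul_pow]
          ring_nf
  · intro i hi
    have haN : (a : K) ^ N ≠ 0 := pow_ne_zero _ (by exact_mod_cast ha.ne')
    have hsum : MvPolynomial.aeval (fun _ => α) (theta i P) =
        ∑ f : I, ((mchoose (φ f) i : K) * (t f : K)) * α ^ ∑ j, φ f j := by
      rw [hP, map_sum, map_sum]
      refine Finset.sum_congr rfl fun f _ => ?_
      rw [theta_monomial, MvPolynomial.aeval_monomial, Finsupp.prod_fintype _ _ (by simp),
        Finset.prod_pow_eq_pow_sum]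
      simp
    rw [hsum]
    by_cases hir : ∀ j, i j ≤ r j
    · let i' : I := fun j => ⟨i j, Nat.lt_succ_of_le (hir j)⟩
      have hi' : φ i' = i := Finsupp.ext fun j => rfl
      have hi'S : i' ∈ S := Finset.mem_filter.mpr ⟨Finset.mem_univ _, hi⟩
      refine (mul_eq_zero.mp ?_).resolve_left haN
      have hpow : ∀ n, n ≤ N → (a : K) ^ N * α ^ n =
          ∑ l, (((a : K) ^ (N - n)) * (((A ^ n) 0 l : ℤ) : K)) * α ^ (l : ℕ) := by
        intro n hn
        have h1 := congrFun (matrix_pow_mulVec hA n) 0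
        have h2 : (A.map (Int.cast : ℤ → K)) ^ n = (A ^ n).map (Int.cast : ℤ → K) :=
          (map_pow (Int.castRingHom K).mapMatrix A n).symm
        rw [h2] at h1
        simp only [Matrix.mulVec, dotProduct, Matrix.map_apply, Pi.smul_apply, smul_eq_mul, hv,
          Fin.val_zero, pow_zero, mul_one] at h1
        simp_rw [mul_assoc, ← Finset.mul_sum]
        rw [h1, mul_pow, ← mul_assoc, ← pow_add, Nat.sub_add_cancel hn]
      calc (a : K) ^ N * ∑ f : I, ((mchoose (φ f) i : K) * (t f : K)) * α ^ ∑ j, φ f j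
          = ∑ f : I, ∑ l : Fin (d + 1), α ^ (l : ℕ) * ((Mx (⟨i', hi'S⟩, l) f * t f : ℤ) : K) := by
            rw [Finset.mul_sum]
            refine Finset.sum_congr rfl fun f _ => ?_
            rw [mul_left_comm, hpow _ (hφN f), Finset.mul_sum]
            refine Finset.sum_congr rfl fun l _ => ?_
            simp only [Mx, hi']
            push_cast
            ring
        _ = ∑ l : Fin (d + 1), α ^ (l : ℕ) * (((Mx *ᵥ t) (⟨i', hi'S⟩, l) : ℤ) : K) := by
            rw [Finset.sum_comm]
            refine Finset.sum_congr rfl fun l _ => ?_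
            rw [← Finset.mul_sum]
            simp [Matrix.mulVec, dotProduct]
        _ = 0 := by simp [htM]
    · push Not at hir
      obtain ⟨j, hj⟩ := hir
      refine Finset.sum_eq_zero fun f _ => ?_
      have : mchoose (φ f) i = 0 := by
        refine Finset.prod_eq_zero (Finset.mem_univ j) (Nat.choose_eq_zero_of_lt ?_)
        rw [hφ]
        exact lt_of_lt_of_le (f j).2 hj
      simp [this]

end Siegel

/-! ## Integral elements of a quadratic algebra -/

section QuadraticIntegers

/-- `y = x + x' Ω` with integers `x`, `x'` of absolute value at most `H`. -/
def HasCoords {K : Type*} [Field K] (Ω : K) (H : ℝ) (y : K) : Prop :=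
  ∃ x x' : ℤ, y = x + x' * Ω ∧ |(x : ℝ)| ≤ H ∧ |(x' : ℝ)| ≤ H

namespace HasCoords

variable {K : Type*} [Field K] {Ω : K} {T N : ℤ} {H H' : ℝ} {y y' : K}

theorem nonneg (h : HasCoords Ω H y) : 0 ≤ H := by
  obtain ⟨x, x', -, h1, -⟩ := h
  exact (abs_nonneg _).trans h1

theorem mono (h : HasCoords Ω H y) (hH : H ≤ H') : HasCoords Ω H' y := by
  obtain ⟨x, x', h0, h1, h2⟩ := h
  exact ⟨x, x', h0, h1.trans hH, h2.trans hH⟩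

theorem intCast (z : ℤ) : HasCoords Ω |(z : ℝ)| (z : K) :=
  ⟨z, 0, by simp, le_rfl, by simp⟩

theorem add (h : HasCoords Ω H y) (h' : HasCoords Ω H' y') : HasCoords Ω (H + H') (y + y') := by
  obtain ⟨x, x', rfl, h1, h2⟩ := h
  obtain ⟨z, z', rfl, h3, h4⟩ := h'
  refine ⟨x + z, x' + z', by push_cast; ring, ?_, ?_⟩
  · push_cast
    exact (abs_add_le _ _).trans (add_le_add h1 h3)
  · push_cast
    exact (abs_add_le _ _).trans (add_le_add h2 h4)

theorem sum {ι : Type*} (S : Finset ι) {H : ι → ℝ} {y : ι → K}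
    (h : ∀ i ∈ S, HasCoords Ω (H i) (y i)) : HasCoords Ω (∑ i ∈ S, H i) (∑ i ∈ S, y i) := by
  classical
  induction S using Finset.induction_on with
  | empty => simpa using intCast (Ω := Ω) 0
  | insert a S ha ih =>
    rw [Finset.sum_insert ha, Finset.sum_insert ha]
    exact (h a (Finset.mem_insert_self _ _)).add
      (ih fun i hi => h i (Finset.mem_insert_of_mem hi))

theorem mul (hΩ : Ω ^ 2 = T * Ω + N) (h : HasCoords Ω H y) (h' : HasCoords Ω H' y') :
    HasCoords Ω ((2 + |(T : ℝ)| + |(N : ℝ)|) * (H * H')) (y * y') := by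
  have hH := h.nonneg
  have hH' := h'.nonneg
  obtain ⟨x, x', rfl, h1, h2⟩ := h
  obtain ⟨z, z', rfl, h3, h4⟩ := h'
  have hT := abs_nonneg (T : ℝ)
  have hN := abs_nonneg (N : ℝ)
  have hHH : 0 ≤ H * H' := mul_nonneg hH hH'
  have hmul : ∀ {a b : ℝ}, |a| ≤ H → |b| ≤ H' → |a * b| ≤ H * H' := by
    intro a b ha hb
    rw [abs_mul]
    exact mul_le_mul ha hb (abs_nonneg _) hH
  refine ⟨x * z + x' * z' * N, x * z' + x' * z + x' * z' * T, ?_, ?_, ?_⟩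
  · push_cast
    linear_combination (x' : K) * z' * hΩ
  · push_cast
    calc |(x : ℝ) * z + x' * z' * N| ≤ |(x : ℝ) * z| + |(x' : ℝ) * z'| * |(N : ℝ)| :=
          (abs_add_le _ _).trans_eq (by rw [abs_mul (_ * _) (N : ℝ)])
      _ ≤ H * H' + H * H' * |(N : ℝ)| := by
          gcongr
          · exact hmul h1 h3
          · exact hmul h2 h4
      _ ≤ _ := by nlinarith [mul_nonneg hHH hT]
  · push_cast
    calc |(x : ℝ) * z' + x' * z + x' * z' * T|
        ≤ |(x : ℝ) * z'| + |(x' : ℝ) * z| + |(x' : ℝ) * z'| * |(T : ℝ)| :=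
          (abs_add_three _ _ _).trans_eq (by rw [abs_mul (_ * _) (T : ℝ)])
      _ ≤ H * H' + H * H' + H * H' * |(T : ℝ)| := by
          gcongr
          · exact hmul h1 h4
          · exact hmul h2 h3
          · exact hmul h2 h4
      _ ≤ _ := by nlinarith [mul_nonneg hHH hN]

theorem pow (hΩ : Ω ^ 2 = T * Ω + N) (h : HasCoords Ω H y) (n : ℕ) :
    HasCoords Ω (((2 + |(T : ℝ)| + |(N : ℝ)|) * H) ^ n) (y ^ n) := by
  induction n with
  | zero => simpa using intCast (Ω := Ω) 1
  | succ n ih =>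
    rw [pow_succ, pow_succ]
    exact (mul hΩ ih h).mono (le_of_eq (by ring))

theorem prod (hΩ : Ω ^ 2 = T * Ω + N) {ι : Type*} (S : Finset ι) {H : ι → ℝ} {y : ι → K}
    (h : ∀ i ∈ S, HasCoords Ω (H i) (y i)) :
    HasCoords Ω (∏ i ∈ S, ((2 + |(T : ℝ)| + |(N : ℝ)|) * H i)) (∏ i ∈ S, y i) := by
  classical
  induction S using Finset.induction_on with
  | empty => simpa using intCast (Ω := Ω) 1
  | insert a S ha ih =>
    rw [Finset.prod_insert ha, Finset.prod_insert ha]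
    exact (mul hΩ (h a (Finset.mem_insert_self _ _))
      (ih fun i hi => h i (Finset.mem_insert_of_mem hi))).mono (le_of_eq (by ring))

end HasCoords

variable {p : ℕ} [hp : Fact p.Prime] {Ω : ℚ_[p]} {T N : ℤ}

theorem norm_le_one_of_sq_eq (hΩ : Ω ^ 2 = T * Ω + N) : ‖Ω‖ ≤ 1 := by
  by_contra! h
  have h1 : ‖Ω ^ 2‖ ≤ ‖Ω‖ := by
    rw [hΩ]
    refine (IsUltrametricDist.norm_add_le_max _ _).trans (max_le ?_ ?_)
    · rw [norm_mul]
      exact mul_le_of_le_one_left (norm_nonneg _) (Padic.norm_int_le_one _)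
    · exact (Padic.norm_int_le_one _).trans h.le
  rw [norm_pow] at h1
  nlinarith

theorem HasCoords.norm_le_one (hΩ : Ω ^ 2 = T * Ω + N) {H : ℝ} {y : ℚ_[p]}
    (h : HasCoords Ω H y) : ‖y‖ ≤ 1 := by
  obtain ⟨x, x', rfl, -, -⟩ := h
  refine (IsUltrametricDist.norm_add_le_max _ _).trans (max_le (Padic.norm_int_le_one _) ?_)
  rw [norm_mul]
  exact mul_le_one₀ (Padic.norm_int_le_one _) (norm_nonneg _) (norm_le_one_of_sq_eq hΩ)

/-- Liouville's inequality in a quadratic algebra. -/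
theorem HasCoords.one_le_mul_norm (hΩ : Ω ^ 2 = T * Ω + N) {H : ℝ} (hH : 1 ≤ H) {y : ℚ_[p]}
    (h : HasCoords Ω H y) (hy : y ≠ 0) : 1 ≤ (2 + |(T : ℝ)| + |(N : ℝ)|) * H ^ 2 * ‖y‖ := by
  obtain ⟨x, x', rfl, h1, h2⟩ := h
  have hT := abs_nonneg (T : ℝ)
  have hN := abs_nonneg (N : ℝ)
  have hn := norm_nonneg ((x : ℚ_[p]) + x' * Ω)
  have hmul : ∀ {a b : ℝ}, |a| ≤ H → |b| ≤ H → |a * b| ≤ H * H := by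
    intro a b ha hb
    rw [abs_mul]
    exact mul_le_mul ha hb (abs_nonneg _) (by linarith)
  have hprod : (((x * x + x * x' * T - x' * x' * N : ℤ)) : ℚ_[p]) =
      (x + x' * Ω) * (x + x' * (T - Ω)) := by
    push_cast
    linear_combination (x' : ℚ_[p]) * x' * hΩ
  by_cases h0 : x * x + x * x' * T - x' * x' * N = 0
  · rw [h0, Int.cast_zero, eq_comm, mul_eq_zero, or_iff_right hy] at hprod
    have hy' : (x : ℚ_[p]) + x' * Ω = ((2 * x + x' * T : ℤ) : ℚ_[p]) := by
      push_cast
      linear_combination -hprod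
    rw [hy'] at hy hn ⊢
    have hz : 2 * x + x' * T ≠ 0 := by exact_mod_cast hy
    refine (one_le_abs_mul_norm_intCast hz).trans (mul_le_mul_of_nonneg_right ?_ hn)
    push_cast
    calc |2 * (x : ℝ) + x' * T| ≤ 2 * |(x : ℝ)| + |(x' : ℝ)| * |(T : ℝ)| :=
          (abs_add_le _ _).trans_eq (by rw [abs_mul, abs_mul, abs_two])
      _ ≤ 2 * H + H * |(T : ℝ)| := by gcongr
      _ = (2 + |(T : ℝ)|) * H := by ring
      _ ≤ (2 + |(T : ℝ)|) * H ^ 2 := by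
          gcongr
          exact le_self_pow₀ hH two_ne_zero
      _ ≤ _ := by nlinarith [mul_nonneg hN (sq_nonneg H)]
  · refine (one_le_abs_mul_norm_intCast (p := p) h0).trans
      (mul_le_mul ?_ ?_ (norm_nonneg _) (by positivity))
    · push_cast
      calc |(x : ℝ) * x + x * x' * T - x' * x' * N|
          ≤ |(x : ℝ) * x + x * x' * T| + |(x' : ℝ) * x' * N| := abs_sub _ _
        _ ≤ |(x : ℝ) * x| + |(x : ℝ) * x'| * |(T : ℝ)| + |(x' : ℝ) * x'| * |(N : ℝ)| := by
            rw [← abs_mul (_ * _) (T : ℝ), ← abs_mul (_ * _) (N : ℝ)]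
            gcongr
            exact abs_add_le _ _
        _ ≤ H * H + H * H * |(T : ℝ)| + H * H * |(N : ℝ)| := by
            gcongr
            · exact hmul h1 h1
            · exact hmul h1 h2
            · exact hmul h2 h2
        _ ≤ _ := by nlinarith
    · rw [hprod, norm_mul]
      refine mul_le_of_le_one_right hn ?_
      have hΩ1 := norm_le_one_of_sq_eq hΩ
      refine (IsUltrametricDist.norm_add_le_max _ _).trans (max_le (Padic.norm_int_le_one _) ?_)
      rw [norm_mul]
      refine mul_le_one₀ (Padic.norm_int_le_one _) (norm_nonneg _) ?_
      rw [sub_eq_add_neg]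
      exact (IsUltrametricDist.norm_add_le_max _ _).trans
        (max_le (Padic.norm_int_le_one _) ((norm_neg Ω).le.trans hΩ1))

end QuadraticIntegers

/-! ## Values of integral polynomials -/

theorem aeval_eq_aeval_dilate {σ R K : Type*} [Fintype σ] [CommRing R] [Field K] [Algebra R K]
    {α : σ → K} (hα : ∀ j, α j ≠ 0) (ξ : σ → K) (Q : MvPolynomial σ R) :
    MvPolynomial.aeval ξ Q =
      MvPolynomial.aeval (fun j => (ξ j - α j) / α j) (dilate α Q) := by
  have h : MvPolynomial.aeval ξ =
      ((MvPolynomial.aeval fun j => (ξ j - α j) / α j).restrictScalars R).comp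
        (dilate (R := R) α) := by
    refine MvPolynomial.algHom_ext fun j => ?_
    simp only [MvPolynomial.aeval_X, AlgHom.comp_apply, dilate, AlgHom.restrictScalars_apply,
      map_mul, map_add, map_one, MvPolynomial.aeval_C, Algebra.algebraMap_self, RingHom.id_apply]
    field_simp [hα j]
    ring
  rw [h]
  rfl

section Values

variable {p : ℕ} [hp : Fact p.Prime]

theorem norm_aeval_le {σ : Type*} [Fintype σ] {Q : MvPolynomial σ ℤ} {r : σ → ℕ}
    (hQ : ∀ e, Q.coeff e ≠ 0 → ∀ j, e j ≤ r j) (α : ℚ_[p]) :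
    ‖MvPolynomial.aeval (fun _ => α) Q‖ ≤ max 1 ‖α‖ ^ ∑ j, r j := by
  rw [MvPolynomial.aeval_def, MvPolynomial.eval₂_eq']
  refine IsUltrametricDist.norm_sum_le_of_forall_le_of_nonneg (by positivity) fun e he => ?_
  rw [norm_mul, Finset.prod_pow_eq_pow_sum, norm_pow]
  refine (mul_le_of_le_one_left (by positivity) ?_).trans ?_
  · simpa using Padic.norm_int_le_one (Q.coeff e)
  · calc ‖α‖ ^ ∑ j, e j ≤ max 1 ‖α‖ ^ ∑ j, e j := by
          gcongr
          exact le_max_right _ _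
      _ ≤ _ := pow_le_pow_right₀ (le_max_left _ _)
          (Finset.sum_le_sum fun j _ => hQ e (MvPolynomial.mem_support_iff.mp he) j)

theorem coeff_theta_ne_zero {σ R : Type*} [Fintype σ] [CommRing R] {e f : σ →₀ ℕ}
    {Q : MvPolynomial σ R} (h : (theta e Q).coeff f ≠ 0) : Q.coeff f ≠ 0 := by
  rw [coeff_theta] at h
  exact right_ne_zero_of_mul h

/-- The value of an integral polynomial is small near a point at which it vanishes to high
order. -/
theorem norm_aeval_le_of_theta {σ : Type*} [Fintype σ] {Q : MvPolynomial σ ℤ} {r : σ → ℕ}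
    (hQ : ∀ e, Q.coeff e ≠ 0 → ∀ j, e j ≤ r j) {α : ℚ_[p]} (hα : α ≠ 0) (ξ : σ → ℚ_[p]) {τ : ℝ}
    (hτ0 : 0 ≤ τ) (hτ : ∀ i, MvPolynomial.aeval (fun _ => α) (theta i Q) ≠ 0 →
      ∏ j, ‖(ξ j - α) / α‖ ^ i j ≤ τ) :
    ‖MvPolynomial.aeval ξ Q‖ ≤ max 1 ‖α‖ ^ (∑ j, r j) * τ := by
  rw [aeval_eq_aeval_dilate (fun _ => hα) ξ Q, MvPolynomial.aeval_def, MvPolynomial.eval₂_eq']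
  refine IsUltrametricDist.norm_sum_le_of_forall_le_of_nonneg (by positivity) fun i hi => ?_
  rw [MvPolynomial.mem_support_iff, coeff_dilate] at hi
  rw [coeff_dilate, norm_mul, norm_prod, Algebra.algebraMap_self, RingHom.id_apply]
  refine mul_le_mul (norm_aeval_le (fun e he => hQ e (coeff_theta_ne_zero he)) α) ?_
    (by positivity) (by positivity)
  simp_rw [norm_pow]
  exact hτ i hi

theorem hasCoords_prod_pow_mul_aeval {K σ : Type*} [Field K] [Fintype σ] {Ω : K} {T N : ℤ}
    (hΩ : Ω ^ 2 = T * Ω + N) {Q : MvPolynomial σ ℤ} {r : σ → ℕ}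
    (hQ : ∀ e, Q.coeff e ≠ 0 → ∀ j, e j ≤ r j) {ξ u w : σ → K} (hw : ∀ j, w j * ξ j = u j)
    {H : σ → ℝ} (hu' : ∀ j, HasCoords Ω (H j) (u j)) (hw' : ∀ j, HasCoords Ω (H j) (w j)) {c : ℝ}
    (hc : c = 2 + |(T : ℝ)| + |(N : ℝ)|) :
    HasCoords Ω (c * (length Q * ∏ j, (c * (c * (c * H j) ^ r j))))
      ((∏ j, w j ^ r j) * MvPolynomial.aeval ξ Q) := by
  have h1 : (∏ j, w j ^ r j) * MvPolynomial.aeval ξ Q = ∑ f ∈ Q.support,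
      ((Q.coeff f : ℤ) : K) * ∏ j, (u j ^ f j * w j ^ (r j - f j)) := by
    rw [MvPolynomial.aeval_def, MvPolynomial.eval₂_eq', Finset.mul_sum]
    refine Finset.sum_congr rfl fun f hf => ?_
    rw [mul_left_comm, ← Finset.prod_mul_distrib, eq_intCast]
    congr 1
    refine Finset.prod_congr rfl fun j _ => ?_
    have hle := hQ f (MvPolynomial.mem_support_iff.mp hf) j
    rw [← hw j, mul_pow]
    conv_lhs => rw [← Nat.sub_add_cancel hle, pow_add]
    ring
  rw [h1]
  refine (HasCoords.sum _ fun f hf => HasCoords.mul hΩ (HasCoords.intCast (Q.coeff f))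
    (HasCoords.prod hΩ Finset.univ fun j _ =>
      HasCoords.mul hΩ ((hu' j).pow hΩ (f j)) ((hw' j).pow hΩ (r j - f j)))).mono (le_of_eq ?_)
  rw [← hc, length, Finset.sum_mul, Finset.mul_sum]
  refine Finset.sum_congr rfl fun f hf => ?_
  congr 2
  refine Finset.prod_congr rfl fun j _ => ?_
  have hle := hQ f (MvPolynomial.mem_support_iff.mp hf) j
  rw [← pow_add, Nat.add_sub_cancel' hle]

end Values

/-! ## Roth's theorem over a quadratic algebra -/

theorem exists_fin_sequence {X : Type*} {S : ℝ → X → Prop} (h : ∀ B : ℝ, ∃ L, B ≤ L ∧ ∃ x, S L x)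
    (B D : ℝ) (m : ℕ) : ∃ (L : Fin m → ℝ) (x : Fin m → X), (∀ j, B ≤ L j ∧ S (L j) (x j)) ∧
      ∀ i j, i < j → D * L j ≤ L i := by
  induction m with
  | zero => exact ⟨Fin.elim0, Fin.elim0, fun j => j.elim0, fun i => i.elim0⟩
  | succ m ih =>
    obtain ⟨L, x, h1, h2⟩ := ih
    obtain ⟨L₀, hL₀, x₀, hx₀⟩ := h (|B| + ∑ j, |D * L j|)
    have hsum : 0 ≤ ∑ j, |D * L j| := Finset.sum_nonneg fun _ _ => abs_nonneg _
    refine ⟨Fin.cons L₀ L, Fin.cons x₀ x, ?_, ?_⟩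
    · refine Fin.cases ⟨?_, hx₀⟩ h1
      have := le_abs_self B
      simp only [Fin.cons_zero]
      linarith
    · refine Fin.cases (Fin.cases (fun h => absurd h (lt_irrefl _)) fun j _ => ?_) fun i =>
        Fin.cases (fun h => absurd h (Fin.not_lt_zero _)) fun j hij => ?_
      · simp only [Fin.cons_zero, Fin.cons_succ]
        have h3 := Finset.single_le_sum (f := fun j => |D * L j|) (fun _ _ => abs_nonneg _)
          (Finset.mem_univ j)
        have h4 := le_abs_self (D * L j)
        have h5 := abs_nonneg B
        linarith
      · simp only [Fin.cons_succ]
        exact h2 i j (Fin.succ_lt_succ_iff.mp hij)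

section Roth

variable {p : ℕ} [hp : Fact p.Prime]

theorem norm_eq_of_norm_sub_lt {ξ α : ℚ_[p]} (h : ‖ξ - α‖ < ‖α‖) : ‖ξ‖ = ‖α‖ := by
  have := IsUltrametricDist.norm_add_eq_max_of_norm_ne_norm h.ne
  rw [sub_add_cancel, max_eq_right h.le] at this
  exact this

/-- `ξ` is an approximation to `α` by a quotient of elements of `ℤ + ℤΩ` of height `exp (2 L)`. -/
def IsApproximation (Ω α : ℚ_[p]) (η K L : ℝ) (ξ : ℚ_[p]) : Prop :=
  ξ ≠ α ∧ ‖ξ - α‖ ≤ Real.exp (-((8 + η) * L)) ∧ ∃ u w : ℚ_[p], w ≠ 0 ∧ w * ξ = u ∧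
    HasCoords Ω (K * Real.exp (2 * L)) u ∧ HasCoords Ω (K * Real.exp (2 * L)) w

theorem prod_norm_pow_le_exp {m : ℕ} {r : Fin m → ℕ} (hr : ∀ j, 1 ≤ r j) {x : Fin m → ℚ_[p]}
    {L : Fin m → ℝ} {η ε R : ℝ} (hη : 0 < η) (hη1 : η ≤ 1) (hε : ε = η / 200) (hR : 0 ≤ R)
    (hrL : ∀ j, (1 - ε) * R ≤ r j * L j) (hx : ∀ j, ‖x j‖ ≤ Real.exp (-((8 + η / 2) * L j)))
    {i : Fin m →₀ ℕ} (hi : (1 / 2 - 2 * ε) * m ≤ relWeight r i) :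
    ∏ j, ‖x j‖ ^ i j ≤ Real.exp (-((4 + η / 8) * (m * R))) := by
  have hm : (0 : ℝ) ≤ m := Nat.cast_nonneg m
  calc ∏ j, ‖x j‖ ^ i j ≤ ∏ j, Real.exp (-((8 + η / 2) * L j)) ^ i j :=
        Finset.prod_le_prod (fun j _ => by positivity)
          fun j _ => pow_le_pow_left₀ (norm_nonneg _) (hx j) _
    _ = Real.exp (-((8 + η / 2) * ∑ j, i j * L j)) := by
        simp_rw [← Real.exp_nat_mul]
        rw [← Real.exp_sum, Finset.mul_sum, ← Finset.sum_neg_distrib]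
        congr 1
        refine Finset.sum_congr rfl fun j _ => by ring
    _ ≤ _ := by
        refine Real.exp_le_exp.mpr (neg_le_neg ?_)
        have h1 : (1 - ε) * R * relWeight r i ≤ ∑ j, i j * L j := by
          rw [relWeight_apply, Finset.mul_sum]
          refine Finset.sum_le_sum fun j _ => ?_
          have hrj : (0 : ℝ) < r j := by exact_mod_cast hr j
          calc (1 - ε) * R * ((i j : ℝ) / r j) ≤ r j * L j * ((i j : ℝ) / r j) :=
                mul_le_mul_of_nonneg_right (hrL j) (by positivity)
            _ = _ := by field_simp
        have h2 : (1 - ε) * R * ((1 / 2 - 2 * ε) * m) ≤ (1 - ε) * R * relWeight r i := by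
          have : 0 ≤ 1 - ε := by linarith
          gcongr
        have h3 : 4 + η / 8 ≤ (8 + η / 2) * ((1 - ε) * (1 / 2 - 2 * ε)) := by
          have h4 : 1 / 2 - 5 * ε / 2 ≤ (1 - ε) * (1 / 2 - 2 * ε) := by nlinarith [sq_nonneg ε]
          have h5 := mul_le_mul_of_nonneg_left h4 (by positivity : (0 : ℝ) ≤ 8 + η / 2)
          subst hε
          nlinarith
        calc (4 + η / 8) * (m * R) ≤ (8 + η / 2) * ((1 - ε) * (1 / 2 - 2 * ε)) * (m * R) := by
              gcongr
          _ = (8 + η / 2) * ((1 - ε) * R * ((1 / 2 - 2 * ε) * m)) := by ring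
          _ ≤ _ := by
              have := h2.trans h1
              gcongr

theorem prod_height_le {m : ℕ} {r : Fin m → ℕ} {L : Fin m → ℝ} {c K R : ℝ} (hc : 0 ≤ c)
    (hK : 0 ≤ K) (hrU : ∀ j, r j * L j ≤ R) :
    ∏ j, (c * (c * (c * (K * Real.exp (2 * L j))) ^ r j)) ≤
      (c ^ 2) ^ m * (c * K) ^ (∑ j, r j) * Real.exp (2 * (m * R)) := by
  calc ∏ j, (c * (c * (c * (K * Real.exp (2 * L j))) ^ r j))
      = ∏ j, (c ^ 2 * (c * K) ^ r j * Real.exp (2 * (r j * L j))) := by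
        refine Finset.prod_congr rfl fun j _ => ?_
        rw [← mul_assoc c K, mul_pow (c * K), ← Real.exp_nat_mul, mul_left_comm (r j : ℝ)]
        ring
    _ ≤ ∏ j, (c ^ 2 * (c * K) ^ r j * Real.exp (2 * R)) := by
        refine Finset.prod_le_prod (fun j _ => by positivity) fun j _ => ?_
        have := Real.exp_le_exp.mpr (mul_le_mul_of_nonneg_left (hrU j) (zero_le_two (α := ℝ)))
        exact mul_le_mul_of_nonneg_left this (by positivity)
    _ = _ := by
        rw [Finset.prod_mul_distrib, Finset.prod_mul_distrib,
          Finset.prod_pow_eq_pow_sum _ r (c * K)]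
        simp only [Finset.prod_const, Finset.card_univ, Fintype.card_fin]
        rw [← Real.exp_nat_mul, mul_left_comm]

theorem height_mul_exp_lt_one {c c₁ ρ η R : ℝ} {m N : ℕ} (hm : 1 ≤ m) (hc : 2 ≤ c) (hc₁ : 1 ≤ c₁)
    (hρ : 1 ≤ ρ) (hη : 0 < η) (hR : 16 * (4 * m + 3) * Real.log c / η < R)
    (hN : N * (16 * (2 * Real.log c₁ + Real.log ρ)) ≤ m * R * η) :
    c * (c ^ (2 * m + 1) * c₁ ^ N * Real.exp (2 * (m * R))) ^ 2 *
      (ρ ^ N * Real.exp (-((4 + η / 8) * (m * R)))) < 1 := by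
  have hlogc : 0 ≤ Real.log c := Real.log_nonneg (by linarith)
  have hR0 : 0 < R := lt_of_le_of_lt (by positivity) hR
  have hm1 : (1 : ℝ) ≤ m := by exact_mod_cast hm
  rw [div_lt_iff₀ hη] at hR
  have h4 : R * η ≤ m * R * η := by
    have : 0 < R * η := by positivity
    nlinarith
  have hc0 : 0 < c := by linarith
  have hc₁0 : 0 < c₁ := by linarith
  have hρ0 : 0 < ρ := by linarith
  rw [← Real.log_neg_iff (by positivity), Real.log_mul (by positivity) (by positivity),
    Real.log_mul hc0.ne' (by positivity), Real.log_mul (by positivity) (by positivity),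
    Real.log_pow, Real.log_pow, Real.log_exp, Real.log_mul (by positivity) (by positivity),
    Real.log_mul (by positivity) (by positivity), Real.log_pow, Real.log_pow, Real.log_exp]
  push_cast
  nlinarith

set_option maxHeartbeats 1000000 in
/-- **Roth's theorem**: a `p`-adic number with very good approximations in a fixed quadratic
algebra is transcendental. -/
theorem transcendental_of_isApproximation {α Ω : ℚ_[p]} (hα0 : α ≠ 0) {T N₀ : ℤ}
    (hΩ : Ω ^ 2 = T * Ω + N₀) {η K : ℝ} (hη : 0 < η) (hη1 : η ≤ 1) (hK : 1 ≤ K)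
    (happrox : ∀ B : ℝ, ∃ L, B ≤ L ∧ ∃ ξ, IsApproximation Ω α η K L ξ) : Transcendental ℚ α := by
  intro hα
  obtain ⟨Cl, hCl, hlow⟩ := exists_lowOrder hα
  obtain ⟨ε, hε⟩ : ∃ ε, ε = η / 200 := ⟨_, rfl⟩
  have hε0 : 0 < ε := by rw [hε]; positivity
  have hε1 : ε < 1 / 2 := by rw [hε]; linarith
  obtain ⟨m₀, Cs, hCs, haux⟩ := exists_auxiliary_polynomial hα hε0 hε1
  obtain ⟨m, hm0, hm1⟩ : ∃ m, m₀ ≤ m ∧ 1 ≤ m := ⟨max m₀ 1, le_max_left _ _, le_max_right _ _⟩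
  obtain ⟨δ, hδ, hroth⟩ := exists_relWeight_le_aeval_theta_ne_zero (L := ℚ_[p]) hCl m ε hε0
  obtain ⟨c, hc⟩ : ∃ c, c = 2 + |(T : ℝ)| + |(N₀ : ℝ)| := ⟨_, rfl⟩
  have hc2 : 2 ≤ c := by
    rw [hc]
    linarith [abs_nonneg (T : ℝ), abs_nonneg (N₀ : ℝ)]
  have hρ1 : 1 ≤ max 1 ‖α‖ := le_max_left _ _
  have hcK : 1 ≤ c * K := by nlinarith
  obtain ⟨c₁, hc₁⟩ : ∃ c₁, c₁ = 2 * Cs * (c * K) := ⟨_, rfl⟩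
  have hc₁1 : 1 ≤ c₁ := by rw [hc₁]; nlinarith
  obtain ⟨c₂, hc₂⟩ : ∃ c₂, c₂ = 2 * Real.log c₁ + Real.log (max 1 ‖α‖) := ⟨_, rfl⟩
  have hlogc₁ := Real.log_nonneg hc₁1
  have hlogρ := Real.log_nonneg hρ1
  have hlogCs := Real.log_nonneg hCs
  have hlogc : 0 ≤ Real.log c := Real.log_nonneg (by linarith)
  have hc₂0 : 0 ≤ c₂ := by rw [hc₂]; positivity
  have hmpos : (1 : ℝ) ≤ m := by exact_mod_cast hm1
  have habs := abs_nonneg (Real.log ‖α‖)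
  have hαpos := norm_pos_iff.mpr hα0
  obtain ⟨B, hB⟩ : ∃ B, B = 1 + 16 * c₂ / η + 2 * m * (1 + Real.log Cs) / δ +
    2 * |Real.log ‖α‖| / η := ⟨_, rfl⟩
  have ht1 : 0 ≤ 16 * c₂ / η := by positivity
  have ht2 : 0 ≤ 2 * m * (1 + Real.log Cs) / δ := by positivity
  have ht3 : 0 ≤ 2 * |Real.log ‖α‖| / η := by positivity
  obtain ⟨L, ξ, hLξ, hLL⟩ := exists_fin_sequence happrox B (2 / δ) m
  have hLB : ∀ j, B ≤ L j := fun j => (hLξ j).1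
  have hL0 : ∀ j, 0 < L j := fun j => lt_of_lt_of_le (by rw [hB]; linarith) (hLB j)
  have hne : ∀ j, ξ j ≠ α := fun j => (hLξ j).2.1
  have hclose : ∀ j, ‖ξ j - α‖ ≤ Real.exp (-((8 + η) * L j)) := fun j => (hLξ j).2.2.1
  choose u w hw0 hwu hu hw using fun j => (hLξ j).2.2.2
  obtain ⟨R, hR⟩ : ∃ R, R = ∑ j, L j / ε + 16 * (4 * m + 3) * Real.log c / η + 1 := ⟨_, rfl⟩
  have hsumL : 0 ≤ ∑ j, L j / ε := Finset.sum_nonneg fun j _ => (div_pos (hL0 j) hε0).le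
  have ht4 : 0 ≤ 16 * (4 * m + 3) * Real.log c / η := by positivity
  have hR0 : 0 < R := by rw [hR]; linarith
  have hRL : ∀ j, L j ≤ ε * R := by
    intro j
    have h1 := Finset.single_le_sum (f := fun j => L j / ε) (fun j _ => (div_pos (hL0 j) hε0).le)
      (Finset.mem_univ j)
    have h2 : L j / ε ≤ R := by rw [hR]; linarith
    rwa [div_le_iff₀' hε0] at h2
  let r : Fin m → ℕ := fun j => ⌊R / L j⌋₊
  have hrU : ∀ j, r j * L j ≤ R := by
    intro j
    rw [← le_div_iff₀ (hL0 j)]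
    exact Nat.floor_le (div_pos hR0 (hL0 j)).le
  have hrL : ∀ j, (1 - ε) * R ≤ r j * L j := by
    intro j
    have h1 := (Nat.lt_floor_add_one (R / L j)).le
    rw [div_le_iff₀ (hL0 j)] at h1
    have h2 := hRL j
    have h3 : R ≤ r j * L j + L j := by
      simp only [r]
      linarith
    linarith
  have hrhalf : ∀ j, R ≤ 2 * (r j * L j) := fun j => by nlinarith [hrL j]
  have hr1 : ∀ j, 1 ≤ r j := by
    intro j
    rw [Nat.one_le_iff_ne_zero]
    intro h0
    have := hrhalf j
    rw [h0] at this
    simp at this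
    linarith
  obtain ⟨N, hN⟩ : ∃ N, N = ∑ j, r j := ⟨_, rfl⟩
  have hNB : (N : ℝ) * B ≤ m * R := by
    rw [hN]
    push_cast
    rw [Finset.sum_mul]
    calc ∑ j, (r j : ℝ) * B ≤ ∑ j : Fin m, R := Finset.sum_le_sum fun j _ =>
          (mul_le_mul_of_nonneg_left (hLB j) (Nat.cast_nonneg _)).trans (hrU j)
      _ = m * R := by simp
  have hN0 : (0 : ℝ) ≤ N := Nat.cast_nonneg N
  obtain ⟨P, hP0, hPdeg, hPlen, hPvan⟩ := haux m hm0 hm1 r hr1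
  rw [← hN] at hPlen
  have hloglen : Real.log (length P) ≤ N * Real.log Cs := by
    rw [← Real.log_pow]
    exact Real.log_le_log (lt_of_lt_of_le one_pos (one_le_length hP0)) hPlen
  have hαL : ∀ j, |Real.log ‖α‖| ≤ η / 2 * L j := by
    intro j
    have h1 : 2 * |Real.log ‖α‖| / η ≤ L j := by linarith [hLB j]
    rw [div_le_iff₀ hη] at h1
    linarith
  have hclose' : ∀ j, ‖(ξ j - α) / α‖ ≤ Real.exp (-((8 + η / 2) * L j)) := by
    intro j
    rw [norm_div, div_le_iff₀ hαpos]
    refine (hclose j).trans ?_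
    rw [← Real.exp_log hαpos, ← Real.exp_add]
    refine Real.exp_le_exp.mpr ?_
    have h1 := hαL j
    have h2 := neg_abs_le (Real.log ‖α‖)
    linarith
  have hnorm : ∀ j, ‖ξ j‖ = ‖α‖ := by
    intro j
    refine norm_eq_of_norm_sub_lt ?_
    have h1 : ‖(ξ j - α) / α‖ < 1 := (hclose' j).trans_lt (by
      rw [Real.exp_lt_one_iff]
      have := hL0 j
      have : 0 < (8 + η / 2) * L j := by positivity
      linarith)
    rwa [norm_div, div_lt_one hαpos] at h1
  obtain ⟨e, he, hQ0⟩ := hroth ξ L r hL0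
    (fun j => hlow (ξ j) (L j) (hne j) (by
      rw [← norm_pos_iff, hnorm]
      exact hαpos) (hnorm j) ((hclose j).trans (Real.exp_le_exp.mpr (by
        have := hL0 j
        nlinarith))))
    hr1 (by
      intro i j hij
      have h1 := hLL i j hij
      rw [div_mul_eq_mul_div, div_le_iff₀ hδ] at h1
      have h2 : (r i : ℝ) * L i ≤ δ * r j * L i := by
        calc (r i : ℝ) * L i ≤ R := hrU i
          _ ≤ r j * (2 * L j) := by linarith [hrhalf j]
          _ ≤ r j * (L i * δ) := by gcongr
          _ = _ := by ring
      exact le_of_mul_le_mul_right h2 (hL0 i))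
    P hP0 hPdeg (by
      intro j
      have h1 : 2 * m * (1 + Real.log Cs) / δ ≤ B := by linarith
      rw [div_le_iff₀ hδ] at h1
      have h2 : (m : ℝ) * (2 * (N * (1 + Real.log Cs))) ≤ m * (δ * R) := by
        calc (m : ℝ) * (2 * (N * (1 + Real.log Cs))) = N * (2 * m * (1 + Real.log Cs)) := by ring
          _ ≤ N * (B * δ) := by gcongr
          _ = N * B * δ := by ring
          _ ≤ m * R * δ := by gcongr
          _ = _ := by ring
      have h3 := le_of_mul_le_mul_left h2 (by linarith)
      have h4 : δ * R ≤ δ * (2 * (r j * L j)) := by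
        have := hrhalf j
        gcongr
      have h5 : ∑ i, (r i : ℝ) = N := by rw [hN]; push_cast; rfl
      rw [h5]
      linarith)
  set Q := theta e P with hQ
  have hQdeg : ∀ f, Q.coeff f ≠ 0 → ∀ j, f j ≤ r j := fun f hf =>
    hPdeg f (coeff_theta_ne_zero hf)
  have hQlen : length Q ≤ (2 * Cs) ^ N := by
    rw [mul_pow]
    refine (length_theta_le e P fun f hf => ?_).trans (by gcongr)
    rw [hN]
    exact Finset.sum_le_sum fun j _ => hPdeg f hf j
  have hupper : ‖MvPolynomial.aeval ξ Q‖ ≤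
      max 1 ‖α‖ ^ N * Real.exp (-((4 + η / 8) * (m * R))) := by
    rw [hN]
    refine norm_aeval_le_of_theta hQdeg hα0 ξ (Real.exp_pos _).le fun i hi => ?_
    refine prod_norm_pow_le_exp hr1 hη hη1 hε hR0.le hrL hclose' ?_
    by_contra! hlt
    refine hi (aeval_theta_theta_eq_zero _ P i e fun l hl => hPvan l ?_)
    have h1 := relWeight_mono r hl
    rw [map_add] at h1
    nlinarith
  set y := (∏ j, w j ^ r j) * MvPolynomial.aeval ξ Q with hy
  have hy0 : y ≠ 0 :=
    mul_ne_zero (Finset.prod_ne_zero_iff.mpr fun j _ => pow_ne_zero _ (hw0 j)) hQ0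
  obtain ⟨H, hH⟩ : ∃ H, H = c ^ (2 * m + 1) * c₁ ^ N * Real.exp (2 * (m * R)) := ⟨_, rfl⟩
  have hH1 : 1 ≤ H := by
    rw [hH]
    have h1 : 1 ≤ c ^ (2 * m + 1) := one_le_pow₀ (by linarith)
    have h2 : 1 ≤ c₁ ^ N := one_le_pow₀ hc₁1
    have h3 : 1 ≤ Real.exp (2 * (m * R)) := Real.one_le_exp (by positivity)
    nlinarith [mul_le_mul h1 h2 zero_le_one (by positivity)]
  have hyH : HasCoords Ω H y := by
    refine (hasCoords_prod_pow_mul_aeval hΩ hQdeg hwu hu hw hc).mono ?_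
    have h1 := prod_height_le (c := c) (K := K) (by linarith) (by linarith) hrU
    rw [← hN] at h1
    calc _ ≤ c * ((2 * Cs) ^ N * ((c ^ 2) ^ m * (c * K) ^ N * Real.exp (2 * (m * R)))) := by
          gcongr
      _ = H := by
          rw [hH, hc₁, mul_pow (2 * Cs), ← pow_mul]
          ring
  have hyle : ‖y‖ ≤ ‖MvPolynomial.aeval ξ Q‖ := by
    rw [hy, norm_mul, norm_prod]
    refine mul_le_of_le_one_left (norm_nonneg _)
      (Finset.prod_le_one (fun j _ => norm_nonneg _) fun j _ => ?_)
    rw [norm_pow]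
    exact pow_le_one₀ (norm_nonneg _) ((hw j).norm_le_one hΩ)
  have hfin : 1 ≤ c * H ^ 2 * (max 1 ‖α‖ ^ N * Real.exp (-((4 + η / 8) * (m * R)))) := by
    refine (hyH.one_le_mul_norm hΩ hH1 hy0).trans ?_
    rw [← hc]
    have := hyle.trans hupper
    gcongr
  rw [hH] at hfin
  refine absurd hfin (not_le.mpr (height_mul_exp_lt_one hm1 hc2 hc₁1 hρ1 hη ?_ ?_))
  · rw [hR]
    linarith
  · have h1 : 16 * c₂ / η ≤ B := by linarith
    rw [div_le_iff₀ hη] at h1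
    rw [← hc₂]
    calc N * (16 * c₂) ≤ N * (B * η) := by gcongr
      _ = N * B * η := by ring
      _ ≤ _ := by gcongr

end Roth

/-! ## Digits of Ruban continued fractions -/

section Digits

variable {p : ℕ}

/-- `x` lies in `ℤ[1/p]`. -/
def HasPowDen (p : ℕ) (x : ℚ) : Prop :=
  ∃ k : ℕ, ∃ z : ℤ, (z : ℚ) = x * (p : ℚ) ^ k

theorem HasPowDen.intCast (z : ℤ) : HasPowDen p z := ⟨0, z, by simp⟩

theorem HasPowDen.add {x y : ℚ} (hx : HasPowDen p x) (hy : HasPowDen p y) :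
    HasPowDen p (x + y) := by
  obtain ⟨k, z, hz⟩ := hx
  obtain ⟨l, w, hw⟩ := hy
  refine ⟨k + l, z * p ^ l + w * p ^ k, ?_⟩
  push_cast
  rw [hz, hw]
  ring

theorem HasPowDen.mul {x y : ℚ} (hx : HasPowDen p x) (hy : HasPowDen p y) :
    HasPowDen p (x * y) := by
  obtain ⟨k, z, hz⟩ := hx
  obtain ⟨l, w, hw⟩ := hy
  refine ⟨k + l, z * w, ?_⟩
  push_cast
  rw [hz, hw]
  ring

variable [hp : Fact p.Prime]

theorem natCast_prime_pos : (0 : ℚ) < p := by exact_mod_cast hp.out.pos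

theorem padicNorm_pow_self (k : ℕ) : padicNorm p ((p : ℚ) ^ k) = ((p : ℚ) ^ k)⁻¹ := by
  induction k with
  | zero => simp
  | succ k ih => rw [pow_succ, padicNorm.mul, ih, padicNorm.padicNorm_p_of_prime, mul_inv]

theorem HasPowDen.exists_int {x : ℚ} (hx : HasPowDen p x) {s : ℕ}
    (hs : padicNorm p x ≤ (p : ℚ) ^ s) : ∃ w : ℤ, (w : ℚ) = x * (p : ℚ) ^ s := by
  obtain ⟨k, z, hz⟩ := hx
  have hp0 := natCast_prime_pos (p := p)
  rcases le_total k s with h | h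
  · refine ⟨z * p ^ (s - k), ?_⟩
    push_cast
    rw [hz, mul_assoc, ← pow_add, Nat.add_sub_cancel' h]
  · obtain ⟨l, rfl⟩ := Nat.exists_eq_add_of_le h
    have h1 : padicNorm p z ≤ (p : ℚ) ^ (-(l : ℤ)) := by
      rw [hz, padicNorm.mul, padicNorm_pow_self]
      calc _ ≤ (p : ℚ) ^ s * ((p : ℚ) ^ (s + l))⁻¹ := by gcongr
        _ = _ := by
          rw [zpow_neg, zpow_natCast, pow_add]
          field_simp
    obtain ⟨w, hw⟩ := padicNorm.dvd_iff_norm_le.mpr h1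
    refine ⟨w, ?_⟩
    rw [hw] at hz
    push_cast at hz
    have h2 : (p : ℚ) ^ l ≠ 0 := by positivity
    apply mul_left_cancel₀ h2
    rw [hz, pow_add]
    ring

theorem eq_of_padicNorm_sub_lt_one {a b : ℚ} (ha : a ∈ Sp p) (hb : b ∈ Sp p)
    (h : padicNorm p (a - b) < 1) : a = b := by
  have hden : HasPowDen p (a - b) := by
    have := HasPowDen.add (p := p) ha.1 ((HasPowDen.intCast (-1)).mul hb.1)
    convert this using 1
    push_cast
    ring
  obtain ⟨w, hw⟩ := hden.exists_int (s := 0) (by simpa using h.le)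
  rw [pow_zero, mul_one] at hw
  rw [← hw, padicNorm.int_lt_one_iff] at h
  have h1 : |w| < p := by
    have : |(w : ℚ)| < p := by
      rw [hw, abs_lt]
      constructor <;> linarith [ha.2.1, ha.2.2, hb.2.1, hb.2.2]
    exact_mod_cast this
  rw [Int.eq_zero_of_abs_lt_dvd h h1] at hw
  push_cast at hw
  linarith

theorem exists_padicNorm_eq {b : ℚ} (hb : b ∈ Sp' p) :
    ∃ m : ℕ, 1 ≤ m ∧ padicNorm p b = (p : ℚ) ^ m := by
  have hp1 : (1 : ℚ) < p := by exact_mod_cast hp.out.one_lt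
  have hb0 : b ≠ 0 := by
    rintro rfl
    have := hb.2
    rw [padicNorm.zero] at this
    linarith
  obtain ⟨z, hz⟩ := padicNorm.values_discrete (p := p) hb0
  have h1 := hb.2
  rw [hz, ← zpow_one (p : ℚ), ← zpow_mul, one_mul, zpow_le_zpow_iff_right₀ hp1] at h1
  obtain ⟨m, hm⟩ := Int.eq_ofNat_of_zero_le (by lia : 0 ≤ -z)
  refine ⟨m, by lia, ?_⟩
  rw [hz, hm, zpow_natCast]

theorem le_sub_inv_padicNorm {b : ℚ} (hb : b ∈ Sp' p) : b ≤ p - (padicNorm p b)⁻¹ := by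
  obtain ⟨m, -, hm⟩ := exists_padicNorm_eq hb
  obtain ⟨w, hw⟩ := HasPowDen.exists_int (p := p) hb.1.1 hm.le
  have hp0 := natCast_prime_pos (p := p)
  have hpm : (0 : ℚ) < (p : ℚ) ^ m := by positivity
  have h1 : (w : ℚ) < ((p * p ^ m : ℕ) : ℤ) := by
    rw [hw]
    push_cast
    exact mul_lt_mul_of_pos_right hb.1.2.2 hpm
  have h2 : w + 1 ≤ ((p * p ^ m : ℕ) : ℤ) := by exact_mod_cast h1
  have h3 : (w : ℚ) + 1 ≤ p * (p : ℚ) ^ m := by exact_mod_cast h2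
  rw [hm, le_sub_iff_add_le]
  rw [hw] at h3
  refine le_of_mul_le_mul_right ?_ hpm
  rwa [add_mul, inv_mul_cancel₀ hpm.ne']

theorem finite_digits (s : ℕ) : {b | b ∈ Sp p ∧ padicNorm p b ≤ (p : ℚ) ^ s}.Finite := by
  refine ((Set.finite_Icc (0 : ℤ) ((p * p ^ s : ℕ) : ℤ)).image
    fun z : ℤ => (z : ℚ) / (p : ℚ) ^ s).subset ?_
  rintro b ⟨hb, hs⟩
  obtain ⟨w, hw⟩ := HasPowDen.exists_int (p := p) hb.1 hs
  have hp0 := natCast_prime_pos (p := p)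
  have hpm : (0 : ℚ) < (p : ℚ) ^ s := by positivity
  refine ⟨w, ⟨?_, ?_⟩, ?_⟩
  · have : (0 : ℚ) ≤ w := by
      rw [hw]
      exact mul_nonneg hb.2.1 hpm.le
    exact_mod_cast this
  · have : (w : ℚ) ≤ ((p * p ^ s : ℕ) : ℤ) := by
      rw [hw]
      push_cast
      exact mul_le_mul_of_nonneg_right hb.2.2.le hpm.le
    exact_mod_cast this
  · simp only
    rw [hw, mul_div_cancel_right₀ _ hpm.ne']

theorem inv_add_digit_le {b : ℚ} (hb : b ∈ Sp' p) : b + (p : ℚ)⁻¹ ≤ padicNorm p b := by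
  obtain ⟨m, hm1, hm⟩ := exists_padicNorm_eq hb
  have h1 := le_sub_inv_padicNorm hb
  have hp1 : (1 : ℚ) < p := by exact_mod_cast hp.out.one_lt
  rw [hm] at h1 ⊢
  rcases hm1.eq_or_lt with rfl | h2
  · rw [pow_one] at h1 ⊢
    linarith
  · have h3 : p + 1 ≤ p ^ m := by
      have h4 := Nat.pow_le_pow_right hp.out.pos h2
      have h5 := hp.out.two_le
      nlinarith
    have h4 : (p : ℚ) + 1 ≤ (p : ℚ) ^ m := by exact_mod_cast h3
    have h5 : (p : ℚ)⁻¹ ≤ 1 := inv_le_one_of_one_le₀ hp1.le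
    linarith [hb.1.2.2]

end Digits

/-! ## Continuants -/

section Continuants

variable {p : ℕ} {a : ℕ → ℚ}

theorem rubanR_mul_rubanQ_sub (a : ℕ → ℚ) (n : ℕ) :
    rubanR a (n + 1) * rubanQ a n - rubanR a n * rubanQ a (n + 1) = (-1) ^ (n + 1) := by
  induction n with
  | zero => simp [rubanQ, rubanR]
  | succ n ih =>
    rw [rubanQ, rubanR, pow_succ, ← ih]
    ring

theorem rubanQ_congr {b : ℕ → ℚ} : ∀ {n : ℕ}, (∀ m < n, a m = b m) → rubanQ a n = rubanQ b n
  | 0, _ => rfl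
  | 1, _ => rfl
  | n + 2, h => by
    rw [rubanQ, rubanQ, h _ (by lia), rubanQ_congr fun m hm => h m (by lia),
      rubanQ_congr fun m hm => h m (by lia)]

theorem rubanR_congr {b : ℕ → ℚ} : ∀ {n : ℕ}, (∀ m < n, a m = b m) → rubanR a n = rubanR b n
  | 0, _ => rfl
  | 1, h => h 0 one_pos
  | n + 2, h => by
    rw [rubanR, rubanR, h _ (by lia), rubanR_congr fun m hm => h m (by lia),
      rubanR_congr fun m hm => h m (by lia)]

theorem hasPowDen_rubanQ (ha : ∀ i, a i ∈ Sp p) : ∀ n, HasPowDen p (rubanQ a n)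
  | 0 => HasPowDen.intCast 0
  | 1 => by simpa [rubanQ] using HasPowDen.intCast (p := p) 1
  | n + 2 => ((HasPowDen.mul (ha _).1 (hasPowDen_rubanQ ha _))).add (hasPowDen_rubanQ ha _)

theorem hasPowDen_rubanR (ha : ∀ i, a i ∈ Sp p) : ∀ n, HasPowDen p (rubanR a n)
  | 0 => by simpa [rubanR] using HasPowDen.intCast (p := p) 1
  | 1 => (ha 0).1
  | n + 2 => ((HasPowDen.mul (ha _).1 (hasPowDen_rubanR ha _))).add (hasPowDen_rubanR ha _)

variable [hp : Fact p.Prime]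

theorem padicNorm_rubanQ (ha : ∀ i, 1 ≤ i → a i ∈ Sp' p) (n : ℕ) :
    padicNorm p (rubanQ a n) < padicNorm p (rubanQ a (n + 1)) ∧
      padicNorm p (rubanQ a (n + 2)) = padicNorm p (a (n + 1)) * padicNorm p (rubanQ a (n + 1)) := by
  have hp1 : (1 : ℚ) < p := by exact_mod_cast hp.out.one_lt
  induction n with
  | zero => simp [rubanQ]
  | succ n ih =>
    have h1 := (ha (n + 1) (by lia)).2
    have h2 := (ha (n + 2) (by lia)).2
    have h0 := padicNorm.nonneg (p := p) (rubanQ a n)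
    have h3 : padicNorm p (rubanQ a (n + 1)) < padicNorm p (rubanQ a (n + 2)) := by
      rw [ih.2]
      exact lt_mul_of_one_lt_left (h0.trans_lt ih.1) (hp1.trans_le h1)
    have h4 : padicNorm p (rubanQ a (n + 1)) < padicNorm p (a (n + 2) * rubanQ a (n + 2)) := by
      rw [padicNorm.mul]
      exact h3.trans (lt_mul_of_one_lt_left ((h0.trans_lt ih.1).trans h3) (hp1.trans_le h2))
    refine ⟨h3, ?_⟩
    rw [rubanQ, padicNorm.add_eq_max_of_ne h4.ne', max_eq_left h4.le, padicNorm.mul]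

theorem padicNorm_rubanR_le (ha : ∀ i, 1 ≤ i → a i ∈ Sp' p) {s : ℕ}
    (hs : padicNorm p (a 0) ≤ (p : ℚ) ^ s) (n : ℕ) :
    padicNorm p (rubanR a n) ≤ (p : ℚ) ^ s * padicNorm p (rubanQ a (n + 1)) ∧
      padicNorm p (rubanR a (n + 1)) ≤ (p : ℚ) ^ s * padicNorm p (rubanQ a (n + 1)) := by
  have hp1 : (1 : ℚ) ≤ p := by exact_mod_cast hp.out.one_lt.le
  induction n with
  | zero => exact ⟨by simpa [rubanQ, rubanR] using one_le_pow₀ hp1, by simpa [rubanQ, rubanR]⟩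
  | succ n ih =>
    have h1 := padicNorm_rubanQ ha n
    have h2 := (padicNorm_rubanQ ha (n + 1)).1.le
    have h3 : (p : ℚ) ^ s * padicNorm p (rubanQ a (n + 1)) ≤
        (p : ℚ) ^ s * padicNorm p (rubanQ a (n + 2)) := by gcongr
    refine ⟨ih.2.trans h3, ?_⟩
    rw [rubanR]
    refine (padicNorm.nonarchimedean (p := p)).trans (max_le ?_ (ih.1.trans h3))
    rw [padicNorm.mul, h1.2, mul_left_comm]
    exact mul_le_mul_of_nonneg_left ih.2 (padicNorm.nonneg _)

/-- A solution of the continuant recursion is at most a constant times the `p`-adic norm of the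
denominators. -/
theorem le_padicNorm_rubanQ (ha : ∀ i, 1 ≤ i → a i ∈ Sp' p) {X : ℕ → ℚ} (hX0 : 0 ≤ X 0)
    (hX0' : X 0 ≤ 1) (hX1 : 0 ≤ X 1) (hX1' : X 1 ≤ p)
    (hX : ∀ n, X (n + 2) = a (n + 1) * X (n + 1) + X n) (n : ℕ) :
    (0 ≤ X n ∧ X n ≤ padicNorm p (rubanQ a (n + 1))) ∧
      0 ≤ X (n + 1) ∧ X (n + 1) ≤ p * padicNorm p (rubanQ a (n + 1)) := by
  have hp0 := natCast_prime_pos (p := p)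
  induction n with
  | zero => simp [rubanQ, *]
  | succ n ih =>
    obtain ⟨⟨h1, h2⟩, h3, h4⟩ := ih
    have ha' := ha (n + 1) (by lia)
    have h5 := (padicNorm_rubanQ ha n).2
    have h6 : 0 ≤ a (n + 1) := ha'.1.2.1
    have h7 := padicNorm.nonneg (p := p) (rubanQ a (n + 1))
    rw [h5, hX]
    refine ⟨⟨h3, h4.trans (mul_le_mul_of_nonneg_right ha'.2 h7)⟩, by positivity, ?_⟩
    calc a (n + 1) * X (n + 1) + X n
        ≤ a (n + 1) * (p * padicNorm p (rubanQ a (n + 1))) + padicNorm p (rubanQ a (n + 1)) := by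
          gcongr
      _ = (a (n + 1) + (p : ℚ)⁻¹) * (p * padicNorm p (rubanQ a (n + 1))) := by
          field_simp
      _ ≤ padicNorm p (a (n + 1)) * (p * padicNorm p (rubanQ a (n + 1))) := by
          gcongr
          exact inv_add_digit_le ha'
      _ = _ := by ring

theorem exists_padicNorm_rubanQ_eq (ha : ∀ i, 1 ≤ i → a i ∈ Sp' p) (n : ℕ) :
    ∃ l, padicNorm p (rubanQ a (n + 1)) = (p : ℚ) ^ l := by
  induction n with
  | zero => exact ⟨0, by simp [rubanQ]⟩
  | succ n ih =>
    obtain ⟨l, hl⟩ := ih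
    obtain ⟨m, -, hm⟩ := exists_padicNorm_eq (ha (n + 1) (by lia))
    exact ⟨m + l, by rw [(padicNorm_rubanQ ha n).2, hl, hm, pow_add]⟩

theorem pow_le_padicNorm_rubanQ (ha : ∀ i, 1 ≤ i → a i ∈ Sp' p) (n : ℕ) :
    (p : ℚ) ^ n ≤ padicNorm p (rubanQ a (n + 1)) := by
  induction n with
  | zero => simp [rubanQ]
  | succ n ih =>
    rw [(padicNorm_rubanQ ha n).2, pow_succ']
    exact mul_le_mul (ha (n + 1) (by lia)).2 ih (by positivity) (padicNorm.nonneg _)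

/-- After multiplication by a common factor the continuants are small integers. -/
theorem exists_int_continuants (ha0 : a 0 ∈ Sp p) (ha : ∀ i, 1 ≤ i → a i ∈ Sp' p) {s : ℕ}
    (hs : padicNorm p (a 0) ≤ (p : ℚ) ^ s) (n : ℕ) : ∃ D : ℚ, D ≠ 0 ∧ ∃ z : Fin 4 → ℤ,
      (z 0 : ℚ) = D * rubanQ a (n + 1) ∧ (z 1 : ℚ) = D * rubanQ a n ∧
      (z 2 : ℚ) = D * rubanR a (n + 1) ∧ (z 3 : ℚ) = D * rubanR a n ∧
      ∀ j, |(z j : ℚ)| ≤ (p : ℚ) ^ (s + 1) * padicNorm p (rubanQ a (n + 1)) ^ 2 := by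
  have hp0 := natCast_prime_pos (p := p)
  have hp1 : (1 : ℚ) ≤ p := by exact_mod_cast hp.out.one_lt.le
  have ha' : ∀ i, a i ∈ Sp p := fun i => by
    rcases Nat.eq_zero_or_pos i with rfl | h
    exacts [ha0, (ha i h).1]
  obtain ⟨l, hl⟩ := exists_padicNorm_rubanQ_eq ha n
  have hl1 : (p : ℚ) ^ l ≤ (p : ℚ) ^ (s + l) := pow_le_pow_right₀ hp1 (by lia)
  have hl2 : (p : ℚ) ^ s * (p : ℚ) ^ l = (p : ℚ) ^ (s + l) := (pow_add _ _ _).symm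
  have hR := padicNorm_rubanR_le ha hs n
  rw [hl, hl2] at hR
  obtain ⟨z₀, h₀⟩ := (hasPowDen_rubanQ ha' (n + 1)).exists_int (hl.trans_le hl1)
  obtain ⟨z₁, h₁⟩ := (hasPowDen_rubanQ ha' n).exists_int
    (((padicNorm_rubanQ ha n).1.le.trans_eq hl).trans hl1)
  obtain ⟨z₂, h₂⟩ := (hasPowDen_rubanR ha' (n + 1)).exists_int hR.2
  obtain ⟨z₃, h₃⟩ := (hasPowDen_rubanR ha' n).exists_int hR.1
  have hbound : ∀ {x : ℚ} {z : ℤ}, (z : ℚ) = x * (p : ℚ) ^ (s + l) → 0 ≤ x →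
      x ≤ p * (p : ℚ) ^ l → |(z : ℚ)| ≤ (p : ℚ) ^ (s + 1) * ((p : ℚ) ^ l) ^ 2 := by
    intro x z hz hx hx'
    rw [hz, abs_of_nonneg (by positivity)]
    calc x * (p : ℚ) ^ (s + l) ≤ p * (p : ℚ) ^ l * (p : ℚ) ^ (s + l) := by gcongr
      _ = _ := by ring
  have hle : (p : ℚ) ^ l ≤ p * (p : ℚ) ^ l := le_mul_of_one_le_left (by positivity) hp1
  have hQ := le_padicNorm_rubanQ ha (X := rubanQ a) le_rfl zero_le_one zero_le_one hp1
    (fun _ => rfl) n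
  have hR' := le_padicNorm_rubanQ ha (X := rubanR a) zero_le_one le_rfl ha0.2.1 ha0.2.2.le
    (fun _ => rfl) n
  rw [hl] at hQ hR' ⊢
  refine ⟨(p : ℚ) ^ (s + l), by positivity, ![z₀, z₁, z₂, z₃], ?_, ?_, ?_, ?_, ?_⟩
  · simpa [mul_comm] using h₀
  · simpa [mul_comm] using h₁
  · simpa [mul_comm] using h₂
  · simpa [mul_comm] using h₃
  · intro j
    fin_cases j
    exacts [hbound h₀ hQ.2.1 hQ.2.2, hbound h₁ hQ.1.1 (hQ.1.2.trans hle),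
      hbound h₂ hR'.2.1 hR'.2.2, hbound h₃ hR'.1.1 (hR'.1.2.trans hle)]

end Continuants

/-! ## Complete quotients -/

section CompleteQuotients

variable {p : ℕ} [hp : Fact p.Prime] {a b : ℕ → ℚ} {x y : ℕ → ℚ_[p]} {α : ℚ_[p]}

/-- `x` is the sequence of complete quotients of a continued fraction with digits `a`. -/
structure IsCompleteQuotients (a : ℕ → ℚ) (x : ℕ → ℚ_[p]) : Prop where
  step : ∀ n, x n = a n + (x (n + 1))⁻¹
  le_norm : ∀ n, (p : ℝ) ≤ ‖x (n + 1)‖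

namespace IsCompleteQuotients

theorem shift (h : IsCompleteQuotients a x) (n : ℕ) :
    IsCompleteQuotients (fun m => a (n + m)) (fun m => x (n + m)) :=
  ⟨fun m => h.step (n + m), fun m => h.le_norm (n + m)⟩

theorem norm_inv_lt_one (h : IsCompleteQuotients a x) (n : ℕ) : ‖(x (n + 1))⁻¹‖ < 1 := by
  rw [norm_inv]
  exact inv_lt_one_of_one_lt₀ (lt_of_lt_of_le (by exact_mod_cast hp.out.one_lt) (h.le_norm n))

theorem ne_zero (h : IsCompleteQuotients a x) (n : ℕ) : x (n + 1) ≠ 0 := by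
  rw [← norm_pos_iff]
  exact lt_of_lt_of_le (by exact_mod_cast hp.out.pos) (h.le_norm n)

theorem norm_sub_le (h : IsCompleteQuotients a x) (h' : IsCompleteQuotients a y) (k : ℕ) :
    ∀ n, ‖x n - y n‖ ≤ (1 / 2) ^ k := by
  have hp2 : (2 : ℝ) ≤ p := by exact_mod_cast hp.out.two_le
  induction k with
  | zero =>
    intro n
    rw [h.step, h'.step, add_sub_add_left_eq_sub, sub_eq_add_neg, pow_zero]
    refine (IsUltrametricDist.norm_add_le_max _ _).trans (max_le (h.norm_inv_lt_one n).le ?_)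
    rw [norm_neg]
    exact (h'.norm_inv_lt_one n).le
  | succ k ih =>
    intro n
    have h1 := h.le_norm n
    have h2 := h'.le_norm n
    have h3 := ih (n + 1)
    rw [h.step, h'.step, add_sub_add_left_eq_sub, inv_sub_inv (h.ne_zero n) (h'.ne_zero n),
      norm_div, norm_mul, norm_sub_rev, div_le_iff₀ (by nlinarith)]
    calc ‖x (n + 1) - y (n + 1)‖ ≤ (1 / 2) ^ k := h3
      _ = (1 / 2) ^ (k + 1) * 2 := by ring
      _ ≤ _ := by
        gcongr
        nlinarith

theorem unique (h : IsCompleteQuotients a x) (h' : IsCompleteQuotients a y) (n : ℕ) :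
    x n = y n := by
  rw [← sub_eq_zero, ← norm_le_zero_iff]
  exact ge_of_tendsto' (tendsto_pow_atTop_nhds_zero_of_lt_one (by norm_num) (by norm_num))
    fun k => norm_sub_le h h' k n

theorem head_eq (h : IsCompleteQuotients a x) (h' : IsCompleteQuotients b y) {n : ℕ}
    (ha : a n ∈ Sp p) (hb : b n ∈ Sp p) (hxy : x n = y n) :
    a n = b n ∧ x (n + 1) = y (n + 1) := by
  rw [h.step, h'.step] at hxy
  have h1 : a n = b n := by
    refine eq_of_padicNorm_sub_lt_one ha hb ?_
    have h2 : ((a n - b n : ℚ) : ℚ_[p]) = (y (n + 1))⁻¹ + -(x (n + 1))⁻¹ := by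
      push_cast
      linear_combination hxy
    have h3 : ‖((a n - b n : ℚ) : ℚ_[p])‖ < 1 := by
      rw [h2]
      refine (IsUltrametricDist.norm_add_le_max _ _).trans_lt (max_lt (h'.norm_inv_lt_one n) ?_)
      rw [norm_neg]
      exact h.norm_inv_lt_one n
    rw [Padic.eq_padicNorm] at h3
    exact_mod_cast h3
  rw [h1] at hxy
  exact ⟨h1, inv_injective (add_left_cancel hxy)⟩

theorem digits_eq (h : IsCompleteQuotients a x) (h' : IsCompleteQuotients b y)
    (ha : ∀ n, a n ∈ Sp p) (hb : ∀ n, b n ∈ Sp p) (hxy : x 0 = y 0) : a = b := by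
  have hall : ∀ n, x n = y n := fun n => by
    induction n with
    | zero => exact hxy
    | succ n ih => exact (head_eq h h' (ha n) (hb n) ih).2
  exact funext fun n => (head_eq h h' (ha n) (hb n) (hall n)).1

theorem zero_ne_zero (h : IsCompleteQuotients a x) (ha : a 0 ∈ Sp p) : x 0 ≠ 0 := by
  intro h0
  have h1 := h.step 0
  rw [h0] at h1
  have h2 : a 0 = 0 := by
    refine eq_of_padicNorm_sub_lt_one ha ⟨HasPowDen.intCast 0, le_rfl, natCast_prime_pos⟩ ?_
    have h3 : ‖((a 0 - 0 : ℚ) : ℚ_[p])‖ < 1 := by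
      rw [sub_zero, ← norm_neg, ← (eq_neg_of_add_eq_zero_right h1.symm)]
      exact h.norm_inv_lt_one 0
    rw [Padic.eq_padicNorm] at h3
    exact_mod_cast h3
  rw [h2, Rat.cast_zero, zero_add, eq_comm, inv_eq_zero] at h1
  exact h.ne_zero 0 h1

theorem zero_mul_add (h : IsCompleteQuotients a x) (n : ℕ) :
    x 0 * (rubanQ a (n + 1) * x (n + 1) + rubanQ a n) =
      rubanR a (n + 1) * x (n + 1) + rubanR a n := by
  induction n with
  | zero =>
    have h1 := h.ne_zero 0
    rw [h.step 0]
    simp only [rubanQ, rubanR]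
    push_cast
    field_simp
    ring
  | succ n ih =>
    have h1 : x (n + 1) * x (n + 2) = a (n + 1) * x (n + 2) + 1 := by
      rw [h.step (n + 1), add_mul, inv_mul_cancel₀ (h.ne_zero (n + 1))]
    simp only [rubanQ, rubanR]
    push_cast
    linear_combination x (n + 2) * ih -
      (x 0 * rubanQ a (n + 1) - rubanR a (n + 1)) * h1

end IsCompleteQuotients

theorem norm_rubanQ (ha : ∀ i, 1 ≤ i → a i ∈ Sp' p) (n : ℕ) :
    ‖(rubanQ a n : ℚ_[p])‖ < ‖(rubanQ a (n + 1) : ℚ_[p])‖ ∧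
      (p : ℝ) * ‖(rubanQ a (n + 1) : ℚ_[p])‖ ≤ ‖(rubanQ a (n + 2) : ℚ_[p])‖ := by
  simp only [Padic.eq_padicNorm]
  have h := padicNorm_rubanQ ha n
  refine ⟨by exact_mod_cast h.1, ?_⟩
  have h1 : p * padicNorm p (rubanQ a (n + 1)) ≤ padicNorm p (rubanQ a (n + 2)) := by
    rw [h.2]
    exact mul_le_mul_of_nonneg_right (ha _ (by lia)).2 (padicNorm.nonneg _)
  exact_mod_cast h1

theorem norm_rubanQ_pos (ha : ∀ i, 1 ≤ i → a i ∈ Sp' p) (n : ℕ) :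
    0 < ‖(rubanQ a (n + 1) : ℚ_[p])‖ :=
  (norm_nonneg _).trans_lt (norm_rubanQ ha n).1

theorem norm_convergent_sub (ha : ∀ i, 1 ≤ i → a i ∈ Sp' p) (n : ℕ) :
    ‖((rubanR a (n + 2) / rubanQ a (n + 2) : ℚ) : ℚ_[p]) -
      ((rubanR a (n + 1) / rubanQ a (n + 1) : ℚ) : ℚ_[p])‖ =
      (‖(rubanQ a (n + 1) : ℚ_[p])‖ * ‖(rubanQ a (n + 2) : ℚ_[p])‖)⁻¹ := by
  have h1 := norm_pos_iff.mp (norm_rubanQ_pos (p := p) ha n)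
  have h2 := norm_pos_iff.mp (norm_rubanQ_pos (p := p) ha (n + 1))
  have h3 : ((rubanR a (n + 2) * rubanQ a (n + 1) - rubanR a (n + 1) * rubanQ a (n + 2) : ℚ) :
      ℚ_[p]) = (-1) ^ (n + 2) := by
    rw [rubanR_mul_rubanQ_sub a (n + 1)]
    push_cast
    ring
  push_cast at h3 ⊢
  rw [div_sub_div _ _ h2 h1, mul_comm (rubanQ a (n + 2) : ℚ_[p]) (rubanR a (n + 1)), h3, norm_div,
    norm_pow, norm_neg, norm_one, one_pow, norm_mul, one_div, mul_comm]

theorem le_norm_rubanQ (ha : ∀ i, 1 ≤ i → a i ∈ Sp' p) (n : ℕ) :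
    (p : ℝ) ^ n ≤ ‖(rubanQ a (n + 1) : ℚ_[p])‖ := by
  rw [Padic.eq_padicNorm]
  exact_mod_cast pow_le_padicNorm_rubanQ ha n

theorem norm_convergent_sub_le (ha : ∀ i, 1 ≤ i → a i ∈ Sp' p) (n k : ℕ) :
    ‖((rubanR a (n + k + 1) / rubanQ a (n + k + 1) : ℚ) : ℚ_[p]) -
      ((rubanR a (n + 1) / rubanQ a (n + 1) : ℚ) : ℚ_[p])‖ ≤
      (‖(rubanQ a (n + 1) : ℚ_[p])‖ * ‖(rubanQ a (n + 2) : ℚ_[p])‖)⁻¹ := by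
  induction k with
  | zero =>
    simp only [add_zero, sub_self, norm_zero]
    positivity
  | succ k ih =>
    rw [← sub_add_sub_cancel]
    refine (IsUltrametricDist.norm_add_le_max _ _).trans (max_le ?_ ih)
    refine (norm_convergent_sub ha (n + k)).le.trans ?_
    have hmono : Monotone fun n => ‖(rubanQ a n : ℚ_[p])‖ :=
      monotone_nat_of_le_succ fun n => (norm_rubanQ ha n).1.le
    have h1 := norm_rubanQ_pos (p := p) ha n
    have h2 := norm_rubanQ_pos (p := p) ha (n + 1)
    gcongr
    · exact hmono (by lia)
    · exact hmono (by lia)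

theorem exists_isRubanValue (ha : ∀ i, 1 ≤ i → a i ∈ Sp' p) : ∃ α, IsRubanValue p a α := by
  refine cauchySeq_tendsto_of_complete
    (NonarchimedeanAddGroup.cauchySeq_of_tendsto_sub_nhds_zero ?_)
  rw [tendsto_zero_iff_norm_tendsto_zero]
  have hp1 : (1 : ℝ) < p := by exact_mod_cast hp.out.one_lt
  refine squeeze_zero (fun _ => norm_nonneg _) (fun n => ?_)
    (tendsto_pow_atTop_nhds_zero_of_lt_one (r := (p : ℝ)⁻¹) (by positivity)
      (inv_lt_one_of_one_lt₀ hp1))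
  rw [norm_convergent_sub ha n, inv_pow]
  have h1 := le_norm_rubanQ (p := p) ha n
  have h2 := (one_le_pow₀ hp1.le).trans (le_norm_rubanQ (p := p) ha (n + 1))
  gcongr
  nlinarith [norm_rubanQ_pos (p := p) ha n]

theorem IsRubanValue.norm_mul_sub (hα : IsRubanValue p a α) (ha : ∀ i, 1 ≤ i → a i ∈ Sp' p)
    (n : ℕ) : ‖rubanQ a n * α - rubanR a n‖ = ‖(rubanQ a (n + 1) : ℚ_[p])‖⁻¹ := by
  cases n with
  | zero => simp [rubanQ, rubanR]
  | succ n =>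
    have hpos := norm_rubanQ_pos (p := p) ha
    have hle : ∀ n, ‖α - ((rubanR a (n + 1) / rubanQ a (n + 1) : ℚ) : ℚ_[p])‖ ≤
        (‖(rubanQ a (n + 1) : ℚ_[p])‖ * ‖(rubanQ a (n + 2) : ℚ_[p])‖)⁻¹ := by
      intro n
      refine le_of_tendsto ((Filter.Tendsto.sub_const hα _).norm) ?_
      filter_upwards [Filter.eventually_ge_atTop n] with m hm
      obtain ⟨k, rfl⟩ := Nat.exists_eq_add_of_le hm
      exact norm_convergent_sub_le ha n k
    have heq : ‖α - ((rubanR a (n + 1) / rubanQ a (n + 1) : ℚ) : ℚ_[p])‖ =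
        (‖(rubanQ a (n + 1) : ℚ_[p])‖ * ‖(rubanQ a (n + 2) : ℚ_[p])‖)⁻¹ := by
      have h1 := norm_convergent_sub (p := p) ha n
      have h2 := (hle (n + 1)).trans_lt (inv_strictAnti₀ (mul_pos (hpos n) (hpos (n + 1)))
        (mul_lt_mul'' (norm_rubanQ ha (n + 1)).1 (norm_rubanQ ha (n + 2)).1 (norm_nonneg _)
          (norm_nonneg _)))
      rw [← h1] at h2 ⊢
      rw [← sub_add_sub_cancel, IsUltrametricDist.norm_add_eq_max_of_norm_ne_norm h2.ne,
        max_eq_right h2.le]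
    have h0 := norm_pos_iff.mp (hpos n)
    have h3 : rubanQ a (n + 1) * α - rubanR a (n + 1) = rubanQ a (n + 1) *
        (α - ((rubanR a (n + 1) / rubanQ a (n + 1) : ℚ) : ℚ_[p])) := by
      push_cast
      field_simp
    rw [h3, norm_mul, heq, mul_inv, mul_inv_cancel_left₀ (hpos n).ne']

theorem IsRubanValue.exists_isCompleteQuotients (hα : IsRubanValue p a α)
    (ha : ∀ i, 1 ≤ i → a i ∈ Sp' p) : ∃ x, IsCompleteQuotients a x ∧ x 0 = α := by
  have hE := hα.norm_mul_sub ha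
  have hne : ∀ n, rubanQ a n * α - rubanR a n ≠ 0 := fun n => by
    rw [← norm_pos_iff, hE]
    exact inv_pos.mpr (norm_rubanQ_pos ha n)
  refine ⟨fun n => Nat.casesOn n α fun n =>
    -(rubanQ a n * α - rubanR a n) / (rubanQ a (n + 1) * α - rubanR a (n + 1)), ⟨?_, ?_⟩, rfl⟩
  · rintro (_ | n)
    · simp [rubanQ, rubanR]
    · have h1 := hne (n + 1)
      have h2 : rubanQ a (n + 2) * α - rubanR a (n + 2) =
          a (n + 1) * (rubanQ a (n + 1) * α - rubanR a (n + 1)) +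
            (rubanQ a n * α - rubanR a n) := by
        simp only [rubanQ, rubanR]
        push_cast
        ring
      simp only [h2, inv_div]
      generalize rubanQ a (n + 1) * α - rubanR a (n + 1) = v at h1
      field_simp
      ring
  · intro n
    simp only [norm_div, norm_neg]
    rw [hE, hE, div_inv_eq_mul, inv_mul_eq_div, le_div_iff₀ (norm_rubanQ_pos ha n)]
    exact (norm_rubanQ ha n).2

theorem IsRubanValue.norm_sub_le {β : ℚ_[p]} (hα : IsRubanValue p a α) (hβ : IsRubanValue p b β)
    (ha : ∀ i, 1 ≤ i → a i ∈ Sp' p) (hb : ∀ i, 1 ≤ i → b i ∈ Sp' p) {n : ℕ}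
    (hab : ∀ m < n + 1, a m = b m) : ‖β - α‖ ≤ (‖(rubanQ a (n + 1) : ℚ_[p])‖ ^ 2)⁻¹ := by
  have h0 := norm_rubanQ_pos (p := p) ha n
  have h1 : ∀ {b : ℕ → ℚ} {β : ℚ_[p]}, IsRubanValue p b β → (∀ i, 1 ≤ i → b i ∈ Sp' p) →
      (∀ m < n + 1, a m = b m) →
      ‖rubanQ a (n + 1) * β - rubanR a (n + 1)‖ ≤ ‖(rubanQ a (n + 1) : ℚ_[p])‖⁻¹ := by
    intro b β hβ hb hab
    rw [rubanQ_congr hab] at h0 ⊢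
    rw [rubanR_congr hab, hβ.norm_mul_sub hb]
    exact inv_anti₀ h0 (norm_rubanQ hb _).1.le
  have h2 : ‖rubanQ a (n + 1) * (β - α)‖ ≤ ‖(rubanQ a (n + 1) : ℚ_[p])‖⁻¹ := by
    rw [show rubanQ a (n + 1) * (β - α) = (rubanQ a (n + 1) * β - rubanR a (n + 1)) +
      -(rubanQ a (n + 1) * α - rubanR a (n + 1)) by ring]
    refine (IsUltrametricDist.norm_add_le_max _ _).trans (max_le (h1 hβ hb hab) ?_)
    rw [norm_neg]
    exact h1 hα ha fun _ _ => rfl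
  rw [norm_mul, ← le_div_iff₀' h0, inv_div_left, ← sq] at h2
  exact h2

end CompleteQuotients

/-! ## Quasi-periodic continued fractions -/

section QuasiPeriodic

variable {p : ℕ} [hp : Fact p.Prime] {a d : ℕ → ℚ} {x : ℕ → ℚ_[p]}

theorem exists_common_denominator (q : Fin 3 → ℚ) :
    ∃ D : ℤ, D ≠ 0 ∧ ∃ z : Fin 3 → ℤ, ∀ j, (z j : ℚ) = D * q j := by
  obtain ⟨D, hD⟩ := IsLocalization.exist_integer_multiples_of_finite (nonZeroDivisors ℤ) q
  choose z hz using hD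
  refine ⟨D, nonZeroDivisors.coe_ne_zero D, z, fun j => ?_⟩
  have := hz j
  simpa [Submonoid.smul_def] using this

theorem IsCompleteQuotients.exists_quadratic (h : IsCompleteQuotients d x)
    (hd : ∀ i, d i ∈ Sp' p) {k : ℕ} (hk : 1 ≤ k) (hper : ∀ m, d (k + m) = d m) :
    ∃ C E F : ℤ, C ≠ 0 ∧ (C : ℚ_[p]) * x 0 ^ 2 = E * x 0 + F := by
  obtain ⟨k, rfl⟩ := Nat.exists_eq_add_of_le' hk
  have h1 : x (k + 1) = x 0 := by
    have h2 := h.shift (k + 1)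
    rw [funext hper] at h2
    exact h2.unique h 0
  have h2 := h.zero_mul_add k
  rw [h1] at h2
  obtain ⟨D, hD, z, hz⟩ := exists_common_denominator
    ![rubanQ d (k + 1), rubanR d (k + 1) - rubanQ d k, rubanR d k]
  have hz' : ∀ j, (z j : ℚ_[p]) = D * ((![rubanQ d (k + 1), rubanR d (k + 1) - rubanQ d k,
      rubanR d k] j : ℚ) : ℚ_[p]) := fun j => by exact_mod_cast congrArg (Rat.cast (K := ℚ_[p])) (hz j)
  refine ⟨z 0, z 1, z 2, ?_, ?_⟩
  · intro h0
    have h3 := hz 0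
    have h4 := norm_pos_iff.mp (norm_rubanQ_pos (p := p) (fun i _ => hd i) k)
    rw [h0] at h3
    simp [hD] at h3
    exact h4 (by rw [h3, Rat.cast_zero])
  · rw [hz', hz', hz']
    simp
    linear_combination (D : ℚ_[p]) * h2

theorem IsCompleteQuotients.exists_hasCoords (h : IsCompleteQuotients a x) (ha0 : a 0 ∈ Sp p)
    (ha : ∀ i, 1 ≤ i → a i ∈ Sp' p) {s : ℕ} (hs : padicNorm p (a 0) ≤ (p : ℚ) ^ s) (n : ℕ)
    {C : ℤ} (hC : C ≠ 0) : ∃ u w : ℚ_[p], w ≠ 0 ∧ w * x 0 = u ∧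
      HasCoords (C * x (n + 1)) (|(C : ℝ)| * p ^ (s + 1) * ‖(rubanQ a (n + 1) : ℚ_[p])‖ ^ 2) u ∧
      HasCoords (C * x (n + 1)) (|(C : ℝ)| * p ^ (s + 1) * ‖(rubanQ a (n + 1) : ℚ_[p])‖ ^ 2) w := by
  obtain ⟨D, hD, z, h0, h1, h2, h3, hz⟩ := exists_int_continuants ha0 ha hs n
  have hz' : ∀ j, |(z j : ℝ)| ≤ p ^ (s + 1) * ‖(rubanQ a (n + 1) : ℚ_[p])‖ ^ 2 := fun j => by
    rw [Padic.eq_padicNorm]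
    exact_mod_cast hz j
  have hC1 : (1 : ℝ) ≤ |(C : ℝ)| := by exact_mod_cast Int.one_le_abs hC
  have hcast : ∀ {v q : ℚ} {z : ℤ}, (z : ℚ) = v * q → (z : ℚ_[p]) = v * q := fun hv => by
    exact_mod_cast congrArg (Rat.cast (K := ℚ_[p])) hv
  have hmul : ∀ j, |(z j : ℝ)| ≤ |(C : ℝ)| * p ^ (s + 1) *
      ‖(rubanQ a (n + 1) : ℚ_[p])‖ ^ 2 := fun j => by
    rw [mul_assoc]
    exact (hz' j).trans (le_mul_of_one_le_left (by positivity) hC1)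
  have hmul' : ∀ j, |((C * z j : ℤ) : ℝ)| ≤ |(C : ℝ)| * p ^ (s + 1) *
      ‖(rubanQ a (n + 1) : ℚ_[p])‖ ^ 2 := fun j => by
    push_cast
    rw [abs_mul, mul_assoc]
    exact mul_le_mul_of_nonneg_left (hz' j) (abs_nonneg _)
  have hu := h.zero_mul_add n
  have hne : (rubanQ a (n + 1) * x (n + 1) + rubanQ a n : ℚ_[p]) ≠ 0 := by
    intro h0
    have h4 := (norm_rubanQ (p := p) ha n).1
    rw [← norm_neg, ← eq_neg_of_add_eq_zero_left h0, norm_mul] at h4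
    have h5 : (1 : ℝ) ≤ ‖x (n + 1)‖ := le_trans (by exact_mod_cast hp.out.one_lt.le) (h.le_norm n)
    exact absurd h4 (not_lt.mpr (le_mul_of_one_le_right (norm_nonneg _) h5))
  have hw : (D * C * (rubanQ a (n + 1) * x (n + 1) + rubanQ a n) : ℚ_[p]) =
      ((C * z 1 : ℤ) : ℚ_[p]) + z 0 * (C * x (n + 1)) := by
    push_cast
    rw [hcast h0, hcast h1]
    ring
  refine ⟨((C * z 3 : ℤ) : ℚ_[p]) + z 2 * (C * x (n + 1)),
    ((C * z 1 : ℤ) : ℚ_[p]) + z 0 * (C * x (n + 1)), ?_, ?_, ⟨_, _, rfl, hmul' 3, hmul 2⟩,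
    ⟨_, _, rfl, hmul' 1, hmul 0⟩⟩
  · rw [← hw]
    exact mul_ne_zero (mul_ne_zero (by exact_mod_cast hD) (by exact_mod_cast hC)) hne
  · push_cast
    rw [hcast h0, hcast h1, hcast h2, hcast h3]
    linear_combination (D * C : ℚ_[p]) * hu

theorem frequently_mul_le {lam : ℕ → ℕ} (hlam : ∀ i, 1 ≤ lam i) {L : ℕ → ℝ} {c q c₀ : ℝ}
    (hq : 0 < q) (hqc : q < c) (hc₀ : 0 < c₀)
    (hgrow : ∀ᶠ i in Filter.atTop, c * lam i ≤ lam (i + 1)) (hL : ∀ i, c₀ * lam i ≤ L (i + 1)) :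
    ∃ᶠ i in Filter.atTop, q * L i ≤ L (i + 1) := by
  by_contra hcon
  rw [Filter.not_frequently] at hcon
  obtain ⟨i₀, hi₀⟩ := Filter.eventually_atTop.mp (hgrow.and hcon)
  have h1 : ∀ j, c ^ j ≤ lam (i₀ + j) := fun j => by
    induction j with
    | zero => simpa using hlam i₀
    | succ j ih =>
      refine le_trans ?_ (hi₀ (i₀ + j) (by lia)).1
      rw [pow_succ']
      exact mul_le_mul_of_nonneg_left ih (hq.trans hqc).le
  have h2 : ∀ j, L (i₀ + j) ≤ q ^ j * L i₀ := fun j => by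
    induction j with
    | zero => simp
    | succ j ih =>
      refine (not_le.mp (hi₀ (i₀ + j) (by lia)).2).le.trans ?_
      rw [pow_succ', mul_assoc]
      exact mul_le_mul_of_nonneg_left ih hq.le
  obtain ⟨j, hj⟩ := pow_unbounded_of_one_lt (q * L i₀ / c₀) ((one_lt_div hq).mpr hqc)
  rw [div_lt_iff₀ hc₀, div_pow, div_mul_eq_mul_div, lt_div_iff₀ (by positivity)] at hj
  have h3 := hL (i₀ + j)
  have h4 := h2 (j + 1)
  have h5 := mul_le_mul_of_nonneg_left (h1 j) hc₀.le
  rw [pow_succ] at h4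
  rw [← add_assoc] at h4
  linarith

theorem eq_mod_of_quasiPeriodic {n k l : ℕ}
    (h : ∀ m, n ≤ m → m + 1 ≤ n + (l - 1) * k → a (m + k) = a m) (t : ℕ) (ht : t < l * k) :
    a (n + t) = a (n + t % k) := by
  induction t using Nat.strong_induction_on with
  | _ t ih =>
    rcases lt_or_ge t k with h1 | h1
    · rw [Nat.mod_eq_of_lt h1]
    · obtain ⟨t, rfl⟩ := Nat.exists_eq_add_of_le' h1
      have h2 : (l - 1) * k = l * k - k := Nat.sub_one_mul l k
      have hk : 0 < k := Nat.pos_of_ne_zero fun h0 => by simp [h0] at ht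
      rw [← add_assoc, h (n + t) (by lia) (by lia), ih t (by lia) (by lia), Nat.add_mod_right]

theorem finite_range_words {F : Set ℚ} (hF : F.Finite) (haF : ∀ i, a i ∈ F) {n k : ℕ → ℕ} {K : ℕ}
    (hk : ∀ i, 1 ≤ k i) (hK : ∀ i, k i ≤ K) :
    (Set.range fun i m => a (n i + m % k i)).Finite := by
  refine ((Set.finite_Iic K).image2
    (fun k (f : Fin K → ℚ) m => if h : m % k < K then f ⟨m % k, h⟩ else 0)
    (Set.Finite.pi' fun _ => hF)).subset ?_
  rintro _ ⟨i, rfl⟩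
  refine ⟨k i, hK i, fun j => a (n i + j), fun j => haF _, ?_⟩
  funext m
  have : m % k i < K := (Nat.mod_lt m (hk i)).trans_le (hK i)
  simp [this]

theorem ultimatelyPeriodic_of_eq {n k : ℕ} (hk : 1 ≤ k)
    (h : ∀ m, n ≤ m → a m = a (n + (m - n) % k)) : UltimatelyPeriodic a := by
  refine ⟨n, k, hk, fun m hm => ?_⟩
  rw [h m hm, h (m + k) (by lia), Nat.sub_add_comm hm, Nat.add_mod_right]

theorem log_le_log_norm_rubanQ (ha : ∀ i, 1 ≤ i → a i ∈ Sp' p) (n : ℕ) :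
    n * Real.log p ≤ Real.log ‖(rubanQ a (n + 1) : ℚ_[p])‖ := by
  have hp0 : (0 : ℝ) < p := by exact_mod_cast hp.out.pos
  rw [← Real.log_pow]
  exact Real.log_le_log (by positivity) (le_norm_rubanQ ha n)

theorem exists_padicNorm_le_pow (habound : ∃ A : ℝ, ∀ i, (padicNorm p (a i) : ℝ) ≤ A) :
    ∃ s : ℕ, ∀ i, padicNorm p (a i) ≤ (p : ℚ) ^ s := by
  obtain ⟨A, hA⟩ := habound
  obtain ⟨s, hs⟩ := pow_unbounded_of_one_lt A
    (show (1 : ℝ) < p by exact_mod_cast hp.out.one_lt)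
  exact ⟨s, fun i => by exact_mod_cast (hA i).trans hs.le⟩

/-- The value of a quasi-periodic continued fraction is very well approximated by the value of the
ultimately periodic continued fraction with the same preperiod and word. -/
theorem exists_isApproximation {α : ℚ_[p]} (ha0 : a 0 ∈ Sp p) (ha : ∀ i, 1 ≤ i → a i ∈ Sp' p)
    (hα : IsRubanValue p a α) (hnper : ¬ UltimatelyPeriodic a) {s : ℕ}
    (hs : padicNorm p (a 0) ≤ (p : ℚ) ^ s) {N k l : ℕ} (hk : 1 ≤ k)
    (hqp : ∀ m, N + 1 ≤ m → m + 1 ≤ N + 1 + (l - 1) * k → a (m + k) = a m)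
    {y : ℕ → ℚ_[p]} (hy : IsCompleteQuotients (fun m => a (N + 1 + m % k)) y) {C : ℤ} (hC : C ≠ 0)
    {η : ℝ} (hη : 0 ≤ η)
    (hgood : (4 + η) * Real.log ‖(rubanQ a (N + 1) : ℚ_[p])‖ ≤
      Real.log ‖(rubanQ a (N + l * k + 1) : ℚ_[p])‖) :
    ∃ ξ, IsApproximation ((C : ℚ_[p]) * y 0) α η (|(C : ℝ)| * p ^ (s + 1))
      (Real.log ‖(rubanQ a (N + 1) : ℚ_[p])‖) ξ := by
  set b : ℕ → ℚ := fun m => if m < N + 1 then a m else a (N + 1 + (m - (N + 1)) % k) with hb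
  have hba : ∀ m < N + 1, a m = b m := fun m hm => (if_pos hm).symm
  have hbt : ∀ m, b (N + 1 + m) = a (N + 1 + m % k) := fun m => by
    rw [hb]
    simp only [if_neg (by lia : ¬N + 1 + m < N + 1), Nat.add_sub_cancel_left]
  have hba' : ∀ m < N + l * k + 1, a m = b m := fun m hm => by
    rcases lt_or_ge m (N + 1) with h | h
    · exact hba m h
    · obtain ⟨t, rfl⟩ := Nat.exists_eq_add_of_le h
      rw [hbt]
      exact eq_mod_of_quasiPeriodic hqp t (by lia)
  have hb' : ∀ i, 1 ≤ i → b i ∈ Sp' p := fun i hi => by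
    simp only [hb]
    split_ifs
    exacts [ha i hi, ha _ (by lia)]
  have hb0 : b 0 = a 0 := (hba 0 (by lia)).symm
  obtain ⟨ξ, hξ⟩ := exists_isRubanValue (p := p) hb'
  obtain ⟨x, hx, hx0⟩ := hα.exists_isCompleteQuotients ha
  obtain ⟨z, hz, hz0⟩ := hξ.exists_isCompleteQuotients hb'
  have hω : z (N + 1) = y 0 := by
    have h1 := hz.shift (N + 1)
    simp only [hbt] at h1
    exact h1.unique hy 0
  have hQ := norm_rubanQ_pos (p := p) ha
  refine ⟨ξ, ?_, ?_, ?_⟩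
  · intro h
    have hSp : ∀ {c : ℕ → ℚ}, c 0 ∈ Sp p → (∀ i, 1 ≤ i → c i ∈ Sp' p) → ∀ i, c i ∈ Sp p :=
      fun h0 h1 i => by
        rcases Nat.eq_zero_or_pos i with rfl | h
        exacts [h0, (h1 i h).1]
    have hab : a = b := hx.digits_eq hz (hSp ha0 ha) (hSp (hb0 ▸ ha0) hb')
      (by rw [hx0, hz0, h])
    refine hnper (ultimatelyPeriodic_of_eq (n := N + 1) hk fun m hm => ?_)
    rw [← hbt, Nat.add_sub_cancel' hm, ← hab]
  · refine (hα.norm_sub_le hξ ha hb' hba').trans ?_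
    have h0 : 0 ≤ Real.log ‖(rubanQ a (N + 1) : ℚ_[p])‖ :=
      le_trans (mul_nonneg (Nat.cast_nonneg _) (Real.log_natCast_nonneg _))
        (log_le_log_norm_rubanQ ha N)
    rw [← Real.exp_log (pow_pos (hQ (N + l * k)) 2), ← Real.exp_neg, Real.log_pow]
    refine Real.exp_le_exp.mpr ?_
    push_cast
    nlinarith
  · obtain ⟨u, w, hw0, hwu, hu, hw⟩ := hz.exists_hasCoords (hb0 ▸ ha0) hb' (hb0 ▸ hs) N hC
    rw [hω, ← rubanQ_congr hba] at hu hw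
    have hexp : Real.exp (2 * Real.log ‖(rubanQ a (N + 1) : ℚ_[p])‖) =
        ‖(rubanQ a (N + 1) : ℚ_[p])‖ ^ 2 := by
      rw [two_mul, Real.exp_add, Real.exp_log (hQ N), sq]
    rw [hz0] at hwu
    rw [hexp]
    exact ⟨u, w, hw0, hwu, hu, hw⟩

end QuasiPeriodic

theorem transcendental_of_isRubanValue {p : ℕ} [hp : Fact p.Prime] {a : ℕ → ℚ} (ha0 : a 0 ∈ Sp p)
    (ha : ∀ i, 1 ≤ i → a i ∈ Sp' p) {n lam k : ℕ → ℕ} (hmono : StrictMono n) (hpos : 1 ≤ n 0)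
    (hlam : ∀ i, 1 ≤ lam i) (hk : ∀ i, 1 ≤ k i) (hqpe : ∀ i, n (i + 1) = n i + lam i * k i)
    (hqp2 : ∀ i m, n i ≤ m → m + 1 ≤ n i + (lam i - 1) * k i → a (m + k i) = a m)
    (hnper : ¬ UltimatelyPeriodic a)
    (habound : ∃ A : ℝ, ∀ i, (padicNorm p (a i) : ℝ) ≤ A) (hkbound : ∃ K : ℕ, ∀ i, k i ≤ K)
    {c : ℝ} (hc : 4 < c) (hgrow : ∀ᶠ i in Filter.atTop, c * lam i ≤ lam (i + 1))
    {α : ℚ_[p]} (hα : IsRubanValue p a α) : Transcendental ℚ α := by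
  have hp1 : (1 : ℝ) < p := by exact_mod_cast hp.out.one_lt
  have hlogp := Real.log_pos hp1
  obtain ⟨s, hs⟩ := exists_padicNorm_le_pow habound
  obtain ⟨K, hK⟩ := hkbound
  obtain ⟨N, hN⟩ : ∃ N : ℕ → ℕ, ∀ i, n i = N i + 1 :=
    ⟨fun i => n i - 1, fun i => (Nat.sub_add_cancel (hpos.trans (hmono.monotone (Nat.zero_le i)))).symm⟩
  have hNi : ∀ i, i ≤ N i := fun i => by
    induction i with
    | zero => exact Nat.zero_le _
    | succ i ih =>
      have := hmono (Nat.lt_succ_self i)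
      rw [hN, hN] at this
      lia
  have hNs : ∀ i, N (i + 1) = N i + lam i * k i := fun i => by
    have := hqpe i
    rw [hN, hN] at this
    lia
  obtain ⟨η, hη0, hη1, hηc⟩ : ∃ η : ℝ, 0 < η ∧ η ≤ 1 ∧ 4 + η < c :=
    ⟨min 1 ((c - 4) / 2), lt_min one_pos (by linarith), min_le_left _ _, by
      linarith [min_le_right 1 ((c - 4) / 2)]⟩
  have hfreq := frequently_mul_le (L := fun i => Real.log ‖(rubanQ a (N i + 1) : ℚ_[p])‖) hlam
    (by linarith : 0 < 4 + η) hηc hlogp hgrow fun i => by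
      refine le_trans ?_ (log_le_log_norm_rubanQ ha (N (i + 1)))
      rw [mul_comm]
      refine mul_le_mul_of_nonneg_right ?_ hlogp.le
      have := Nat.le_mul_of_pos_right (lam i) (hk i)
      exact_mod_cast (by rw [hNs]; lia : lam i ≤ N (i + 1))
  have hdigit : ∀ i, a i ∈ {b | b ∈ Sp p ∧ padicNorm p b ≤ (p : ℚ) ^ s} := fun i => by
    refine ⟨?_, hs i⟩
    rcases Nat.eq_zero_or_pos i with rfl | h
    exacts [ha0, (ha i h).1]
  have hfin := finite_range_words (finite_digits s) hdigit (n := n) hk hK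
  obtain ⟨d, hd⟩ : ∃ d : ℕ → ℚ, ∃ᶠ i in Filter.atTop,
      (4 + η) * Real.log ‖(rubanQ a (N i + 1) : ℚ_[p])‖ ≤
        Real.log ‖(rubanQ a (N (i + 1) + 1) : ℚ_[p])‖ ∧ (fun m => a (n i + m % k i)) = d := by
    by_contra hcon
    simp only [not_exists, Filter.not_frequently] at hcon
    refine hfreq ?_
    filter_upwards [(Filter.eventually_all_finite hfin).mpr fun d _ => hcon d] with i hi h
    exact hi _ ⟨i, rfl⟩ ⟨h, rfl⟩
  obtain ⟨i₀, -, hi₀⟩ := hd.exists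
  have hdSp : ∀ m, d m ∈ Sp' p := fun m => by
    rw [← hi₀]
    exact ha _ (by have := hN i₀; lia)
  obtain ⟨ω, hω⟩ := exists_isRubanValue (p := p) fun i _ => hdSp i
  obtain ⟨y, hy, -⟩ := hω.exists_isCompleteQuotients fun i _ => hdSp i
  obtain ⟨C, E, F, hC, hquad⟩ := hy.exists_quadratic hdSp (hk i₀) fun m => by
    subst hi₀
    exact congrArg (fun t => a (n i₀ + t)) (Nat.add_mod_left _ _)
  obtain ⟨x, hx, hx0⟩ := hα.exists_isCompleteQuotients ha
  refine transcendental_of_isApproximation (Ω := C * y 0) (T := E) (N₀ := C * F)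
    (K := |(C : ℝ)| * p ^ (s + 1)) (hx0 ▸ hx.zero_ne_zero ha0) ?_ hη0 hη1 ?_ fun B => ?_
  · push_cast
    linear_combination (C : ℚ_[p]) * hquad
  · have hC1 : (1 : ℝ) ≤ |(C : ℝ)| := by exact_mod_cast Int.one_le_abs hC
    exact one_le_mul_of_one_le_of_one_le hC1 (one_le_pow₀ hp1.le)
  · obtain ⟨i, ⟨hgood, hword⟩, hi⟩ :=
      (hd.and_eventually (Filter.eventually_ge_atTop ⌈B / Real.log p⌉₊)).exists
    refine ⟨_, ?_, exists_isApproximation ha0 ha hα hnper (hs 0) (hk i)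
      (hN i ▸ hqp2 i) (y := y) (by rw [← hN, hword]; exact hy) hC hη0.le (by rwa [← hNs])⟩
    refine le_trans ?_ (log_le_log_norm_rubanQ ha (N i))
    rw [← div_le_iff₀ hlogp]
    exact (Nat.le_ceil _).trans (by exact_mod_cast hi.trans (hNi i))

theorem eventually_mul_le_of_lt_liminf {lam : ℕ → ℕ} (hlam : ∀ i, 1 ≤ lam i) {b : ℝ}
    (h : b < Filter.liminf (fun i => (lam (i + 1) : ℝ) / (lam i : ℝ)) Filter.atTop) :
    ∃ c, b < c ∧ ∀ᶠ i in Filter.atTop, c * lam i ≤ lam (i + 1) := by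
  obtain ⟨c, hbc, hc⟩ := exists_between h
  refine ⟨c, hbc, ?_⟩
  filter_upwards [Filter.eventually_lt_of_lt_liminf hc
    (Filter.isBoundedUnder_of ⟨0, fun i => by positivity⟩)] with i hi
  rw [lt_div_iff₀ (by exact_mod_cast hlam i)] at hi
  exact hi.le

/-- **Theorem 3.** A quasi-periodic Ruban continued fraction with exact quasi-period
structure `n_{i+1} = n_i + λ_i k_i`, non-ultimately-periodic partial quotients, bounded
`|a_i|_p` and `k_i`, and `liminf λ_i / λ_{i-1} > 4`, has value that is quadratic
irrational or transcendental. -/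
theorem ruban_exactQuasiPeriodic_quadratic_or_transcendental
    (p : ℕ) [Fact p.Prime]
    (a : ℕ → ℚ) (ha0 : a 0 ∈ Sp p) (ha : ∀ i, 1 ≤ i → a i ∈ Sp' p)
    (n lam k : ℕ → ℕ)
    (hmono : StrictMono n) (hpos : 1 ≤ n 0)
    (hlam : ∀ i, 1 ≤ lam i) (hk : ∀ i, 1 ≤ k i)
    (hqpe : ∀ i, n (i + 1) = n i + lam i * k i)
    (hqp2 : ∀ i m, n i ≤ m → m + 1 ≤ n i + (lam i - 1) * k i → a (m + k i) = a m)
    (hnper : ¬ UltimatelyPeriodic a)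
    (habound : ∃ A : ℝ, ∀ i, (padicNorm p (a i) : ℝ) ≤ A)
    (hkbound : ∃ K : ℕ, ∀ i, k i ≤ K)
    (hliminf : (4 : ℝ) <
      Filter.liminf (fun i => (lam (i + 1) : ℝ) / (lam i : ℝ)) Filter.atTop)
    (α : ℚ_[p]) (hα : IsRubanValue p a α) :
    (minpoly ℚ α).natDegree = 2 ∨ Transcendental ℚ α := by
  obtain ⟨c, hc, hgrow⟩ := eventually_mul_le_of_lt_liminf hlam hliminf
  exact Or.inr (transcendental_of_isRubanValue ha0 ha hmono hpos hlam hk hqpe hqp2 hnper habound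
    hkbound hc hgrow hα)
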